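/- arXiv:1407.1700 — 2 statements merged into one kernel-verified Lean document; each statement's English description precedes it below -/
import Mathlib

section
/- Let X be a Polish space, P a point process on X of first order, n ≥ 2, and q_1, …, q_n ∈ (0,1) with q_1 + … + q_n = 1. If the n-fold splitting factorization S^n_q(P) = Γ_{q_1}(P) ⊗ ⋯ ⊗ Γ_{q_n}(P) holds, then the Campbell measure of Γ_{q_1}(P) satisfies, for every non-negative measurable h on X × M··(X), C_{Γ_{q_1}(P)}(h) = ∫ Γ_{q_1}(P)(dκ) ∫ h(x, κ + δ_x) q_1 ν_P(dx); i.e. Γ_{q_1}(P) has the constant Papangelou kernel q_1 ν_P, and hence Γ_{q_1}(P) = Π_{q_1 ν_P}. -/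
open MeasureTheory ENNReal

noncomputable section

namespace PoissonSplitting

variable {X : Type*} [MeasurableSpace X] [MetricSpace X]

/-- `expNeg a = e^{-a}` for an extended nonnegative real `a`. -/
def expNeg (a : ℝ≥0∞) : ℝ≥0∞ := if a = ∞ then 0 else ENNReal.ofReal (Real.exp (-a.toReal))

/-- A (Radon) point measure on `X`: a locally finite countable sum of Dirac measures. -/
def IsPointMeasure (μ : Measure X) : Prop :=
  (∃ D : ℕ → Option X, μ = Measure.sum fun n => (D n).elim 0 Measure.dirac) ∧
    IsLocallyFiniteMeasure μ

/-- The class `U` of nonnegative bounded measurable functions on `X` whose support is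
contained in some bounded set. -/
def MemU (f : X → ℝ) : Prop :=
  Measurable f ∧ (∀ x, 0 ≤ f x) ∧ (∃ C, ∀ x, f x ≤ C) ∧
    Bornology.IsBounded (Function.support f)

/-- The pairing `ζ_f(ν) = ν(f)`, as an extended nonnegative real. -/
def pairing (f : X → ℝ) (ν : Measure X) : ℝ≥0∞ := ∫⁻ x, ENNReal.ofReal (f x) ∂ν

/-- The Laplace transform of a law `P` on measures: `L_P(f) = ∫ e^{-ν(f)} P(dν)`. -/
def laplaceT (P : Measure (Measure X)) (f : X → ℝ) : ℝ≥0∞ := ∫⁻ ν, expNeg (pairing f ν) ∂P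

/-- `T` is the independent `q`-thinning `T^μ_q` of the point measure `μ`:
the probability law, supported on point-measure subconfigurations of `μ`, whose Laplace
transform on test functions `f ∈ U` is
`T(e^{-ζ_f}) = ∏_{x∈μ}(1-q+q e^{-f(x)})^{μ({x})} = exp(∫ log(1-q+q e^{-f}) dμ)`. -/
def IsThinning (q : ℝ) (μ : Measure X) (T : Measure (Measure X)) : Prop :=
  IsProbabilityMeasure T ∧ (∀ᵐ ν ∂T, IsPointMeasure ν ∧ ν ≤ μ) ∧
    ∀ f : X → ℝ, MemU f →
      laplaceT T f =
        expNeg (∫⁻ x, ENNReal.ofReal (-Real.log (1 - q + q * Real.exp (-f x))) ∂μ)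

/-- `P` is the Poisson point process `Π_ϱ` with intensity (first moment) measure `ϱ`:
the point process with Laplace transform `L_P(f) = exp(-ϱ(1 - e^{-f}))`, `f ∈ U`. -/
def IsPoissonPP (ϱ : Measure X) (P : Measure (Measure X)) : Prop :=
  IsProbabilityMeasure P ∧ (∀ᵐ μ ∂P, IsPointMeasure μ) ∧
    ∀ f : X → ℝ, MemU f →
      laplaceT P f = expNeg (∫⁻ x, ENNReal.ofReal (1 - Real.exp (-f x)) ∂ϱ)

/-- A point process: a probability law on the point measures of `X`. -/
def IsPointProcess (P : Measure (Measure X)) : Prop :=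
  IsProbabilityMeasure P ∧ ∀ᵐ μ ∂P, IsPointMeasure μ

/-- The first moment (intensity) measure `ν_P` of a point process `P`:
`ν_P(B) = ∫ μ(B) P(dμ)`. -/
def momentMeasure (P : Measure (Measure X)) : Measure X := P.bind id

/-- `P` is of first order if its first moment measure is a Radon (locally finite) measure. -/
def IsFirstOrder (P : Measure (Measure X)) : Prop := IsLocallyFiniteMeasure (momentMeasure P)

end PoissonSplitting

namespace PoissonSplitting

variable {X : Type*} [MeasurableSpace X] [MetricSpace X]

/-- The sequential splitting functional: `seqThinInt Th m s μ h` is the iterated integral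
`∫ Th(s₁,μ)(dκ₁) ∫ Th(s₂,μ-κ₁)(dκ₂) ⋯ ∫ Th(s_m, μ-(κ₁+⋯+κ_{m-1}))(dκ_m)
  h(κ₁,…,κ_m, μ-(κ₁+⋯+κ_m))`,
i.e. the integral of `h` against the law `T^μ_{(s₁,…,s_m)}` partitioning `μ` into `m+1`
parts, where `Th s` is an independent `s`-thinning kernel. -/
def seqThinInt (Th : ℝ → Measure X → Measure (Measure X)) :
    (m : ℕ) → (Fin m → ℝ) → Measure X → ((Fin (m + 1) → Measure X) → ℝ≥0∞) → ℝ≥0∞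
  | 0, _, μ, h => h fun _ => μ
  | m + 1, s, μ, h =>
      ∫⁻ κ, seqThinInt Th m (fun i => s i.succ) (μ - κ) (fun l => h (Fin.cons κ l))
        ∂(Th (s 0) μ)

/-- Given probabilities `q₀,…,q_m`, the associated sequential survival probabilities
`s_j = q_j / (q_j + ⋯ + q_m)`. -/
def splitProbs {m : ℕ} (q : Fin (m + 1) → ℝ) : Fin m → ℝ :=
  fun j => q j.castSucc / ∑ i ∈ Finset.Ici j.castSucc, q i

end PoissonSplitting


open MeasureTheory ENNReal PoissonSplitting


set_option linter.unusedSectionVars false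

namespace PSAux

/-- natural-number valued -/
def IsN (a : ℝ≥0∞) : Prop := ∃ k : ℕ, a = k

lemma IsN.tsum {a : ℕ → ℝ≥0∞} (h : ∀ n, IsN (a n)) (hf : ∑' n, a n ≠ ∞) : IsN (∑' n, a n) := by
  choose k hk using h
  have h1 : ∑' n, a n = ∑' (p : Σ n, Fin (k n)), (1 : ℝ≥0∞) := by
    rw [ENNReal.tsum_sigma']
    congr 1; ext n
    rw [hk n]
    simp
  rw [ENNReal.tsum_one] at h1
  rw [h1] at hf ⊢
  have hne : ENat.card (Σ n, Fin (k n)) ≠ ⊤ := fun h => hf (by rw [h]; simp)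
  obtain ⟨m, hm⟩ := ENat.ne_top_iff_exists.1 hne
  refine ⟨m, ?_⟩
  rw [← hm]; simp

lemma IsN.add {a b : ℝ≥0∞} (ha : IsN a) (hb : IsN b) : IsN (a + b) := by
  obtain ⟨k, rfl⟩ := ha
  obtain ⟨l, rfl⟩ := hb
  exact ⟨k + l, by push_cast; rfl⟩

lemma IsN.sub {a b : ℝ≥0∞} (ha : IsN a) (hb : IsN b) : IsN (a - b) := by
  obtain ⟨k, rfl⟩ := ha
  obtain ⟨l, rfl⟩ := hb
  exact ⟨k - l, by push_cast; rfl⟩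

lemma IsN.one_le {a : ℝ≥0∞} (ha : IsN a) (h : a ≠ 0) : 1 ≤ a := by
  obtain ⟨k, rfl⟩ := ha
  have : k ≠ 0 := by simpa using h
  exact_mod_cast Nat.one_le_iff_ne_zero.2 this

/-- countable sum of Diracs -/
def IsDS {X : Type*} [MeasurableSpace X] (μ : Measure X) : Prop :=
  ∃ D : ℕ → Option X, μ = Measure.sum fun n => (D n).elim 0 Measure.dirac

section
variable {X : Type*} [MeasurableSpace X]

lemma IsDS.zero : IsDS (0 : Measure X) := ⟨fun _ => none, by simp⟩

lemma IsDS.sum {μ : ℕ → Measure X} (h : ∀ n, IsDS (μ n)) : IsDS (Measure.sum μ) := by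
  choose D hD using h
  refine ⟨fun n => D n.unpair.1 n.unpair.2, ?_⟩
  have : μ = fun n => Measure.sum fun i => (D n i).elim 0 Measure.dirac := funext hD
  rw [this, Measure.sum_sum]
  ext s hs
  rw [Measure.sum_apply _ hs, Measure.sum_apply _ hs]
  exact (Nat.pairEquiv.symm.tsum_eq (fun p : ℕ × ℕ => ((D p.1 p.2).elim 0 Measure.dirac : Measure X) s)).symm

lemma IsDS.add_dirac {μ : Measure X} (h : IsDS μ) (x : X) : IsDS (μ + Measure.dirac x) := by
  obtain ⟨D, rfl⟩ := h
  refine ⟨fun n => Nat.casesOn n (some x) D, ?_⟩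
  ext s hs
  rw [Measure.add_apply, Measure.sum_apply _ hs, Measure.sum_apply _ hs,
    tsum_eq_zero_add' (f := fun i => ((Nat.casesOn i (some x) D : Option X).elim 0
      Measure.dirac : Measure X) s) ENNReal.summable, add_comm]
  rfl

lemma IsDS.isN {μ : Measure X} (h : IsDS μ) {B : Set X} (hB : MeasurableSet B) (hf : μ B ≠ ∞) :
    IsN (μ B) := by
  obtain ⟨D, rfl⟩ := h
  rw [Measure.sum_apply _ hB] at hf ⊢
  refine IsN.tsum (fun n => ?_) hf
  cases D n with
  | none => exact ⟨0, by simp⟩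
  | some x =>
    by_cases hx : x ∈ B
    · exact ⟨1, by simp [hB, hx]⟩
    · exact ⟨0, by simp [hB, hx]⟩

variable [MeasurableSpace.CountablySeparated X] [MeasurableSingletonClass X]

lemma exists_atom (μ : Measure X) [IsFiniteMeasure μ]
    (h : ∀ B, MeasurableSet B → IsN (μ B)) (h0 : μ ≠ 0) : ∃ x, 1 ≤ μ {x} := by
  classical
  obtain ⟨B, hBm, hBs⟩ := exists_seq_separating X (p := MeasurableSet)
    MeasurableSet.empty Set.univ
  let C : ℕ → Set X := fun n => Nat.rec Set.univ
    (fun k c => if μ (c ∩ B k) = 0 then c \ B k else c ∩ B k) n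
  have hC1 : ∀ k, C (k+1) = if μ (C k ∩ B k) = 0 then C k \ B k else C k ∩ B k := fun k => rfl
  have hm : ∀ k, MeasurableSet (C k) ∧ μ (C k) ≠ 0 := by
    intro k
    induction k with
    | zero => exact ⟨MeasurableSet.univ, by simpa [C] using h0⟩
    | succ k ih =>
      rw [hC1]
      split_ifs with hz
      · refine ⟨ih.1.diff (hBm k), fun h' => ih.2 ?_⟩
        rw [← measure_inter_add_sdiff (C k) (hBm k), hz, h', add_zero]
      · exact ⟨ih.1.inter (hBm k), hz⟩
  have hanti : Antitone C := antitone_nat_of_succ_le fun k => by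
    rw [hC1]; split_ifs
    · exact Set.sdiff_subset
    · exact Set.inter_subset_left
  have hlim := tendsto_measure_iInter_atTop (μ := μ) (fun k => (hm k).1.nullMeasurableSet) hanti
    ⟨0, measure_ne_top _ _⟩
  have hge : 1 ≤ μ (⋂ n, C n) :=
    ge_of_tendsto' hlim fun k => (h _ (hm k).1).one_le (hm k).2
  have hne : (⋂ n, C n).Nonempty := by
    by_contra hne
    rw [Set.not_nonempty_iff_eq_empty] at hne
    simp [hne] at hge
  obtain ⟨x, hx⟩ := hne
  refine ⟨x, hge.trans (measure_mono ?_)⟩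
  intro y hy
  refine hBs y (Set.mem_univ _) x (Set.mem_univ _) fun n => ?_
  have h1 := Set.mem_iInter.1 hx (n+1)
  have h2 := Set.mem_iInter.1 hy (n+1)
  rw [hC1] at h1 h2
  split_ifs at h1 h2
  · exact ⟨fun h => (h2.2 h).elim, fun h => (h1.2 h).elim⟩
  · exact ⟨fun _ => h1.2, fun _ => h2.2⟩

lemma isDS_of_finite (n : ℕ) : ∀ (μ : Measure X), 
    (∀ B, MeasurableSet B → IsN (μ B)) → μ Set.univ = n → IsDS μ := by
  induction n with
  | zero =>
    intro μ _ h
    have : μ = 0 := by simpa using h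
    rw [this]; exact IsDS.zero
  | succ n ih =>
    intro μ h hn
    have : IsFiniteMeasure μ := ⟨by rw [hn]; exact ENNReal.natCast_lt_top _⟩
    obtain ⟨x, hx⟩ := exists_atom μ h (by rintro rfl; simp at hn; norm_cast at hn)
    have hle : Measure.dirac x ≤ μ := by
      refine Measure.le_iff.2 fun s hs => ?_
      by_cases hxs : x ∈ s
      · rw [Measure.dirac_apply' _ hs]
        simp only [hxs, Set.indicator_of_mem, Pi.one_apply]
        exact hx.trans (measure_mono (by simpa using hxs))
      · rw [Measure.dirac_apply' _ hs]; simp [hxs]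
    rw [← Measure.sub_add_cancel_of_le hle]
    refine (ih _ (fun B hB => ?_) ?_).add_dirac x
    · rw [Measure.sub_apply hB hle]
      refine (h B hB).sub ?_
      rw [Measure.dirac_apply' _ hB]
      by_cases hxs : x ∈ B
      · exact ⟨1, by simp [hxs]⟩
      · exact ⟨0, by simp [hxs]⟩
    · rw [Measure.sub_apply MeasurableSet.univ hle, hn]
      simp

lemma isDS_of_partition (μ : Measure X) (V : ℕ → Set X) (hVm : ∀ n, MeasurableSet (V n))
    (hVd : Pairwise (Function.onFun Disjoint V)) (hVu : ⋃ n, V n = Set.univ)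
    (h : ∀ n B, MeasurableSet B → IsN (μ (B ∩ V n))) : IsDS μ := by
  have : μ = Measure.sum fun n => μ.restrict (V n) := by
    rw [← Measure.restrict_iUnion hVd hVm, hVu, Measure.restrict_univ]
  rw [this]
  refine IsDS.sum fun n => ?_
  obtain ⟨k, hk⟩ := h n Set.univ MeasurableSet.univ
  refine isDS_of_finite k _ (fun B hB => ?_) ?_
  · rw [Measure.restrict_apply hB]; exact h n B hB
  · rw [Measure.restrict_apply MeasurableSet.univ]; exact hk

end

section
variable {X : Type*} [MeasurableSpace X]

lemma sub_add_cancel_sf {μ κ : Measure X} [SigmaFinite μ] (hle : κ ≤ μ) : μ - κ + κ = μ := by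
  refine Measure.ext_of_iUnion_eq_univ (iUnion_spanningSets μ) fun n => ?_
  have : IsFiniteMeasure (κ.restrict (spanningSets μ n)) := ⟨by
    rw [Measure.restrict_apply MeasurableSet.univ, Set.univ_inter]
    exact (hle _).trans_lt (measure_spanningSets_lt_top μ n)⟩
  rw [Measure.restrict_add, Measure.restrict_sub_eq_restrict_sub_restrict
    (measurableSet_spanningSets μ n)]
  exact Measure.sub_add_cancel_of_le (Measure.restrict_mono le_rfl hle)

end

section
variable {X : Type*} [MeasurableSpace X] [MetricSpace X] [PolishSpace X] [BorelSpace X]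

lemma sf_of_pm {μ : Measure X} (h : IsPointMeasure μ) : SigmaFinite μ := by
  have := h.2
  infer_instance

lemma isPM_sub {μ κ : Measure X} (hμ : IsPointMeasure μ) (hκ : IsPointMeasure κ) (hle : κ ≤ μ) :
    IsPointMeasure (μ - κ) := by
  have := sf_of_pm hμ
  have hlf := hμ.2
  have hadd := sub_add_cancel_sf hle
  refine ⟨?_, ⟨fun x => ?_⟩⟩
  · refine isDS_of_partition _ (disjointed (spanningSets μ))
      (MeasurableSet.disjointed (measurableSet_spanningSets μ)) (disjoint_disjointed _)
      (by rw [iUnion_disjointed, iUnion_spanningSets]) fun n B hB => ?_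
    have hm := hB.inter ((MeasurableSet.disjointed (measurableSet_spanningSets μ)) n)
    set S := B ∩ disjointed (spanningSets μ) n
    have hfin : μ S ≠ ∞ := ((measure_mono (Set.inter_subset_right.trans
      (disjointed_subset _ n))).trans_lt (measure_spanningSets_lt_top μ n)).ne
    have hfk : κ S ≠ ∞ := ne_top_of_le_ne_top hfin (hle S)
    have : (μ - κ) S = μ S - κ S := by
      rw [← congrArg (fun m : Measure X => m S) hadd, Measure.add_apply, 
        ENNReal.add_sub_cancel_right hfk]
    rw [this]
    exact (IsDS.isN hμ.1 hm hfin).sub (IsDS.isN hκ.1 hm hfk)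
  · obtain ⟨s, hs, hs'⟩ := hlf.finiteAtNhds x
    exact ⟨s, hs, (Measure.sub_le s).trans_lt hs'⟩

/-- Given open exhausting sets, a measurable set of point measures. -/
lemma exists_meas_PM (W : ℕ → Set X) (hWo : ∀ n, IsOpen (W n)) (hWu : ⋃ n, W n = Set.univ) :
    ∃ A : Set (Measure X), MeasurableSet A ∧ (∀ κ ∈ A, IsPointMeasure κ) ∧
      ∀ κ, IsPointMeasure κ → (∀ n, κ (W n) < ∞) → κ ∈ A := by
  let R := generateSetAlgebra (MeasurableSpace.countableGeneratingSet X)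
  have hRc : R.Countable := countable_generateSetAlgebra
    (MeasurableSpace.countable_countableGeneratingSet)
  have hRg : ‹MeasurableSpace X› = MeasurableSpace.generateFrom R := by
    rw [generateFrom_generateSetAlgebra_eq, MeasurableSpace.generateFrom_countableGeneratingSet]
  have hRm : ∀ B ∈ R, MeasurableSet B := fun B hB => by
    rw [hRg]; exact MeasurableSpace.measurableSet_generateFrom hB
  have hRa : IsSetAlgebra R := isSetAlgebra_generateSetAlgebra
  have hRpi : IsPiSystem R := fun s hs t ht _ => hRa.inter_mem hs ht
  have hWm : ∀ n, MeasurableSet (W n) := fun n => (hWo n).measurableSet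
  have hVm := MeasurableSet.disjointed hWm
  refine ⟨{κ | (∀ n, κ (W n) < ∞) ∧ ∀ n, ∀ B ∈ R, κ (B ∩ disjointed W n) ∈ Set.range
    (fun k : ℕ => (k : ℝ≥0∞))}, ?_, ?_, ?_⟩
  · rw [Set.ofPred_and]
    refine MeasurableSet.inter ?_ ?_
    · rw [Set.ofPred_forall]
      exact MeasurableSet.iInter fun n => measurableSet_lt (Measure.measurable_coe (hWm n))
        measurable_const
    · rw [Set.ofPred_forall]
      refine MeasurableSet.iInter fun n => ?_
      simp only [Set.ofPred_forall]
      refine MeasurableSet.biInter hRc fun B hB => ?_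
      exact (Measure.measurable_coe ((hRm B hB).inter (hVm n)))
        (Set.countable_range _).measurableSet
  · rintro κ ⟨hf, hk⟩
    refine ⟨?_, ⟨fun x => ?_⟩⟩
    · refine isDS_of_partition κ (disjointed W) hVm (disjoint_disjointed _)
        (by rw [iUnion_disjointed, hWu]) fun n B hB => ?_
      have hfin : ∀ B, κ (B ∩ disjointed W n) ≠ ∞ := fun B =>
        ((measure_mono (Set.inter_subset_right.trans (disjointed_subset _ n))).trans_lt (hf n)).ne
      have hR : ∀ B ∈ R, IsN (κ (B ∩ disjointed W n)) := fun B hB => by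
        obtain ⟨k, hk⟩ := hk n B hB
        exact ⟨k, hk.symm⟩
      induction B, hB using MeasurableSpace.induction_on_inter hRg hRpi with
      | empty => exact ⟨0, by simp⟩
      | basic t ht => exact hR t ht
      | compl t ht ih =>
        have := hR _ hRa.univ_mem
        have h2 : κ (tᶜ ∩ disjointed W n) = κ (Set.univ ∩ disjointed W n) 
            - κ (t ∩ disjointed W n) := by
          rw [← measure_sdiff (Set.inter_subset_inter_left _ (Set.subset_univ _))
            (ht.inter (hVm n)).nullMeasurableSet (hfin _)]
          congr 1
          ext y; simp; tauto
        rw [h2]; exact this.sub ih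
      | iUnion f hd hm ih =>
        have h2 : κ ((⋃ i, f i) ∩ disjointed W n) = ∑' i, κ (f i ∩ disjointed W n) := by
          rw [Set.iUnion_inter]
          exact measure_iUnion (fun i j hij => (hd hij).mono Set.inter_subset_left
            Set.inter_subset_left) fun i => (hm i).inter (hVm n)
        have h3 := hfin (⋃ i, f i)
        rw [h2] at h3 ⊢
        exact IsN.tsum ih h3
    · obtain ⟨n, hn⟩ := Set.mem_iUnion.1 (hWu.symm ▸ Set.mem_univ x : x ∈ ⋃ n, W n)
      exact ⟨W n, (hWo n).mem_nhds hn, hf n⟩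
  · intro κ hκ hf
    refine ⟨hf, fun n B hB => ?_⟩
    obtain ⟨k, hk⟩ := IsDS.isN hκ.1 ((hRm B hB).inter (hVm n))
      ((measure_mono (Set.inter_subset_right.trans (disjointed_subset _ n))).trans_lt (hf n)).ne
    exact ⟨k, hk.symm⟩

/-- exhaustion by open bounded sets of finite measure -/
lemma exists_exhaust (ν : Measure X) [IsLocallyFiniteMeasure ν] :
    ∃ W : ℕ → Set X, (∀ n, IsOpen (W n)) ∧ ⋃ n, W n = Set.univ ∧ Monotone W ∧
      (∀ n, Bornology.IsBounded (W n)) ∧ ∀ n, ν (W n) < ∞ := by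
  rcases isEmpty_or_nonempty X with hX | ⟨⟨x₀⟩⟩
  · exact ⟨fun _ => ∅, by simp, by simp [Set.eq_empty_of_isEmpty], monotone_const, by simp, by simp⟩
  let S := ν.finiteSpanningSetsInOpen'
  refine ⟨fun n => Set.accumulate S.set n ∩ Metric.ball x₀ n, fun n => ?_, ?_, ?_, fun n => ?_, fun n => ?_⟩
  · exact (isOpen_biUnion fun i _ => S.set_mem i).inter Metric.isOpen_ball
  · rw [Set.iUnion_eq_univ_iff]
    intro x
    obtain ⟨i, hi⟩ := Set.mem_iUnion.1 (S.spanning.symm ▸ Set.mem_univ x : x ∈ ⋃ n, S.set n)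
    obtain ⟨j, hj⟩ := exists_nat_gt (dist x x₀)
    refine ⟨max i j, Set.mem_accumulate.2 ⟨i, le_max_left _ _, hi⟩, ?_⟩
    rw [Metric.mem_ball]
    exact hj.trans_le (by exact_mod_cast le_max_right _ _)
  · exact fun a b hab => Set.inter_subset_inter (Set.monotone_accumulate hab)
      (Metric.ball_subset_ball (by exact_mod_cast hab))
  · exact Metric.isBounded_ball.subset Set.inter_subset_right
  · refine (measure_mono Set.inter_subset_left).trans_lt ?_
    exact measure_biUnion_lt_top (Set.finite_Iic n) fun i _ => S.finite i

end
end PSAux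

namespace PSAux

open BoundedContinuousFunction in
lemma cube_ext {ι : Type*} [Fintype ι] (μ ν : Measure (ι → unitInterval)) [IsFiniteMeasure μ]
    [IsFiniteMeasure ν]
    (h : ∀ e : ι → ℕ, ∫ x, ∏ i, ((x i : ℝ)) ^ e i ∂μ = ∫ x, ∏ i, ((x i : ℝ)) ^ e i ∂ν) :
    μ = ν := by
  classical
  let c : ι → ((ι → unitInterval) →ᵇ ℝ) := fun i =>
    BoundedContinuousFunction.mkOfCompact ⟨fun x => (x i : ℝ), by fun_prop⟩
  let A0 : Subalgebra ℝ ((ι → unitInterval) →ᵇ ℝ) := Algebra.adjoin ℝ (Set.range c)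
  have hstar : ∀ a ∈ A0, star a ∈ A0 := fun a ha => by
    have : star a = a := by ext x; simp
    rw [this]; exact ha
  let A : StarSubalgebra ℝ ((ι → unitInterval) →ᵇ ℝ) :=
    { A0 with star_mem' := fun {a} ha => hstar a ha }
  refine ext_of_forall_mem_subalgebra_integral_eq_of_polish (𝕜 := ℝ) (A := A) ?_ ?_
  · intro x y hxy
    obtain ⟨i, hi⟩ := Function.ne_iff.1 hxy
    refine ⟨fun x => (x i : ℝ), ⟨⟨fun x => (x i : ℝ), by fun_prop⟩, ?_, rfl⟩, ?_⟩
    · refine ⟨c i, ?_, rfl⟩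
      exact Algebra.subset_adjoin ⟨i, rfl⟩
    · simpa [Subtype.ext_iff] using hi
  · intro g hg
    have hg' : g ∈ Submodule.span ℝ (Submonoid.closure (Set.range c) : Set _) := by
      rw [← Algebra.adjoin_eq_span]; exact hg
    induction hg' using Submodule.span_induction with
    | zero => simp
    | add x y hx hy h1 h2 =>
      simp only [BoundedContinuousFunction.coe_add, Pi.add_apply]
      rw [integral_add (x.integrable _) (y.integrable _),
        integral_add (x.integrable _) (y.integrable _), h1, h2]
      · rw [← SetLike.mem_coe]; show y ∈ A0; rw [← Subalgebra.mem_toSubmodule, Algebra.adjoin_eq_span]; exact hy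
      · show x ∈ A0; rw [← Subalgebra.mem_toSubmodule, Algebra.adjoin_eq_span]; exact hx
    | smul a x hx h1 =>
      simp only [BoundedContinuousFunction.coe_smul, smul_eq_mul]
      rw [integral_const_mul, integral_const_mul, h1]
      show x ∈ A0; rw [← Subalgebra.mem_toSubmodule, Algebra.adjoin_eq_span]; exact hx
    | mem x hx =>
      have : ∃ e : ι → ℕ, ∀ y, x y = ∏ i, ((y i : ℝ)) ^ e i := by
        clear hg
        induction hx using Submonoid.closure_induction with
        | mem x hx =>
          obtain ⟨i, rfl⟩ := hx
          refine ⟨Pi.single i 1, fun y => ?_⟩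
          rw [Finset.prod_eq_single i]
          · simp [c]
          · intro j _ hj; simp [hj]
          · simp
        | one => exact ⟨0, fun y => by simp⟩
        | mul x y _ _ h1 h2 =>
          obtain ⟨e, he⟩ := h1
          obtain ⟨e', he'⟩ := h2
          refine ⟨e + e', fun z => ?_⟩
          simp [he, he', pow_add, Finset.prod_mul_distrib]
      obtain ⟨e, he⟩ := this
      simp_rw [he]
      exact h e

/-- Multiplicative class theorem. -/
lemma mult_ext {Ω : Type*} [mΩ : MeasurableSpace Ω] (μ ν : Measure Ω) [IsFiniteMeasure μ]
    [IsFiniteMeasure ν] (F : Set (Ω → ℝ)) (hmeas : ∀ f ∈ F, Measurable f)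
    (hb : ∀ f ∈ F, ∀ ω, f ω ∈ Set.Icc (0:ℝ) 1) (h1 : (1 : Ω → ℝ) ∈ F)
    (hmul : ∀ f ∈ F, ∀ g ∈ F, f * g ∈ F)
    (heq : ∀ f ∈ F, ∫ ω, f ω ∂μ = ∫ ω, f ω ∂ν)
    (hgen : mΩ ≤ MeasurableSpace.generateFrom {s | ∃ f ∈ F, ∃ a : ℝ, s = {ω | a < f ω}}) :
    μ = ν := by
  classical
  let C : Set (Set Ω) := {s | ∃ t : Finset (F × ℝ), s = ⋂ p ∈ t, {ω | p.2 < p.1.1 ω}}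
  have hCm : ∀ s ∈ C, MeasurableSet s := by
    rintro s ⟨t, rfl⟩
    exact Finset.measurableSet_biInter _ fun p _ =>
      measurableSet_lt measurable_const (hmeas _ p.1.2)
  refine ext_of_generate_finite C ?_ ?_ ?_ ?_
  · refine le_antisymm (hgen.trans ?_) (MeasurableSpace.generateFrom_le hCm)
    refine MeasurableSpace.generateFrom_mono ?_
    rintro s ⟨f, hf, a, rfl⟩
    exact ⟨{(⟨f, hf⟩, a)}, by simp⟩
  · rintro s ⟨t, rfl⟩ s' ⟨t', rfl⟩ _
    exact ⟨t ∪ t', by ext ω; simp only [Set.mem_inter_iff, Set.mem_iInter, Finset.mem_union]; grind⟩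
  · rintro s ⟨t, rfl⟩
    let φ : Ω → (t → unitInterval) := fun ω p => ⟨p.1.1.1 ω, hb _ p.1.1.2 ω⟩
    have hφ : Measurable φ := measurable_pi_lambda _ fun p =>
      (hmeas _ p.1.1.2).subtype_mk
    have hφe : μ.map φ = ν.map φ := by
      refine cube_ext _ _ fun e => ?_
      have hmz : Continuous (fun x : t → unitInterval => ∏ i, (x i : ℝ) ^ e i) := by fun_prop
      rw [integral_map hφ.aemeasurable hmz.aestronglyMeasurable, integral_map hφ.aemeasurable hmz.aestronglyMeasurable]
      have hpow : ∀ f ∈ F, ∀ n : ℕ, f ^ n ∈ F := by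
        intro f hf n
        induction n with
        | zero => simpa using h1
        | succ n ih => rw [pow_succ]; exact hmul _ ih _ hf
      have hprod : ∀ u : Finset t, (∏ i ∈ u, (i.1.1.1) ^ e i) ∈ F := by
        intro u
        induction u using Finset.induction_on with
        | empty => simpa using h1
        | insert a u ha ih =>
          rw [Finset.prod_insert ha]
          exact hmul _ (hpow _ a.1.1.2 _) _ ih
      have := heq _ (hprod Finset.univ)
      simpa [φ, Finset.prod_apply] using this
    have hset : (⋂ p ∈ t, {ω | p.2 < p.1.1 ω}) = φ ⁻¹' {x | ∀ p : t, p.1.2 < (x p : ℝ)} := by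
      ext ω; simp [φ]
    have hms : MeasurableSet {x : t → unitInterval | ∀ p : t, p.1.2 < (x p : ℝ)} := by
      rw [Set.ofPred_forall]
      exact MeasurableSet.iInter fun p => measurableSet_lt measurable_const (by fun_prop)
    rw [hset, ← Measure.map_apply hφ hms, ← Measure.map_apply hφ hms, hφe]
  · have := heq _ h1
    simp only [Pi.one_apply, integral_const, smul_eq_mul, mul_one] at this
    exact (measureReal_eq_measureReal_iff).1 this

end PSAux

set_option linter.unusedSectionVars false
namespace PSAux

lemma expNeg_ofReal {r : ℝ} (hr : 0 ≤ r) : expNeg (ENNReal.ofReal r) = ENNReal.ofReal (Real.exp (-r)) := by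
  simp [expNeg, ENNReal.toReal_ofReal hr]

lemma expNeg_of_ne_top {a : ℝ≥0∞} (h : a ≠ ∞) : expNeg a = ENNReal.ofReal (Real.exp (-a.toReal)) := by
  simp [expNeg, h]

lemma expNeg_zero : expNeg 0 = 1 := by simp [expNeg]

lemma expNeg_top : expNeg ∞ = 0 := by simp [expNeg]

lemma expNeg_le_one (a : ℝ≥0∞) : expNeg a ≤ 1 := by
  unfold expNeg
  split_ifs
  · simp
  · rw [ENNReal.ofReal_le_one, Real.exp_le_one_iff]
    simp

lemma expNeg_ne_top (a : ℝ≥0∞) : expNeg a ≠ ∞ := ne_top_of_le_ne_top one_ne_top (expNeg_le_one a)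

lemma expNeg_add (a b : ℝ≥0∞) : expNeg (a + b) = expNeg a * expNeg b := by
  by_cases ha : a = ∞
  · simp [ha, expNeg_top]
  by_cases hb : b = ∞
  · simp [hb, expNeg_top]
  rw [expNeg_of_ne_top ha, expNeg_of_ne_top hb, expNeg_of_ne_top (by simp [ha, hb]),
    ← ENNReal.ofReal_mul (Real.exp_nonneg _), ← Real.exp_add, ENNReal.toReal_add ha hb]
  ring_nf

lemma expNeg_strictAnti : StrictAnti expNeg := by
  intro a b hab
  have ha : a ≠ ∞ := hab.ne_top
  rw [expNeg_of_ne_top ha]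
  by_cases hb : b = ∞
  · simp [hb, expNeg_top, Real.exp_pos]
  · rw [expNeg_of_ne_top hb, ENNReal.ofReal_lt_ofReal_iff (Real.exp_pos _), Real.exp_lt_exp]
    have := (ENNReal.toReal_lt_toReal ha hb).2 hab
    linarith

@[fun_prop]
lemma measurable_expNeg : Measurable expNeg := expNeg_strictAnti.antitone.measurable

lemma expNeg_tendsto {u : ℕ → ℝ≥0∞} {a : ℝ≥0∞} (h : Filter.Tendsto u Filter.atTop (nhds a)) :
    Filter.Tendsto (fun n => expNeg (u n)) Filter.atTop (nhds (expNeg a)) := by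
  by_cases ha : a = ∞
  · subst ha
    rw [expNeg_top]
    refine ENNReal.tendsto_nhds_zero.2 fun ε hε => ?_
    obtain ⟨r, hr⟩ : ∃ r : ℝ, 0 ≤ r ∧ ENNReal.ofReal (Real.exp (-r)) ≤ ε := by
      have h0 : Filter.Tendsto (fun r : ℝ => ENNReal.ofReal (Real.exp (-r))) Filter.atTop (nhds 0) := by
        have := (ENNReal.continuous_ofReal.tendsto 0).comp Real.tendsto_exp_neg_atTop_nhds_zero
        simpa [Function.comp_def] using this
      have := (Filter.eventually_ge_atTop (0:ℝ)).and ((ENNReal.tendsto_nhds_zero.1 h0) ε hε)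
      exact this.exists
    filter_upwards [h.eventually (lt_mem_nhds (ENNReal.ofReal_lt_top : ENNReal.ofReal r < ∞))] with n hn
    refine (expNeg_strictAnti.antitone hn.le).trans ?_
    rw [expNeg_ofReal hr.1]; exact hr.2
  · have h1 : ∀ᶠ n in Filter.atTop, u n ≠ ∞ := by
      filter_upwards [h.eventually (gt_mem_nhds (lt_top_iff_ne_top.2 ha))] with n hn
      exact hn.ne
    have h2 := (ENNReal.tendsto_toReal ha).comp h
    have h3 := (ENNReal.continuous_ofReal.tendsto _).comp
      ((Real.continuous_exp.tendsto _).comp h2.neg)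
    rw [expNeg_of_ne_top ha]
    refine Filter.Tendsto.congr' ?_ h3
    filter_upwards [h1] with n hn
    simp [expNeg_of_ne_top hn]

section
variable {X : Type*} [MeasurableSpace X] [MetricSpace X]

/-- nice functions supported in W -/
structure Nice (W : Set X) (f : X → ℝ) : Prop where
  meas : Measurable f
  nonneg : ∀ x, 0 ≤ f x
  bdd : ∃ C, ∀ x, f x ≤ C
  supp : ∀ x, x ∉ W → f x = 0

lemma Nice.memU {W : Set X} {f : X → ℝ} (h : Nice W f) (hW : Bornology.IsBounded W) : MemU f :=
  ⟨h.meas, h.nonneg, h.bdd, hW.subset fun x hx => by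
    by_contra hx'; exact hx (h.supp x hx')⟩

lemma Nice.add_smul {W : Set X} {f g : X → ℝ} (hf : Nice W f) (hg : Nice W g) {t : ℝ} (ht : 0 ≤ t) :
    Nice W (fun x => f x + t * g x) := by
  obtain ⟨C, hC⟩ := hf.bdd
  obtain ⟨C', hC'⟩ := hg.bdd
  refine ⟨hf.meas.add (hg.meas.const_mul t), fun x => ?_, ⟨C + t * C', fun x => ?_⟩, fun x hx => ?_⟩
  · have := hf.nonneg x; have := hg.nonneg x; positivity
  · have := hC x; have := mul_le_mul_of_nonneg_left (hC' x) ht; linarith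
  · simp [hf.supp x hx, hg.supp x hx]

/-- multiply by a bounded measurable nonneg function -/
lemma Nice.mul {W : Set X} {f k : X → ℝ} (hf : Nice W f) (hk : Measurable k) (hk0 : ∀ x, 0 ≤ k x)
    {C : ℝ} (hC : ∀ x, k x ≤ C) : Nice W (fun x => f x * k x) := by
  obtain ⟨D, hD⟩ := hf.bdd
  refine ⟨hf.meas.mul hk, fun x => mul_nonneg (hf.nonneg x) (hk0 x), ⟨D * C, fun x => ?_⟩, fun x hx => ?_⟩
  · exact mul_le_mul (hD x) (hC x) (hk0 x) ((hf.nonneg x).trans (hD x))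
  · simp [hf.supp x hx]

lemma Nice.pairing_le {W : Set X} {f : X → ℝ} (hf : Nice W f) (hW : MeasurableSet W) {C : ℝ}
    (hC : ∀ x, f x ≤ C) (κ : Measure X) : pairing f κ ≤ ENNReal.ofReal C * κ W := by
  unfold pairing
  rw [← lintegral_indicator_const hW]
  refine lintegral_mono fun x => ?_
  by_cases hx : x ∈ W
  · simp only [hx, Set.indicator_of_mem]; exact ENNReal.ofReal_le_ofReal (hC x)
  · simp [hf.supp x hx]

lemma Nice.pairing_lt_top {W : Set X} {f : X → ℝ} (hf : Nice W f) (hW : MeasurableSet W)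
    {κ : Measure X} (hκ : κ W < ∞) : pairing f κ < ∞ := by
  obtain ⟨C, hC⟩ := hf.bdd
  exact (hf.pairing_le hW hC κ).trans_lt (ENNReal.mul_lt_top ENNReal.ofReal_lt_top hκ)

lemma measurable_pairing {f : X → ℝ} (hf : Measurable f) : Measurable (pairing f) :=
  Measure.measurable_lintegral hf.ennreal_ofReal

lemma pairing_add_smul {f g : X → ℝ} (hf : Measurable f) (hf0 : ∀ x, 0 ≤ f x) (hg : Measurable g)
    (hg0 : ∀ x, 0 ≤ g x) {t : ℝ} (ht : 0 ≤ t) (κ : Measure X) :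
    pairing (fun x => f x + t * g x) κ = pairing f κ + ENNReal.ofReal t * pairing g κ := by
  unfold pairing
  rw [← lintegral_const_mul _ hg.ennreal_ofReal, ← lintegral_add_left hf.ennreal_ofReal]
  congr 1; ext x
  rw [ENNReal.ofReal_add (hf0 x) (mul_nonneg ht (hg0 x)), ENNReal.ofReal_mul ht]

lemma pairing_smul {g : X → ℝ} (hg : Measurable g) {t : ℝ} (ht : 0 ≤ t) (κ : Measure X) :
    pairing (fun x => t * g x) κ = ENNReal.ofReal t * pairing g κ := by
  unfold pairing
  rw [← lintegral_const_mul _ hg.ennreal_ofReal]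
  congr 1; ext x
  rw [ENNReal.ofReal_mul ht]

lemma pairing_add_measure (f : X → ℝ) (κ ξ : Measure X) :
    pairing f (κ + ξ) = pairing f κ + pairing f ξ := by
  simp [pairing]

lemma lintegral_ofReal_eq_restrict {W : Set X} (hWm : MeasurableSet W) {u : X → ℝ}
    (h0 : ∀ x, x ∉ W → u x = 0) (μ : Measure X) :
    ∫⁻ x, ENNReal.ofReal (u x) ∂μ = ∫⁻ x, ENNReal.ofReal (u x) ∂(μ.restrict W) := by
  rw [← lintegral_indicator hWm]
  congr 1; ext x
  by_cases hx : x ∈ W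
  · simp [hx]
  · simp [hx, h0 x hx]

variable [PolishSpace X] [BorelSpace X]

lemma thin_deriv {q : ℝ} (hq : q ∈ Set.Ioo (0:ℝ) 1) {μ : Measure X} {T : Measure (Measure X)}
    (hT : IsThinning q μ T) {W : Set X} (hWm : MeasurableSet W) (hWb : Bornology.IsBounded W)
    (hμW : μ W < ∞) {f g : X → ℝ} (hf : Nice W f) (hg : Nice W g) :
    ∫⁻ κ, pairing g κ * expNeg (pairing f κ) ∂T =
      (∫⁻ x, ENNReal.ofReal (q * g x * Real.exp (-f x) / (1 - q + q * Real.exp (-f x))) ∂μ)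
        * laplaceT T f := by
  obtain ⟨hTp, hTs, hTL⟩ := hT
  obtain ⟨Cg, hCg⟩ := hg.bdd
  obtain ⟨hq0, hq1⟩ := hq
  have hden : ∀ y : ℝ, 0 < 1 - q + q * Real.exp y := fun y => by
    have := Real.exp_pos y
    nlinarith [mul_pos hq0 this]
  set F : Measure X → ℝ := fun κ => (pairing f κ).toReal with hF
  set G : Measure X → ℝ := fun κ => (pairing g κ).toReal with hG
  have hFm : Measurable F := (measurable_pairing hf.meas).ennreal_toReal
  have hGm : Measurable G := (measurable_pairing hg.meas).ennreal_toReal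
  have hF0 : ∀ κ, 0 ≤ F κ := fun κ => ENNReal.toReal_nonneg
  have hG0 : ∀ κ, 0 ≤ G κ := fun κ => ENNReal.toReal_nonneg
  set M : ℝ := (ENNReal.ofReal Cg * μ W).toReal with hM
  have hM0 : 0 ≤ M := ENNReal.toReal_nonneg
  have hfin : ∀ᵐ κ ∂T, pairing f κ < ∞ ∧ pairing g κ < ∞ ∧ G κ ≤ M := by
    filter_upwards [hTs] with κ hκ
    have hκW : κ W < ∞ := (hκ.2 W).trans_lt hμW
    refine ⟨hf.pairing_lt_top hWm hκW, hg.pairing_lt_top hWm hκW, ?_⟩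
    refine ENNReal.toReal_mono (ENNReal.mul_lt_top ENNReal.ofReal_lt_top hμW).ne ?_
    exact (hg.pairing_le hWm hCg κ).trans (by gcongr; exact hκ.2)
  have : IsFiniteMeasure (μ.restrict W) := ⟨by simpa using hμW⟩
  -- derivative of the left side
  have hA := (hasDerivAt_integral_of_dominated_loc_of_deriv_le (μ := T) (x₀ := (0:ℝ))
    (s := Metric.ball 0 1) (F := fun t κ => Real.exp (-(F κ + t * G κ)))
    (F' := fun t κ => Real.exp (-(F κ + t * G κ)) * (-(G κ))) (bound := fun _ => Real.exp M * M)
    (Metric.ball_mem_nhds _ one_pos)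
    (Filter.Eventually.of_forall fun t => by
      apply Measurable.aestronglyMeasurable; fun_prop)
    (by
      refine Integrable.of_bound (C := 1) (by apply Measurable.aestronglyMeasurable; fun_prop) (Filter.Eventually.of_forall fun κ => ?_)
      rw [Real.norm_eq_abs, Real.abs_exp, Real.exp_le_one_iff]
      have := hF0 κ; linarith)
    (by apply Measurable.aestronglyMeasurable; fun_prop)
    (by
      filter_upwards [hfin] with κ hκ t ht
      rw [norm_mul, Real.norm_eq_abs, Real.abs_exp, norm_neg, Real.norm_eq_abs, abs_of_nonneg (hG0 κ)]
      refine mul_le_mul (Real.exp_le_exp.2 ?_) hκ.2.2 (hG0 κ) (Real.exp_nonneg _)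
      have ht' : -1 < t := by
        rw [Metric.mem_ball, dist_zero_right, Real.norm_eq_abs, abs_lt] at ht; exact ht.1
      nlinarith [hF0 κ, hG0 κ, hκ.2.2])
    (integrable_const _)
    (by
      refine Filter.Eventually.of_forall fun κ t _ => ?_
      have h1 : HasDerivAt (fun t : ℝ => -(F κ + t * G κ)) (-(G κ)) t := by
        have h0 := (((hasDerivAt_id t).mul_const (G κ)).const_add (F κ)).neg
        rw [one_mul] at h0; exact h0
      exact h1.exp)).2
  -- derivative of the exponent
  have hB := (hasDerivAt_integral_of_dominated_loc_of_deriv_le (μ := μ.restrict W) (x₀ := (0:ℝ))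
    (s := Metric.ball 0 1) (F := fun t x => Real.log (1 - q + q * Real.exp (-(f x + t * g x))))
    (F' := fun t x => (q * (Real.exp (-(f x + t * g x)) * (-(g x)))) /
      (1 - q + q * Real.exp (-(f x + t * g x))))
    (bound := fun _ => (Real.exp Cg * Cg) / (1 - q))
    (Metric.ball_mem_nhds _ one_pos)
    (Filter.Eventually.of_forall fun t => by
      have := hf.meas; have := hg.meas
      apply Measurable.aestronglyMeasurable; fun_prop)
    (by
      have h1 := hf.meas; have h2 := hg.meas
      refine Integrable.of_bound (C := -Real.log (1 - q)) (by apply Measurable.aestronglyMeasurable; fun_prop) (Filter.Eventually.of_forall fun x => ?_)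
      have h3 : Real.exp (-(f x + 0 * g x)) ≤ 1 := by
        rw [Real.exp_le_one_iff]; have := hf.nonneg x; linarith
      have h4 := Real.exp_pos (-(f x + 0 * g x))
      rw [Real.norm_eq_abs, abs_of_nonpos]
      · refine neg_le_neg (Real.log_le_log (by linarith) ?_)
        nlinarith [mul_pos hq0 h4]
      · refine Real.log_nonpos (hden _).le ?_
        nlinarith)
    (by
      have := hf.meas; have := hg.meas
      apply Measurable.aestronglyMeasurable; fun_prop)
    (by
      refine Filter.Eventually.of_forall fun x t ht => ?_
      have ht' : -1 < t := by
        rw [Metric.mem_ball, dist_zero_right, Real.norm_eq_abs, abs_lt] at ht; exact ht.1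
      have h4 := Real.exp_pos (-(f x + t * g x))
      rw [norm_div, Real.norm_eq_abs, Real.norm_eq_abs, abs_of_pos (hden _), abs_mul, abs_mul,
        abs_neg, Real.abs_exp, abs_of_pos hq0, abs_of_nonneg (hg.nonneg x)]
      have h5 : Real.exp (-(f x + t * g x)) ≤ Real.exp Cg := Real.exp_le_exp.2 (by
        nlinarith [hf.nonneg x, hg.nonneg x, hCg x])
      have h6 : Real.exp (-(f x + t * g x)) * g x ≤ Real.exp Cg * Cg :=
        mul_le_mul h5 (hCg x) (hg.nonneg x) (Real.exp_nonneg _)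
      have h7 : 0 ≤ Real.exp (-(f x + t * g x)) * g x := mul_nonneg h4.le (hg.nonneg x)
      refine div_le_div₀ (h7.trans h6) ?_ (by linarith) ?_
      · nlinarith
      · nlinarith [mul_pos hq0 h4])
    (integrable_const _)
    (by
      refine Filter.Eventually.of_forall fun x t _ => ?_
      have h1 : HasDerivAt (fun t : ℝ => -(f x + t * g x)) (-(g x)) t := by
        have h0 := (((hasDerivAt_id t).mul_const (g x)).const_add (f x)).neg
        rw [one_mul] at h0; exact h0
      exact ((h1.exp.const_mul q).const_add (1 - q)).log (hden _).ne'))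
  have hBint := hB.1
  have hB := hB.2.exp
  -- equality for t ≥ 0
  have hEq : ∀ t : ℝ, 0 ≤ t → ∫ κ, Real.exp (-(F κ + t * G κ)) ∂T =
      Real.exp (∫ x, Real.log (1 - q + q * Real.exp (-(f x + t * g x))) ∂(μ.restrict W)) := by
    intro t ht
    have hn := hf.add_smul hg ht
    have h1 := hTL _ (hn.memU hWb)
    have h2 : laplaceT T (fun x => f x + t * g x) =
        ENNReal.ofReal (∫ κ, Real.exp (-(F κ + t * G κ)) ∂T) := by
      rw [ofReal_integral_eq_lintegral_ofReal]
      · refine lintegral_congr_ae ?_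
        filter_upwards [hfin] with κ hκ
        rw [pairing_add_smul hf.meas hf.nonneg hg.meas hg.nonneg ht, expNeg_of_ne_top,
          ENNReal.toReal_add hκ.1.ne, ENNReal.toReal_mul, ENNReal.toReal_ofReal ht]
        · exact ENNReal.mul_ne_top ENNReal.ofReal_ne_top hκ.2.1.ne
        · exact ENNReal.add_ne_top.2 ⟨hκ.1.ne, ENNReal.mul_ne_top ENNReal.ofReal_ne_top hκ.2.1.ne⟩
      · refine Integrable.of_bound (C := 1) (by apply Measurable.aestronglyMeasurable; fun_prop) (Filter.Eventually.of_forall fun κ => ?_)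
        rw [Real.norm_eq_abs, Real.abs_exp, Real.exp_le_one_iff]
        have := hF0 κ; have := mul_nonneg ht (hG0 κ); linarith
      · exact Filter.Eventually.of_forall fun κ => (Real.exp_nonneg _)
    have hlog : ∀ x, Real.log (1 - q + q * Real.exp (-(f x + t * g x))) ≤ 0 ∧ 
        Real.log (1 - q) ≤ Real.log (1 - q + q * Real.exp (-(f x + t * g x))) := fun x => by
      have h3 : Real.exp (-(f x + t * g x)) ≤ 1 := by
        rw [Real.exp_le_one_iff]; have := hn.nonneg x; linarith
      have h4 := Real.exp_pos (-(f x + t * g x))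
      refine ⟨Real.log_nonpos (hden _).le (by nlinarith), Real.log_le_log (by linarith) ?_⟩
      nlinarith [mul_pos hq0 h4]
    have h3 : ∫⁻ x, ENNReal.ofReal (-Real.log (1 - q + q * Real.exp (-(f x + t * g x)))) ∂μ =
        ENNReal.ofReal (-∫ x, Real.log (1 - q + q * Real.exp (-(f x + t * g x))) ∂(μ.restrict W)) := by
      rw [lintegral_ofReal_eq_restrict hWm (fun x hx => by simp [hf.supp x hx, hg.supp x hx]),
        ← integral_neg, ofReal_integral_eq_lintegral_ofReal]
      · have := hf.meas; have := hg.meas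
        refine Integrable.of_bound (C := -Real.log (1 - q)) (by apply Measurable.aestronglyMeasurable; fun_prop) (Filter.Eventually.of_forall fun x => ?_)
        rw [norm_neg, Real.norm_eq_abs, abs_of_nonpos (hlog x).1]
        exact neg_le_neg (hlog x).2
      · exact Filter.Eventually.of_forall fun x => neg_nonneg.2 (hlog x).1
    rw [h2, h3, expNeg_ofReal (neg_nonneg.2 (integral_nonpos fun x => (hlog x).1)), neg_neg] at h1
    exact (ENNReal.ofReal_eq_ofReal_iff (integral_nonneg fun κ => Real.exp_nonneg _)
      (Real.exp_nonneg _)).1 h1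
  have hD : ∫ κ, Real.exp (-(F κ + 0 * G κ)) * (-(G κ)) ∂T = _ :=
    (uniqueDiffWithinAt_Ici (0:ℝ)).eq_deriv _ (hA.hasDerivWithinAt (s := Set.Ici 0))
      ((hB.hasDerivWithinAt (s := Set.Ici 0)).congr (fun t ht => hEq t ht) (hEq 0 le_rfl))
  rw [← hEq 0 le_rfl] at hD
  simp only [zero_mul, add_zero] at hD hBint
  -- convert
  have hL : laplaceT T f = ENNReal.ofReal (∫ κ, Real.exp (-(F κ)) ∂T) := by
    rw [ofReal_integral_eq_lintegral_ofReal]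
    · refine lintegral_congr_ae ?_
      filter_upwards [hfin] with κ hκ
      rw [expNeg_of_ne_top hκ.1.ne]
    · refine Integrable.of_bound (C := 1) (by apply Measurable.aestronglyMeasurable; fun_prop) (Filter.Eventually.of_forall fun κ => ?_)
      rw [Real.norm_eq_abs, Real.abs_exp, Real.exp_le_one_iff]
      have := hF0 κ; linarith
    · exact Filter.Eventually.of_forall fun κ => (Real.exp_nonneg _)
  have hLhs : ∫⁻ κ, pairing g κ * expNeg (pairing f κ) ∂T =
      ENNReal.ofReal (∫ κ, Real.exp (-(F κ)) * G κ ∂T) := by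
    rw [ofReal_integral_eq_lintegral_ofReal]
    · refine lintegral_congr_ae ?_
      filter_upwards [hfin] with κ hκ
      rw [expNeg_of_ne_top hκ.1.ne, ENNReal.ofReal_mul (Real.exp_nonneg _), mul_comm,
        ENNReal.ofReal_toReal hκ.2.1.ne]
    · refine Integrable.of_bound (C := M) (by apply Measurable.aestronglyMeasurable; fun_prop) ?_
      filter_upwards [hfin] with κ hκ
      rw [norm_mul, Real.norm_eq_abs, Real.abs_exp, Real.norm_eq_abs, abs_of_nonneg (hG0 κ)]
      have : Real.exp (-(F κ)) ≤ 1 := by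
        rw [Real.exp_le_one_iff]; have := hF0 κ; linarith
      nlinarith [hG0 κ, hκ.2.2]
    · exact Filter.Eventually.of_forall fun κ => mul_nonneg (Real.exp_nonneg _) (hG0 κ)
  have hR : ∫⁻ x, ENNReal.ofReal (q * g x * Real.exp (-f x) / (1 - q + q * Real.exp (-f x))) ∂μ =
      ENNReal.ofReal (-∫ x, q * (Real.exp (-f x) * (-g x)) / (1 - q + q * Real.exp (-f x)) ∂(μ.restrict W)) := by
    rw [lintegral_ofReal_eq_restrict hWm (fun x hx => by simp [hg.supp x hx]), ← integral_neg,
      ofReal_integral_eq_lintegral_ofReal (f := fun a => -(q * (Real.exp (-f a) * -g a) / (1 - q + q * Real.exp (-f a)))) hBint.neg]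
    · refine lintegral_congr fun x => ?_
      congr 1; ring
    · refine Filter.Eventually.of_forall fun x => ?_
      have h1 : 0 ≤ q * (Real.exp (-f x) * g x) / (1 - q + q * Real.exp (-f x)) :=
        div_nonneg (mul_nonneg hq0.le (mul_nonneg (Real.exp_nonneg _) (hg.nonneg x))) (hden _).le
      have h2 : -(q * (Real.exp (-f x) * (-g x)) / (1 - q + q * Real.exp (-f x))) =
        q * (Real.exp (-f x) * g x) / (1 - q + q * Real.exp (-f x)) := by ring
      show 0 ≤ -(q * (Real.exp (-f x) * (-g x)) / (1 - q + q * Real.exp (-f x)))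
      rw [h2]; exact h1
  rw [hLhs, hR, hL, mul_comm, ← ENNReal.ofReal_mul (integral_nonneg fun κ => Real.exp_nonneg _)]
  congr 1
  have h5 : ∫ κ, Real.exp (-(F κ)) * (-(G κ)) ∂T = -∫ κ, Real.exp (-(F κ)) * (G κ) ∂T := by
    rw [← integral_neg]; congr 1; ext κ; ring
  rw [h5] at hD
  rw [mul_neg, ← hD, neg_neg]

lemma thin_mecke {q : ℝ} (hq : q ∈ Set.Ioo (0:ℝ) 1) {μ : Measure X} {T : Measure (Measure X)}
    (hμ : IsPointMeasure μ)
    (hT : IsThinning q μ T) {W : Set X} (hWm : MeasurableSet W) (hWb : Bornology.IsBounded W)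
    (hμW : μ W < ∞) {f g : X → ℝ} (hf : Nice W f) (hg : Nice W g) :
    ENNReal.ofReal (1 - q) * ∫⁻ κ, pairing (fun x => g x * Real.exp (f x)) κ * expNeg (pairing f κ) ∂T =
      ENNReal.ofReal q * ∫⁻ κ, expNeg (pairing f κ) * pairing g (μ - κ) ∂T := by
  have hsf := sf_of_pm hμ
  have hTp := hT.1
  have hTs := hT.2.1
  obtain ⟨hq0, hq1⟩ := hq
  obtain ⟨Cf, hCf⟩ := hf.bdd
  have hge : Nice W (fun x => g x * Real.exp (f x)) :=
    hg.mul hf.meas.exp (fun x => Real.exp_nonneg _) (fun x => Real.exp_le_exp.2 (hCf x))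
  have hqg : Nice W (fun x => g x * q) := hg.mul measurable_const (fun x => hq0.le) (fun x => le_rfl)
  have hgt := hqg.add_smul hge (sub_nonneg.2 hq1.le)
  have key := thin_deriv ⟨hq0, hq1⟩ hT hWm hWb hμW hf hgt
  have h1 : ∀ x, q * (g x * q + (1 - q) * (g x * Real.exp (f x))) * Real.exp (-f x) / 
      (1 - q + q * Real.exp (-f x)) = q * g x := fun x => by
    have hden : 0 < 1 - q + q * Real.exp (-f x) := by
      nlinarith [mul_pos hq0 (Real.exp_pos (-f x))]
    rw [div_eq_iff hden.ne']
    have : Real.exp (f x) * Real.exp (-f x) = 1 := by rw [← Real.exp_add]; simp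
    linear_combination (q * (1 - q) * g x) * this
  simp_rw [h1] at key
  have h2 : ∫⁻ x, ENNReal.ofReal (q * g x) ∂μ = ENNReal.ofReal q * pairing g μ :=
    pairing_smul hg.meas hq0.le μ
  have hmE : Measurable fun κ => expNeg (pairing f κ) := measurable_expNeg.comp (measurable_pairing hf.meas)
  have hmg := measurable_pairing hg.meas
  have hmge := measurable_pairing hge.meas
  have hm1 : Measurable fun κ => pairing g κ * expNeg (pairing f κ) := hmg.mul hmE
  have hm2 : Measurable fun κ => pairing (fun x => g x * Real.exp (f x)) κ * expNeg (pairing f κ) := hmge.mul hmE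
  have h3 : ∀ κ : Measure X, pairing (fun x => g x * q + (1 - q) * (g x * Real.exp (f x))) κ =
      ENNReal.ofReal q * pairing g κ + ENNReal.ofReal (1 - q) * pairing (fun x => g x * Real.exp (f x)) κ := by
    intro κ
    rw [pairing_add_smul hqg.meas hqg.nonneg hge.meas hge.nonneg (sub_nonneg.2 hq1.le)]
    congr 1
    rw [← pairing_smul hg.meas hq0.le]
    simp_rw [mul_comm]
  have h4 : ∫⁻ κ, pairing (fun x => g x * q + (1 - q) * (g x * Real.exp (f x))) κ * expNeg (pairing f κ) ∂T =
      ENNReal.ofReal q * ∫⁻ κ, pairing g κ * expNeg (pairing f κ) ∂T +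
      ENNReal.ofReal (1 - q) * ∫⁻ κ, pairing (fun x => g x * Real.exp (f x)) κ * expNeg (pairing f κ) ∂T := by
    rw [← lintegral_const_mul _ hm1, ← lintegral_const_mul _ hm2,
      ← lintegral_add_left (hm1.const_mul _)]
    congr 1; ext κ; rw [h3]; ring
  have h5 : ENNReal.ofReal q * pairing g μ * laplaceT T f =
      ENNReal.ofReal q * ∫⁻ κ, pairing g κ * expNeg (pairing f κ) ∂T +
      ENNReal.ofReal q * ∫⁻ κ, expNeg (pairing f κ) * pairing g (μ - κ) ∂T := by
    rw [laplaceT, mul_assoc, ← lintegral_const_mul _ hmE, ← mul_add, ← lintegral_add_left hm1]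
    congr 1
    refine lintegral_congr_ae ?_
    filter_upwards [hTs] with κ hκ
    have : pairing g μ = pairing g (μ - κ) + pairing g κ := by
      rw [← pairing_add_measure, sub_add_cancel_sf hκ.2]
    rw [this]; ring
  rw [h4, h2, h5] at key
  refine (ENNReal.add_right_inj ?_).1 key
  refine ENNReal.mul_ne_top ENNReal.ofReal_ne_top (ne_top_of_le_ne_top 
    (hg.pairing_lt_top hWm hμW).ne (b := pairing g μ) ?_)
  calc ∫⁻ κ, pairing g κ * expNeg (pairing f κ) ∂T ≤ ∫⁻ κ, pairing g μ ∂T := by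
        refine lintegral_mono_ae ?_
        filter_upwards [hTs] with κ hκ
        calc _ ≤ pairing g μ * 1 := mul_le_mul' (lintegral_mono' hκ.2 le_rfl) (expNeg_le_one _)
          _ = _ := mul_one _
    _ = pairing g μ := by simp

lemma thin_mean {q : ℝ} (hq : q ∈ Set.Ioo (0:ℝ) 1) {μ : Measure X} {T : Measure (Measure X)}
    (hT : IsThinning q μ T) {W : Set X} (hWm : MeasurableSet W) (hWb : Bornology.IsBounded W)
    (hμW : μ W < ∞) {g : X → ℝ} (hg : Nice W g) :
    ∫⁻ κ, pairing g κ ∂T = ENNReal.ofReal q * pairing g μ := by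
  have hTp := hT.1
  have h0 : Nice W (fun _ => (0:ℝ)) := ⟨measurable_const, fun _ => le_rfl, ⟨0, fun _ => le_rfl⟩, fun _ _ => rfl⟩
  have key := thin_deriv hq hT hWm hWb hμW h0 hg
  have h1 : ∀ κ : Measure X, pairing (fun _ => (0:ℝ)) κ = 0 := fun κ => by simp [pairing]
  simp only [laplaceT, h1, expNeg_zero, mul_one, neg_zero, Real.exp_zero, sub_add_cancel, div_one,
    lintegral_const, measure_univ] at key
  rw [key]
  exact pairing_smul hg.meas hq.1.le μ

end
end PSAux

set_option linter.unusedSectionVars false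
namespace PSAux

section
variable {X : Type*} [MeasurableSpace X] [MetricSpace X] [PolishSpace X] [BorelSpace X]

lemma seqThin_lin {Th : ℝ → Measure X → Measure (Measure X)}
    (hTh : ∀ s ∈ Set.Ioo (0 : ℝ) 1, ∀ μ, IsPointMeasure μ → IsThinning s μ (Th s μ))
    (g : X → ℝ) (m : ℕ) : ∀ (s : Fin m → ℝ), (∀ i, s i ∈ Set.Ioo (0:ℝ) 1) → ∀ μ, IsPointMeasure μ →
      ∀ a c : ℝ≥0∞, seqThinInt Th m s μ (fun l => a + c * ∑ i, pairing g (l i)) = a + c * pairing g μ := by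
  induction m with
  | zero => intro s _ μ _ a c; simp [seqThinInt]
  | succ m ih =>
    intro s hs μ hμ a c
    have hT := hTh _ (hs 0) μ hμ
    have hTp := hT.1
    have hsf := sf_of_pm hμ
    rw [seqThinInt]
    have : ∀ᵐ κ ∂(Th (s 0) μ), seqThinInt Th m (fun i => s i.succ) (μ - κ)
        (fun l => a + c * ∑ i, pairing g ((Fin.cons κ l : Fin (m + 2) → Measure X) i)) = a + c * pairing g μ := by
      filter_upwards [hT.2.1] with κ hκ
      have h1 : (fun l : Fin (m+1) → Measure X => a + c * ∑ i, pairing g ((Fin.cons κ l : Fin (m + 2) → Measure X) i)) =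
          fun l => (a + c * pairing g κ) + c * ∑ i, pairing g (l i) := by
        ext l
        rw [Fin.sum_univ_succ]
        simp only [Fin.cons_zero, Fin.cons_succ]
        ring
      have h2 : pairing g μ = pairing g (μ - κ) + pairing g κ := by
        rw [← pairing_add_measure, sub_add_cancel_sf hκ.2]
      rw [h1, ih _ (fun i => hs i.succ) _ (isPM_sub hμ hκ.1 hκ.2), h2]
      ring
    rw [lintegral_congr_ae this]
    simp

lemma splitProbs_mem {m : ℕ} {q : Fin (m + 1) → ℝ} (hq : ∀ i, q i ∈ Set.Ioo (0 : ℝ) 1) (j : Fin m) :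
    splitProbs q j ∈ Set.Ioo (0:ℝ) 1 := by
  unfold splitProbs
  have hlt : q j.castSucc < ∑ i ∈ Finset.Ici j.castSucc, q i := by
    have h1 : ({j.castSucc, Fin.last m} : Finset (Fin (m+1))) ⊆ Finset.Ici j.castSucc := by
      intro i hi
      simp only [Finset.mem_insert, Finset.mem_singleton] at hi
      rcases hi with rfl | rfl
      · simp
      · simp [Fin.le_last]
    have h2 := Finset.sum_le_sum_of_subset_of_nonneg (f := q) h1 (fun i _ _ => (hq i).1.le)
    rw [Finset.sum_pair (Fin.castSucc_lt_last j).ne] at h2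
    have := (hq (Fin.last m)).1
    linarith
  have h0 := (hq j.castSucc).1
  exact ⟨div_pos h0 (h0.trans hlt), (div_lt_one (h0.trans hlt)).2 hlt⟩

lemma splitProbs_zero {m : ℕ} {q : Fin (m + 2) → ℝ} (hsum : ∑ i, q i = 1) :
    splitProbs q 0 = q 0 := by
  unfold splitProbs
  have : Finset.Ici (Fin.castSucc (0 : Fin (m+1))) = Finset.univ := by
    ext i; simp
  rw [this, hsum]; simp

lemma bind_prob {P : Measure (Measure X)} (hP : IsPointProcess P)
    {Th : ℝ → Measure X → Measure (Measure X)} (hThm : ∀ s, Measurable (Th s))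
    (hTh : ∀ s ∈ Set.Ioo (0 : ℝ) 1, ∀ μ, IsPointMeasure μ → IsThinning s μ (Th s μ)) {s : ℝ}
    (hs : s ∈ Set.Ioo (0:ℝ) 1) : IsProbabilityMeasure (P.bind (Th s)) := by
  have := hP.1
  constructor
  rw [Measure.bind_apply MeasurableSet.univ (hThm s).aemeasurable]
  have : ∀ᵐ μ ∂P, Th s μ Set.univ = 1 := by
    filter_upwards [hP.2] with μ hμ
    exact (hTh s hs μ hμ).1.measure_univ
  rw [lintegral_congr_ae this]; simp

lemma pairing_moment (P : Measure (Measure X)) {g : X → ℝ} (hg : Measurable g) :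
    pairing g (momentMeasure P) = ∫⁻ μ, pairing g μ ∂P := by
  unfold pairing momentMeasure
  rw [Measure.lintegral_bind measurable_id.aemeasurable hg.ennreal_ofReal.aemeasurable]
  rfl

lemma ae_W {P : Measure (Measure X)} {W : Set X} (hWm : MeasurableSet W)
    (h : momentMeasure P W < ∞) : ∀ᵐ μ ∂P, μ W < ∞ := by
  unfold momentMeasure at h
  rw [Measure.bind_apply hWm measurable_id.aemeasurable] at h
  exact ae_lt_top (Measure.measurable_coe hWm) h.ne

lemma bind_mean {P : Measure (Measure X)} (hP : IsPointProcess P)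
    {Th : ℝ → Measure X → Measure (Measure X)} (hThm : ∀ s, Measurable (Th s))
    (hTh : ∀ s ∈ Set.Ioo (0 : ℝ) 1, ∀ μ, IsPointMeasure μ → IsThinning s μ (Th s μ)) {s : ℝ}
    (hs : s ∈ Set.Ioo (0:ℝ) 1) {W : Set X} (hWm : MeasurableSet W) (hWb : Bornology.IsBounded W)
    (hW : momentMeasure P W < ∞) {g : X → ℝ} (hg : Nice W g) :
    ∫⁻ κ, pairing g κ ∂(P.bind (Th s)) = ENNReal.ofReal s * pairing g (momentMeasure P) := by
  rw [Measure.lintegral_bind (hThm s).aemeasurable (measurable_pairing hg.meas).aemeasurable,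
    pairing_moment P hg.meas, ← lintegral_const_mul _ (measurable_pairing hg.meas)]
  refine lintegral_congr_ae ?_
  filter_upwards [hP.2, ae_W hWm hW] with μ hμ hμW
  exact thin_mean hs (hTh s hs μ hμ) hWm hWb hμW hg

lemma campbell_nice (P : Measure (Measure X)) (hP : IsPointProcess P)
    (m : ℕ) (q : Fin (m + 2) → ℝ)
    (hq : ∀ i, q i ∈ Set.Ioo (0 : ℝ) 1) (hsum : ∑ i, q i = 1)
    (Th : ℝ → Measure X → Measure (Measure X)) (hThm : ∀ s, Measurable (Th s))
    (hTh : ∀ s ∈ Set.Ioo (0 : ℝ) 1, ∀ μ, IsPointMeasure μ → IsThinning s μ (Th s μ))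
    (hfact : ∀ h : (Fin (m + 2) → Measure X) → ℝ≥0∞, Measurable h →
      ∫⁻ μ, seqThinInt Th (m+1) (splitProbs q) μ h ∂P
        = ∫⁻ κ, h κ ∂(Measure.pi fun i => P.bind (Th (q i))))
    {W : Set X} (hWm : MeasurableSet W) (hWb : Bornology.IsBounded W)
    (hW : momentMeasure P W < ∞) {f g : X → ℝ} (hf : Nice W f) (hg : Nice W g) :
    ∫⁻ κ, pairing (fun x => g x * Real.exp (f x)) κ * expNeg (pairing f κ) ∂(P.bind (Th (q 0))) =
      ENNReal.ofReal (q 0) * pairing g (momentMeasure P) * laplaceT (P.bind (Th (q 0))) f := by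
  have hprob : ∀ i, IsProbabilityMeasure (P.bind (Th (q i))) := fun i => bind_prob hP hThm hTh (hq i)
  have hmE : Measurable fun κ => expNeg (pairing f κ) := measurable_expNeg.comp (measurable_pairing hf.meas)
  have hmg := measurable_pairing hg.meas
  have hge : Measurable fun x => g x * Real.exp (f x) := hg.meas.mul hf.meas.exp
  have hm2 : Measurable fun κ => pairing (fun x => g x * Real.exp (f x)) κ * expNeg (pairing f κ) :=
    (measurable_pairing hge).mul hmE
  have hq1 : 0 < 1 - q 0 := by have := (hq 0).2; linarith
  -- the factorization
  have hF := hfact (fun l => expNeg (pairing f (l 0)) * ∑ i : Fin (m+1), pairing g (l i.succ))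
    ((hmE.comp (measurable_pi_apply 0)).mul
      (Finset.measurable_sum _ fun i _ => hmg.comp (measurable_pi_apply _)))
  have hL : ∫⁻ μ, seqThinInt Th (m+1) (splitProbs q) μ
      (fun l => expNeg (pairing f (l 0)) * ∑ i : Fin (m+1), pairing g (l i.succ)) ∂P =
      ∫⁻ μ, ∫⁻ κ, expNeg (pairing f κ) * pairing g (μ - κ) ∂(Th (q 0) μ) ∂P := by
    refine lintegral_congr_ae ?_
    filter_upwards [hP.2] with μ hμ
    rw [seqThinInt, splitProbs_zero hsum]
    refine lintegral_congr_ae ?_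
    filter_upwards [(hTh _ (hq 0) μ hμ).2.1] with κ hκ
    simp only [Fin.cons_zero, Fin.cons_succ]
    have := seqThin_lin hTh g m (fun i => splitProbs q i.succ) (fun i => splitProbs_mem hq _) (μ - κ)
      (isPM_sub hμ hκ.1 hκ.2) 0 (expNeg (pairing f κ))
    simpa using this
  have hR : ∫⁻ κ : Fin (m + 2) → Measure X, expNeg (pairing f (κ 0)) * ∑ i : Fin (m+1), pairing g (κ i.succ)
      ∂(Measure.pi fun i => P.bind (Th (q i))) =
      laplaceT (P.bind (Th (q 0))) f * (ENNReal.ofReal (1 - q 0) * pairing g (momentMeasure P)) := by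
    simp_rw [Finset.mul_sum]
    rw [lintegral_finsetSum]
    swap
    · intro i _
      exact (hmE.comp (measurable_pi_apply 0)).mul (hmg.comp (measurable_pi_apply _))
    have hone : ∀ i : Fin (m+1), ∫⁻ κ : Fin (m + 2) → Measure X, expNeg (pairing f (κ 0)) * pairing g (κ i.succ)
      ∂(Measure.pi fun i => P.bind (Th (q i))) = laplaceT (P.bind (Th (q 0))) f *
        (ENNReal.ofReal (q i.succ) * pairing g (momentMeasure P)) := by
      intro i
      have hind := (ProbabilityTheory.iIndepFun_pi (μ := fun i => P.bind (Th (q i)))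
        (X := fun _ κ => κ) (fun i => aemeasurable_id)).indepFun (Fin.succ_ne_zero i).symm
      have := ProbabilityTheory.lintegral_mul_eq_lintegral_mul_lintegral_of_indepFun
        (hmE.comp (measurable_pi_apply 0)) (hmg.comp (measurable_pi_apply i.succ))
        (hind.comp hmE hmg)
      simp only [Pi.mul_apply, Function.comp_apply] at this
      rw [this]
      have e0 := (measurePreserving_eval (fun i => P.bind (Th (q i))) 0).lintegral_comp hmE
      have ei := (measurePreserving_eval (fun i => P.bind (Th (q i))) i.succ).lintegral_comp hmg
      simp only [Function.eval] at e0 ei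
      rw [e0, ei, bind_mean hP hThm hTh (hq _) hWm hWb hW hg]
      rfl
    simp_rw [hone]
    rw [← Finset.mul_sum, ← Finset.sum_mul, ← ENNReal.ofReal_sum_of_nonneg (fun i _ => (hq _).1.le)]
    rw [Fin.sum_univ_succ] at hsum
    rw [← hsum]; simp
  rw [hL, hR] at hF
  have hM : ENNReal.ofReal (1 - q 0) * ∫⁻ κ, pairing (fun x => g x * Real.exp (f x)) κ * expNeg (pairing f κ) ∂(P.bind (Th (q 0)))
      = ENNReal.ofReal (q 0) * ∫⁻ μ, ∫⁻ κ, expNeg (pairing f κ) * pairing g (μ - κ) ∂(Th (q 0) μ) ∂P := by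
    rw [Measure.lintegral_bind (hThm _).aemeasurable hm2.aemeasurable,
      ← lintegral_const_mul' _ _ ENNReal.ofReal_ne_top, ← lintegral_const_mul' _ _ ENNReal.ofReal_ne_top]
    refine lintegral_congr_ae ?_
    filter_upwards [hP.2, ae_W hWm hW] with μ hμ hμW
    exact thin_mecke (hq 0) hμ (hTh _ (hq 0) μ hμ) hWm hWb hμW hf hg
  rw [hF] at hM
  have hne : ENNReal.ofReal (1 - q 0) ≠ 0 := by simpa using hq1
  refine (ENNReal.mul_right_inj hne ENNReal.ofReal_ne_top).1 (hM.trans ?_)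
  ring

end
end PSAux

set_option linter.unusedSectionVars false
namespace PSAux
open ProbabilityTheory
variable {X : Type*} [MeasurableSpace X] [MetricSpace X] [PolishSpace X] [BorelSpace X]

/-- level sets of the mass of `V` -/
def lev (V : Set X) (j : ℕ) : Set (Measure X) := {κ | (j : ℝ≥0∞) ≤ κ V ∧ κ V < (j : ℝ≥0∞) + 1}

lemma lev_meas {V : Set X} (hV : MeasurableSet V) (j : ℕ) : MeasurableSet (lev V j) :=
  (measurableSet_le measurable_const (Measure.measurable_coe hV)).inter
    (measurableSet_lt (Measure.measurable_coe hV) measurable_const)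

open Classical in
/-- piece of the restriction kernel -/
noncomputable def kerPiece (V : Set X) (hV : MeasurableSet V) (j : ℕ) : Kernel (Measure X) X where
  toFun κ := if κ ∈ lev V j then κ.restrict V else 0
  measurable' := Measurable.ite (lev_meas hV j) 
    (Measure.measurable_of_measurable_coe _ fun s hs => by
      simp only [Measure.restrict_apply hs]
      exact Measure.measurable_coe (hs.inter hV)) measurable_const

lemma kerPiece_pos {V : Set X} (hV : MeasurableSet V) {j : ℕ} {κ : Measure X} (h : κ ∈ lev V j) :
    kerPiece V hV j κ = κ.restrict V := if_pos h

lemma kerPiece_neg {V : Set X} (hV : MeasurableSet V) {j : ℕ} {κ : Measure X} (h : κ ∉ lev V j) :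
    kerPiece V hV j κ = 0 := if_neg h

instance (V : Set X) (hV : MeasurableSet V) (j : ℕ) : IsFiniteKernel (kerPiece V hV j) := by
  refine ⟨⟨(j : ℝ≥0∞) + 1, by simp, fun κ => ?_⟩⟩
  by_cases h : κ ∈ lev V j
  · rw [kerPiece_pos hV h]; simpa using h.2.le
  · rw [kerPiece_neg hV h]; simp

/-- the restriction kernel -/
noncomputable def kerV (V : Set X) (hV : MeasurableSet V) : Kernel (Measure X) X :=
  Kernel.sum (kerPiece V hV)

instance (V : Set X) (hV : MeasurableSet V) : IsSFiniteKernel (kerV V hV) := by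
  unfold kerV; infer_instance

lemma kerV_apply {V : Set X} (hV : MeasurableSet V) {κ : Measure X} (h : κ V < ∞) :
    kerV V hV κ = κ.restrict V := by
  unfold kerV
  rw [Kernel.sum_apply]
  obtain ⟨j, hj⟩ : ∃ j : ℕ, κ ∈ lev V j := by
    refine ⟨⌊(κ V).toNNReal⌋₊, ?_⟩
    have hr : ((κ V).toNNReal : ℝ≥0∞) = κ V := ENNReal.coe_toNNReal h.ne
    generalize (κ V).toNNReal = r at hr
    simp only [lev, Set.mem_setOf_eq, ← hr]
    constructor
    · exact_mod_cast Nat.floor_le (zero_le (a := r))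
    · exact_mod_cast Nat.lt_floor_add_one r
  have hu : ∀ i, i ≠ j → κ ∉ lev V i := by
    intro i hij hi
    have h1 : (i : ℝ≥0∞) < j + 1 := hi.1.trans_lt hj.2
    have h2 : (j : ℝ≥0∞) < i + 1 := hj.1.trans_lt hi.2
    have h1' : i < j + 1 := by exact_mod_cast h1
    have h2' : j < i + 1 := by exact_mod_cast h2
    omega
  ext s hs
  rw [Measure.sum_apply _ hs, tsum_eq_single j]
  · rw [kerPiece_pos hV hj]
  · intro i hi
    rw [kerPiece_neg hV (hu i hi)]; simp

lemma measurable_addDirac : Measurable fun p : Measure X × X => (p.1 + Measure.dirac p.2, p.2) := by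
  refine Measurable.prodMk ?_ measurable_snd
  refine Measure.measurable_of_measurable_coe _ fun s hs => ?_
  simp only [Measure.coe_add, Pi.add_apply]
  exact ((Measure.measurable_coe hs).comp measurable_fst).add
    ((Measure.measurable_coe hs).comp (Measure.measurable_dirac.comp measurable_snd))

/-- test functions on marked configurations -/
noncomputable def tf (B : Set X) (f : X → ℝ) (p : Measure X × X) : ℝ≥0∞ :=
  B.indicator 1 p.2 * expNeg (pairing f p.1)

lemma tf_meas {B : Set X} (hB : MeasurableSet B) {f : X → ℝ} (hf : Measurable f) : Measurable (tf B f) :=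
  ((measurable_one.indicator hB).comp measurable_snd).mul
    ((measurable_expNeg.comp (measurable_pairing hf)).comp measurable_fst)

lemma tf_le (B : Set X) (f : X → ℝ) (p) : tf B f p ≤ 1 := by
  unfold tf
  refine mul_le_one' ?_ (expNeg_le_one _)
  by_cases h : p.2 ∈ B <;> simp [h]

lemma nice_ind {W B : Set X} (hB : MeasurableSet B) (hBW : B ⊆ W) : Nice W (B.indicator (fun _ => (1:ℝ))) := by
  refine ⟨measurable_const.indicator hB, fun x => Set.indicator_nonneg (fun _ _ => zero_le_one) x,
    ⟨1, fun x => Set.indicator_le_self' (fun _ _ => zero_le_one) x⟩, fun x hx => ?_⟩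
  exact Set.indicator_of_notMem (fun h => hx (hBW h)) _

lemma pairing_ind {B : Set X} (hB : MeasurableSet B) (κ : Measure X) :
    pairing (B.indicator (fun _ => (1:ℝ))) κ = κ B := by
  unfold pairing
  rw [← lintegral_indicator_one hB]
  congr 1; ext x
  by_cases h : x ∈ B <;> simp [h]

lemma Nice.mono {W W' : Set X} (h : W ⊆ W') {f : X → ℝ} (hf : Nice W f) : Nice W' f :=
  ⟨hf.meas, hf.nonneg, hf.bdd, fun x hx => hf.supp x fun hx' => hx (h hx')⟩

section

lemma local_test (Γ : Measure (Measure X)) [IsProbabilityMeasure Γ] (ϱ : Measure X) (W : ℕ → Set X)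
    (hWo : ∀ n, MeasurableSet (W n)) (hWu : ⋃ n, W n = Set.univ) (hWmono : Monotone W)
    (hWϱ : ∀ n, ϱ (W n) < ∞) (hΓ : ∀ᵐ κ ∂Γ, ∀ n, κ (W n) < ∞)
    (key : ∀ n, ∀ f g : X → ℝ, Nice (W n) f → Nice (W n) g →
      ∫⁻ κ, pairing g κ * expNeg (pairing f κ) ∂Γ =
        pairing (fun x => g x * Real.exp (-f x)) ϱ * laplaceT Γ f)
    {V : Set X} (hV : MeasurableSet V) {n : ℕ} (hVW : V ⊆ W n) {B : Set X} (hB : MeasurableSet B)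
    {f : X → ℝ} {k : ℕ} (hf : Nice (W k) f) :
    ∫⁻ p, tf B f p ∂(Γ ⊗ₘ kerV V hV) =
      ∫⁻ p, tf B f p ∂((Γ.prod (ϱ.restrict V)).map fun p => (p.1 + Measure.dirac p.2, p.2)) := by
  have hfk : Nice (W (max k n)) f := hf.mono (hWmono (le_max_left _ _))
  have hBV : B ∩ V ⊆ W (max k n) := fun x hx => hWmono (le_max_right _ _) (hVW hx.2)
  have hfin : IsFiniteMeasure (ϱ.restrict V) := ⟨by simpa using (measure_mono hVW).trans_lt (hWϱ n)⟩
  have hk := key _ f _ hfk (nice_ind (hB.inter hV) hBV)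
  have hmE : Measurable fun κ => expNeg (pairing f κ) := measurable_expNeg.comp (measurable_pairing hf.meas)
  rw [Measure.lintegral_compProd (tf_meas hB hf.meas)]
  have e1 : ∫⁻ κ, ∫⁻ x, tf B f (κ, x) ∂(kerV V hV κ) ∂Γ =
      ∫⁻ κ, pairing ((B ∩ V).indicator (fun _ => (1:ℝ))) κ * expNeg (pairing f κ) ∂Γ := by
    refine lintegral_congr_ae ?_
    filter_upwards [hΓ] with κ hκ
    rw [kerV_apply hV ((measure_mono hVW).trans_lt (hκ n)), pairing_ind (hB.inter hV)]
    simp only [tf]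
    rw [lintegral_mul_const _ (measurable_one.indicator hB), lintegral_indicator_one hB,
      Measure.restrict_apply hB]
  rw [e1, hk, lintegral_map (tf_meas hB hf.meas) measurable_addDirac,
    lintegral_prod (fun p : Measure X × X => tf B f (p.1 + Measure.dirac p.2, p.2))
    ((tf_meas hB hf.meas).comp measurable_addDirac).aemeasurable]
  have e2 : ∀ κ : Measure X, ∫⁻ x, tf B f (κ + Measure.dirac x, x) ∂(ϱ.restrict V) =
      pairing (fun x => (B ∩ V).indicator (fun _ => (1:ℝ)) x * Real.exp (-f x)) ϱ * expNeg (pairing f κ) := by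
    intro κ
    have : ∀ x, tf B f (κ + Measure.dirac x, x) =
        (B.indicator 1 x * ENNReal.ofReal (Real.exp (-f x))) * expNeg (pairing f κ) := by
      intro x
      have : pairing f (Measure.dirac x) = ENNReal.ofReal (f x) := by
        unfold pairing; rw [lintegral_dirac' _ hf.meas.ennreal_ofReal]
      simp only [tf]
      rw [pairing_add_measure, this, expNeg_add, expNeg_ofReal (hf.nonneg x)]
      ring
    simp only [this]
    have hm' : Measurable fun x => B.indicator (1 : X → ℝ≥0∞) x * ENNReal.ofReal (Real.exp (-f x)) :=
      (measurable_one.indicator hB).mul (hf.meas.neg.exp.ennreal_ofReal)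
    rw [lintegral_mul_const _ hm']
    congr 1
    unfold pairing
    rw [← lintegral_indicator hV]
    congr 1; ext x
    by_cases h1 : x ∈ V <;> by_cases h2 : x ∈ B <;> simp [h1, h2]
  simp only [e2]
  rw [lintegral_const_mul _ hmE]
  rfl

lemma local_eq (Γ : Measure (Measure X)) [IsProbabilityMeasure Γ] (ϱ : Measure X) (W : ℕ → Set X)
    (hWo : ∀ n, MeasurableSet (W n)) (hWu : ⋃ n, W n = Set.univ) (hWmono : Monotone W)
    (hWϱ : ∀ n, ϱ (W n) < ∞) (hΓ : ∀ᵐ κ ∂Γ, ∀ n, κ (W n) < ∞)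
    (key : ∀ n, ∀ f g : X → ℝ, Nice (W n) f → Nice (W n) g →
      ∫⁻ κ, pairing g κ * expNeg (pairing f κ) ∂Γ =
        pairing (fun x => g x * Real.exp (-f x)) ϱ * laplaceT Γ f)
    {V : Set X} (hV : MeasurableSet V) {n : ℕ} (hVW : V ⊆ W n) :
    Γ ⊗ₘ kerV V hV = (Γ.prod (ϱ.restrict V)).map fun p => (p.1 + Measure.dirac p.2, p.2) := by
  have hfin : IsFiniteMeasure (ϱ.restrict V) := ⟨by simpa using (measure_mono hVW).trans_lt (hWϱ n)⟩
  have h0 : Nice (W 0) (fun _ => (0:ℝ)) := ⟨measurable_const, fun _ => le_rfl, ⟨0, fun _ => le_rfl⟩, fun _ _ => rfl⟩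
  have t0 : ∀ (B : Set X) p, tf B (fun _ => (0:ℝ)) p = B.indicator 1 p.2 := fun B p => by
    simp [tf, pairing, expNeg_zero]
  have hLT := fun (B : Set X) (hB : MeasurableSet B) (f : X → ℝ) (k : ℕ) (hf : Nice (W k) f) =>
    local_test Γ ϱ W hWo hWu hWmono hWϱ hΓ key hV hVW hB hf
  have hfin2 : IsFiniteMeasure ((Γ.prod (ϱ.restrict V)).map fun p => (p.1 + Measure.dirac p.2, p.2)) :=
    inferInstance
  have hfin1 : IsFiniteMeasure (Γ ⊗ₘ kerV V hV) := by
    constructor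
    have := hLT Set.univ MeasurableSet.univ _ 0 h0
    simp only [t0, Set.indicator_univ, Pi.one_apply, lintegral_one] at this
    rw [this]; exact measure_lt_top _ _
  refine mult_ext _ _ {g | ∃ B, MeasurableSet B ∧ ∃ f k, Nice (W k) f ∧ g = fun p => (tf B f p).toReal}
    ?_ ?_ ?_ ?_ ?_ ?_
  · rintro g ⟨B, hB, f, k, hf, rfl⟩
    exact (tf_meas hB hf.meas).ennreal_toReal
  · rintro g ⟨B, hB, f, k, hf, rfl⟩ p
    exact ⟨ENNReal.toReal_nonneg, by
      simpa using ENNReal.toReal_mono one_ne_top (tf_le B f p)⟩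
  · refine ⟨Set.univ, MeasurableSet.univ, _, 0, h0, ?_⟩
    ext p; simp [t0]
  · rintro _ ⟨B, hB, f, k, hf, rfl⟩ _ ⟨B', hB', f', k', hf', rfl⟩
    have hfk : Nice (W (max k k')) f := hf.mono (hWmono (le_max_left _ _))
    have hfk' : Nice (W (max k k')) f' := hf'.mono (hWmono (le_max_right _ _))
    refine ⟨B ∩ B', hB.inter hB', _, _, hfk.add_smul hfk' zero_le_one, ?_⟩
    ext p
    simp only [Pi.mul_apply, tf, ← ENNReal.toReal_mul]
    rw [pairing_add_smul hf.meas hf.nonneg hf'.meas hf'.nonneg zero_le_one, ENNReal.ofReal_one, one_mul,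
      expNeg_add]
    congr 1
    by_cases h1 : p.2 ∈ B <;> by_cases h2 : p.2 ∈ B' <;> simp [h1, h2]
  · rintro _ ⟨B, hB, f, k, hf, rfl⟩
    rw [integral_toReal (tf_meas hB hf.meas).aemeasurable
      (Filter.Eventually.of_forall fun p => (tf_le B f p).trans_lt one_lt_top),
      integral_toReal (tf_meas hB hf.meas).aemeasurable
      (Filter.Eventually.of_forall fun p => (tf_le B f p).trans_lt one_lt_top), hLT B hB f k hf]
  · set 𝓕 := {g : Measure X × X → ℝ | ∃ B, MeasurableSet B ∧ ∃ f k, Nice (W k) f ∧ g = fun p => (tf B f p).toReal}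
      with h𝓕
    set 𝓖 := MeasurableSpace.generateFrom {s | ∃ f ∈ 𝓕, ∃ a : ℝ, s = {ω | a < f ω}} with h𝓖
    have hgen : ∀ B, MeasurableSet B → ∀ f k, Nice (W k) f → ∀ a : ℝ,
        MeasurableSet[𝓖] {p | a < (tf B f p).toReal} := fun B hB f k hf a =>
      MeasurableSpace.measurableSet_generateFrom ⟨_, ⟨B, hB, f, k, hf, rfl⟩, a, rfl⟩
    have hsnd : @Measurable _ _ 𝓖 _ (Prod.snd : Measure X × X → X) := by
      intro B hB
      have := hgen B hB _ 0 h0 (1/2)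
      convert this using 1
      ext p
      simp only [t0, Set.mem_preimage, Set.mem_setOf_eq]
      by_cases h : p.2 ∈ B
      · simp [h]; norm_num
      · simp [h]
    have hcoe1 : ∀ B k, MeasurableSet B → B ⊆ W k → @Measurable _ _ 𝓖 _ (fun p : Measure X × X => p.1 B) := by
      intro B k hB hBW
      refine measurable_of_Iio (mδ := 𝓖) fun c => ?_
      have := hgen Set.univ MeasurableSet.univ _ k (nice_ind hB hBW) (expNeg c).toReal
      convert this using 1
      ext p
      simp only [Set.mem_preimage, Set.mem_Iio, Set.mem_setOf_eq, tf, pairing_ind hB, Set.indicator_univ,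
        Pi.one_apply, one_mul]
      rw [ENNReal.toReal_lt_toReal (expNeg_ne_top _) (expNeg_ne_top _), expNeg_strictAnti.lt_iff_gt]
    have hfst : @Measurable _ _ 𝓖 _ (Prod.fst : Measure X × X → Measure X) := by
      refine @Measure.measurable_of_measurable_coe _ _ _ 𝓖 _ fun B hB => ?_
      have : (fun p : Measure X × X => p.1 B) = fun p => ⨆ k, p.1 (B ∩ W k) := by
        ext p
        rw [← Monotone.measure_iUnion (fun i j hij => Set.inter_subset_inter_right _ (hWmono hij)),
          ← Set.inter_iUnion, hWu, Set.inter_univ]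
      rw [this]
      exact Measurable.iSup (mδ := 𝓖) fun k => hcoe1 _ k (hB.inter (hWo k)) Set.inter_subset_right
    exact sup_le (measurable_iff_comap_le.1 hfst) (measurable_iff_comap_le.1 hsnd)

lemma campbell_all (Γ : Measure (Measure X)) [IsProbabilityMeasure Γ] (ϱ : Measure X) (W : ℕ → Set X)
    (hWo : ∀ n, MeasurableSet (W n)) (hWu : ⋃ n, W n = Set.univ) (hWmono : Monotone W)
    (hWϱ : ∀ n, ϱ (W n) < ∞) (hΓ : ∀ᵐ κ ∂Γ, ∀ n, κ (W n) < ∞)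
    (key : ∀ n, ∀ f g : X → ℝ, Nice (W n) f → Nice (W n) g →
      ∫⁻ κ, pairing g κ * expNeg (pairing f κ) ∂Γ =
        pairing (fun x => g x * Real.exp (-f x)) ϱ * laplaceT Γ f)
    (h : X → Measure X → ℝ≥0∞) (hh : Measurable (Function.uncurry h)) :
    ∫⁻ κ, ∫⁻ x, h x κ ∂κ ∂Γ = ∫⁻ κ, ∫⁻ x, h x (κ + Measure.dirac x) ∂ϱ ∂Γ := by
  set V := disjointed W with hVdef
  have hVm : ∀ n, MeasurableSet (V n) := fun n => MeasurableSet.disjointed hWo n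
  have hVW : ∀ n, V n ⊆ W n := fun n => disjointed_subset W n
  have hVu : ⋃ n, V n = Set.univ := by rw [hVdef, iUnion_disjointed, hWu]
  have hVd : Pairwise (Function.onFun Disjoint V) := disjoint_disjointed W
  have hdec : ∀ (κ : Measure X) (u : X → ℝ≥0∞), ∫⁻ x, u x ∂κ = ∑' n, ∫⁻ x in V n, u x ∂κ := by
    intro κ u
    rw [← lintegral_iUnion hVm hVd, hVu, Measure.restrict_univ]
  have hh' : Measurable fun p : Measure X × X => h p.2 p.1 := hh.comp measurable_swap
  have h1 : ∫⁻ κ, ∫⁻ x, h x κ ∂κ ∂Γ = ∫⁻ κ, ∑' n, ∫⁻ x, h x κ ∂(kerV (V n) (hVm n) κ) ∂Γ := by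
    refine lintegral_congr_ae ?_
    filter_upwards [hΓ] with κ hκ
    rw [hdec]
    congr 1; ext n
    rw [kerV_apply (hVm n) ((measure_mono (hVW n)).trans_lt (hκ n))]
  have hfin : ∀ n, IsFiniteMeasure (ϱ.restrict (V n)) := fun n =>
    ⟨by simpa using (measure_mono (hVW n)).trans_lt (hWϱ n)⟩
  have hh2 : Measurable fun p : Measure X × X => h p.2 (p.1 + Measure.dirac p.2) :=
    hh'.comp measurable_addDirac
  rw [h1, lintegral_tsum fun n => (hh'.lintegral_kernel_prod_right).aemeasurable]
  have h2 : ∫⁻ κ, ∫⁻ x, h x (κ + Measure.dirac x) ∂ϱ ∂Γ =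
      ∑' n, ∫⁻ κ, ∫⁻ x in V n, h x (κ + Measure.dirac x) ∂ϱ ∂Γ := by
    rw [← lintegral_tsum fun n => hh2.lintegral_prod_right'.aemeasurable]
    congr 1; ext κ
    exact hdec _ _
  rw [h2]
  congr 1; ext n
  have e := local_eq Γ ϱ W hWo hWu hWmono hWϱ hΓ key (hVm n) (hVW n)
  have e' := congrArg (fun m => ∫⁻ p, h p.2 p.1 ∂m) e
  rw [Measure.lintegral_compProd hh', lintegral_map hh' measurable_addDirac,
    lintegral_prod _ hh2.aemeasurable] at e'
  exact e'
end
end PSAux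

set_option linter.unusedSectionVars false
namespace PSAux

lemma one_sub_exp_bound {t y : ℝ} (ht : 0 ≤ t) (ht1 : t ≤ 1) (hy : 0 ≤ y) : ‖1 - Real.exp (-(t * y))‖ ≤ y := by
  have h1 : Real.exp (-(t * y)) ≤ 1 := Real.exp_le_one_iff.2 (by nlinarith [mul_nonneg ht hy])
  have h2 := Real.add_one_le_exp (-(t * y))
  rw [Real.norm_of_nonneg (by linarith)]
  nlinarith

lemma psi_cont {Ω : Type*} [MeasurableSpace Ω] (μ : Measure Ω) {F : Ω → ℝ} (hF0 : ∀ ω, 0 ≤ F ω)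
    (hFm : Measurable F) (hF : Integrable F μ) :
    ContinuousOn (fun t : ℝ => ∫ ω, (1 - Real.exp (-(t * F ω))) ∂μ) (Set.Icc 0 1) := by
  refine continuousOn_of_dominated (bound := F) ?_ ?_ hF ?_
  · intro t _
    exact (by fun_prop : Measurable _).aestronglyMeasurable
  · intro t ht
    exact Filter.Eventually.of_forall fun ω => one_sub_exp_bound ht.1 ht.2 (hF0 ω)
  · exact Filter.Eventually.of_forall fun ω => by fun_prop

lemma psi_deriv {Ω : Type*} [MeasurableSpace Ω] (μ : Measure Ω) {F : Ω → ℝ} (hF0 : ∀ ω, 0 ≤ F ω)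
    (hFm : Measurable F) (hF : Integrable F μ) {t : ℝ} (ht : t ∈ Set.Ioo (0:ℝ) 1) :
    HasDerivAt (fun t : ℝ => ∫ ω, (1 - Real.exp (-(t * F ω))) ∂μ) (∫ ω, F ω * Real.exp (-(t * F ω)) ∂μ) t := by
  refine (hasDerivAt_integral_of_dominated_loc_of_deriv_le (s := Set.Ioo 0 1) (bound := F)
    (F' := fun t ω => F ω * Real.exp (-(t * F ω))) (Ioo_mem_nhds ht.1 ht.2) ?_ ?_ ?_ ?_ hF ?_).2
  · exact Filter.Eventually.of_forall fun t => (by fun_prop : Measurable _).aestronglyMeasurable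
  · refine hF.mono' (by fun_prop : Measurable _).aestronglyMeasurable
      (Filter.Eventually.of_forall fun ω => one_sub_exp_bound ht.1.le ht.2.le (hF0 ω))
  · exact (by fun_prop : Measurable _).aestronglyMeasurable
  · refine Filter.Eventually.of_forall fun ω s hs => ?_
    have h1 : Real.exp (-(s * F ω)) ≤ 1 := Real.exp_le_one_iff.2 (by nlinarith [mul_nonneg hs.1.le (hF0 ω)])
    rw [Real.norm_of_nonneg (mul_nonneg (hF0 ω) (Real.exp_nonneg _))]
    nlinarith [hF0 ω]
  · refine Filter.Eventually.of_forall fun ω s hs => ?_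
    have := (((hasDerivAt_id s).mul_const (F ω)).neg.exp).const_sub 1
    refine HasDerivAt.congr_deriv (f := fun x => 1 - Real.exp (-(x * F ω))) this ?_
    symm
    change F ω * Real.exp (-(s * F ω)) = -(Real.exp (-(s * F ω)) * -(1 * F ω))
    ring

section
variable {X : Type*} [MeasurableSpace X] [MetricSpace X] [PolishSpace X] [BorelSpace X]

lemma laplace_nice (Γ : Measure (Measure X)) [IsProbabilityMeasure Γ] (ϱ : Measure X) (W : ℕ → Set X)
    (hWo : ∀ n, MeasurableSet (W n)) (hWu : ⋃ n, W n = Set.univ) (hWmono : Monotone W)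
    (hWϱ : ∀ n, ϱ (W n) < ∞) (hΓ : ∀ᵐ κ ∂Γ, ∀ n, κ (W n) < ∞)
    (key : ∀ n, ∀ f g : X → ℝ, Nice (W n) f → Nice (W n) g →
      ∫⁻ κ, pairing g κ * expNeg (pairing f κ) ∂Γ =
        pairing (fun x => g x * Real.exp (-f x)) ϱ * laplaceT Γ f)
    {n : ℕ} {f : X → ℝ} (hf : Nice (W n) f) :
    laplaceT Γ f = expNeg (∫⁻ x, ENNReal.ofReal (1 - Real.exp (-f x)) ∂ϱ) := by
  have h0 : Nice (W n) (fun _ => (0:ℝ)) := ⟨measurable_const, fun _ => le_rfl, ⟨0, fun _ => le_rfl⟩, fun _ _ => rfl⟩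
  have hp0 : ∀ κ : Measure X, pairing (fun _ => (0:ℝ)) κ = 0 := fun κ => by simp [pairing]
  have htf : ∀ t : ℝ, 0 ≤ t → Nice (W n) (fun x => t * f x) := fun t ht => by
    simpa using h0.add_smul hf ht
  have hfϱ : pairing f ϱ < ∞ := hf.pairing_lt_top (hWo n) (hWϱ n)
  have hmean : ∫⁻ κ, pairing f κ ∂Γ = pairing f ϱ := by
    have := key n _ f h0 hf
    simpa [laplaceT, hp0, expNeg_zero] using this
  set F : Measure X → ℝ := fun κ => (pairing f κ).toReal with hFdef
  have hFm : Measurable F := (measurable_pairing hf.meas).ennreal_toReal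
  have hF0 : ∀ κ, 0 ≤ F κ := fun κ => ENNReal.toReal_nonneg
  have hF : Integrable F Γ := integrable_toReal_of_lintegral_ne_top (measurable_pairing hf.meas).aemeasurable
    (by rw [hmean]; exact hfϱ.ne)
  have hfi : Integrable f ϱ := by
    refine ⟨hf.meas.aestronglyMeasurable, ?_⟩
    rw [hasFiniteIntegral_iff_ofReal (Filter.Eventually.of_forall hf.nonneg)]
    exact hfϱ
  have hfin : ∀ᵐ κ ∂Γ, pairing f κ ≠ ∞ := by
    filter_upwards [hΓ] with κ hκ
    exact (hf.pairing_lt_top (hWo n) (hκ n)).ne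
  have hE : ∀ t : ℝ, 0 ≤ t → ∀ᵐ κ ∂Γ, expNeg (pairing (fun x => t * f x) κ) = ENNReal.ofReal (Real.exp (-(t * F κ))) := by
    intro t ht
    filter_upwards [hfin] with κ hκ
    rw [pairing_smul hf.meas ht, ← ENNReal.ofReal_toReal hκ, ← ENNReal.ofReal_mul ht, expNeg_ofReal]
    exact mul_nonneg ht (hF0 κ)
  set φ : ℝ → ℝ := fun t => ∫ κ, Real.exp (-(t * F κ)) ∂Γ with hφ
  have hexpi : ∀ t : ℝ, 0 ≤ t → Integrable (fun κ => Real.exp (-(t * F κ))) Γ := fun t ht => by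
    refine Integrable.of_bound (C := 1) (by fun_prop : Measurable _).aestronglyMeasurable
      (Filter.Eventually.of_forall fun κ => ?_)
    rw [Real.norm_of_nonneg (Real.exp_nonneg _)]
    exact Real.exp_le_one_iff.2 (by nlinarith [mul_nonneg ht (hF0 κ)])
  have hL : ∀ t : ℝ, 0 ≤ t → laplaceT Γ (fun x => t * f x) = ENNReal.ofReal (φ t) := by
    intro t ht
    rw [laplaceT, lintegral_congr_ae (hE t ht), hφ,
      ofReal_integral_eq_lintegral_ofReal (hexpi t ht) (Filter.Eventually.of_forall fun _ => Real.exp_nonneg _)]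
  set G : ℝ → ℝ := fun t => ∫ κ, (1 - Real.exp (-(t * F κ))) ∂Γ with hG
  have hGφ : ∀ t, 0 ≤ t → φ t = 1 - G t := by
    intro t ht
    rw [hG]; simp only
    rw [integral_sub (integrable_const _) (hexpi t ht)]
    simp [hφ]
  set Ψ : ℝ → ℝ := fun t => ∫ x, (1 - Real.exp (-(t * f x))) ∂ϱ with hΨ
  have hrel : ∀ t ∈ Set.Ioo (0:ℝ) 1, ∫ κ, F κ * Real.exp (-(t * F κ)) ∂Γ =
      (∫ x, f x * Real.exp (-(t * f x)) ∂ϱ) * (1 - G t) := by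
    intro t ht
    have hk := key n _ f (htf t ht.1.le) hf
    rw [hL t ht.1.le, hGφ t ht.1.le] at hk
    have e1 : ∫⁻ κ, pairing f κ * expNeg (pairing (fun x => t * f x) κ) ∂Γ =
        ∫⁻ κ, ENNReal.ofReal (F κ * Real.exp (-(t * F κ))) ∂Γ := by
      refine lintegral_congr_ae ?_
      filter_upwards [hfin, hE t ht.1.le] with κ hκ hκ'
      rw [hκ', ENNReal.ofReal_mul (hF0 κ), ENNReal.ofReal_toReal hκ]
    have hGn : 0 ≤ 1 - G t := by
      rw [← hGφ t ht.1.le]; exact integral_nonneg fun _ => Real.exp_nonneg _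
    have hk2 := congrArg ENNReal.toReal hk
    rw [e1, ENNReal.toReal_mul, ENNReal.toReal_ofReal hGn] at hk2
    rw [integral_eq_lintegral_of_nonneg_ae
      (Filter.Eventually.of_forall fun κ => mul_nonneg (hF0 κ) (Real.exp_nonneg _))
      (by fun_prop : Measurable _).aestronglyMeasurable, hk2]
    have hfm := hf.meas
    rw [integral_eq_lintegral_of_nonneg_ae
      (Filter.Eventually.of_forall fun x => mul_nonneg (hf.nonneg x) (Real.exp_nonneg _))
      (by fun_prop : Measurable _).aestronglyMeasurable]
    rfl
  have hconst : (1 - G 1) * Real.exp (Ψ 1) = (1 - G 0) * Real.exp (Ψ 0) := by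
    obtain ⟨c, hc, hc'⟩ := exists_hasDerivAt_eq_slope (fun t => (1 - G t) * Real.exp (Ψ t)) (fun _ => 0)
      (zero_lt_one' ℝ)
      ((continuousOn_const.sub (psi_cont Γ hF0 hFm hF)).mul (psi_cont ϱ hf.nonneg hf.meas hfi).rexp)
      (fun t ht => by
        have := ((psi_deriv Γ hF0 hFm hF ht).const_sub 1).mul (psi_deriv ϱ hf.nonneg hf.meas hfi ht).exp
        refine this.congr_deriv ?_
        rw [hrel t ht]
        simp only [hG]
        ring)
    simp only [sub_zero, div_one] at hc'
    linarith
  have hG0 : G 0 = 0 := by simp [hG]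
  have hΨ0 : Ψ 0 = 0 := by simp [hΨ]
  have h1 := hL 1 zero_le_one
  simp only [one_mul] at h1
  rw [h1, hGφ 1 zero_le_one]
  have hΨ1 : ∫⁻ x, ENNReal.ofReal (1 - Real.exp (-f x)) ∂ϱ = ENNReal.ofReal (Ψ 1) := by
    have hfm := hf.meas
    rw [hΨ]; simp only [one_mul]
    rw [ofReal_integral_eq_lintegral_ofReal]
    · refine hfi.mono' (by fun_prop : Measurable _).aestronglyMeasurable (Filter.Eventually.of_forall fun x => ?_)
      simpa using one_sub_exp_bound zero_le_one le_rfl (hf.nonneg x)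
    · refine Filter.Eventually.of_forall fun x => ?_
      have : Real.exp (-f x) ≤ 1 := Real.exp_le_one_iff.2 (by linarith [hf.nonneg x])
      simpa using this
  have hΨnn : 0 ≤ Ψ 1 := by
    refine integral_nonneg fun x => ?_
    have : Real.exp (-f x) ≤ 1 := Real.exp_le_one_iff.2 (by linarith [hf.nonneg x])
    simpa using this
  rw [hΨ1, expNeg_ofReal hΨnn, Real.exp_neg]
  congr 1
  rw [hG0, hΨ0] at hconst
  have := Real.exp_pos (Ψ 1)
  field_simp
  simpa using hconst

lemma laplace_all (Γ : Measure (Measure X)) [IsProbabilityMeasure Γ] (ϱ : Measure X) (W : ℕ → Set X)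
    (hWo : ∀ n, MeasurableSet (W n)) (hWu : ⋃ n, W n = Set.univ) (hWmono : Monotone W)
    (hWϱ : ∀ n, ϱ (W n) < ∞) (hΓ : ∀ᵐ κ ∂Γ, ∀ n, κ (W n) < ∞)
    (key : ∀ n, ∀ f g : X → ℝ, Nice (W n) f → Nice (W n) g →
      ∫⁻ κ, pairing g κ * expNeg (pairing f κ) ∂Γ =
        pairing (fun x => g x * Real.exp (-f x)) ϱ * laplaceT Γ f)
    {f : X → ℝ} (hf : MemU f) :
    laplaceT Γ f = expNeg (∫⁻ x, ENNReal.ofReal (1 - Real.exp (-f x)) ∂ϱ) := by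
  obtain ⟨hfm, hf0, ⟨C, hC⟩, -⟩ := hf
  set u : ℕ → X → ℝ := fun n => (W n).indicator f with hu
  have hun : ∀ n, Nice (W n) (u n) := fun n =>
    ⟨hfm.indicator (hWo n), fun x => Set.indicator_nonneg (fun x _ => hf0 x) x,
      ⟨C, fun x => (Set.indicator_le_self' (fun x _ => hf0 x) x).trans (hC x)⟩,
      fun x hx => Set.indicator_of_notMem hx _⟩
  have humono : ∀ x, Monotone fun n => u n x := fun x i j hij =>
    Set.indicator_le_indicator_of_subset (hWmono hij) hf0 x
  have hutend : ∀ x, Filter.Tendsto (fun n => u n x) Filter.atTop (nhds (f x)) := by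
    intro x
    obtain ⟨k, hk⟩ : ∃ k, x ∈ W k := by
      have : x ∈ ⋃ n, W n := by rw [hWu]; trivial
      simpa using this
    refine tendsto_const_nhds.congr' ?_
    filter_upwards [Filter.eventually_ge_atTop k] with i hi
    exact (Set.indicator_of_mem (hWmono hi hk) f).symm
  have hT1 : ∀ κ : Measure X, Filter.Tendsto (fun n => pairing (u n) κ) Filter.atTop (nhds (pairing f κ)) := by
    intro κ
    refine lintegral_tendsto_of_tendsto_of_monotone (fun n => (hun n).meas.ennreal_ofReal.aemeasurable)
      (Filter.Eventually.of_forall fun x i j hij => ENNReal.ofReal_le_ofReal (humono x hij))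
      (Filter.Eventually.of_forall fun x => (ENNReal.continuous_ofReal.tendsto _).comp (hutend x))
  have hT2 : Filter.Tendsto (fun n => laplaceT Γ (u n)) Filter.atTop (nhds (laplaceT Γ f)) := by
    refine tendsto_lintegral_of_dominated_convergence (fun _ => 1)
      (fun n => measurable_expNeg.comp (measurable_pairing (hun n).meas))
      (fun n => Filter.Eventually.of_forall fun κ => expNeg_le_one _) (by simp)
      (Filter.Eventually.of_forall fun κ => expNeg_tendsto (hT1 κ))
  have hT3 : Filter.Tendsto (fun n => ∫⁻ x, ENNReal.ofReal (1 - Real.exp (-u n x)) ∂ϱ) Filter.atTop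
      (nhds (∫⁻ x, ENNReal.ofReal (1 - Real.exp (-f x)) ∂ϱ)) := by
    refine lintegral_tendsto_of_tendsto_of_monotone
      (fun n => ((hun n).meas.neg.exp.const_sub 1).ennreal_ofReal.aemeasurable)
      (Filter.Eventually.of_forall fun x i j hij => ENNReal.ofReal_le_ofReal
        (sub_le_sub_left (Real.exp_le_exp.2 (neg_le_neg (humono x hij))) 1))
      (Filter.Eventually.of_forall fun x => (ENNReal.continuous_ofReal.tendsto _).comp
        (((Real.continuous_exp.tendsto _).comp (hutend x).neg).const_sub 1))
  refine tendsto_nhds_unique hT2 ?_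
  simp only [fun n => laplace_nice Γ ϱ W hWo hWu hWmono hWϱ hΓ key (hun n)]
  exact expNeg_tendsto hT3
end
end PSAux

/-- If a first-order point process `P` satisfies the `n`-fold splitting factorization
(`n = m + 1 ≥ 2`), `S^n_q(P) = Γ_{q₁}(P) ⊗ ⋯ ⊗ Γ_{q_n}(P)`, then the Campbell measure of
`Γ_{q₁}(P)` satisfies `C_{Γ_{q₁}(P)}(h) = ∫ Γ_{q₁}(P)(dκ) ∫ h(x, κ+δ_x) q₁ ν_P(dx)`, i.e.
`Γ_{q₁}(P)` has constant Papangelou kernel `q₁ ν_P`; hence `Γ_{q₁}(P) = Π_{q₁ ν_P}`. -/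
theorem statement14 {X : Type*} [MeasurableSpace X] [MetricSpace X] [PolishSpace X]
    [BorelSpace X] (P : Measure (Measure X)) (hP : IsPointProcess P)
    (hP1 : IsFirstOrder P)
    (m : ℕ) (hm : 1 ≤ m) (q : Fin (m + 1) → ℝ)
    (hq : ∀ i, q i ∈ Set.Ioo (0 : ℝ) 1) (hsum : ∑ i, q i = 1)
    (Th : ℝ → Measure X → Measure (Measure X)) (hThm : ∀ s, Measurable (Th s))
    (hTh : ∀ s ∈ Set.Ioo (0 : ℝ) 1, ∀ μ, IsPointMeasure μ → IsThinning s μ (Th s μ))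
    (hfact : ∀ h : (Fin (m + 1) → Measure X) → ℝ≥0∞, Measurable h →
      ∫⁻ μ, seqThinInt Th m (splitProbs q) μ h ∂P
        = ∫⁻ κ, h κ ∂(Measure.pi fun i => P.bind (Th (q i)))) :
    (∀ h : X → Measure X → ℝ≥0∞, Measurable (Function.uncurry h) →
      ∫⁻ κ, ∫⁻ x, h x κ ∂κ ∂(P.bind (Th (q 0)))
        = ∫⁻ κ, ∫⁻ x, h x (κ + Measure.dirac x)
            ∂(ENNReal.ofReal (q 0) • momentMeasure P) ∂(P.bind (Th (q 0))))
      ∧ IsPoissonPP (ENNReal.ofReal (q 0) • momentMeasure P) (P.bind (Th (q 0))) := by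
  obtain ⟨m, rfl⟩ : ∃ k, m = k + 1 := ⟨m - 1, by omega⟩
  have hν : IsLocallyFiniteMeasure (momentMeasure P) := hP1
  obtain ⟨W, hWopen, hWu, hWmono, hWb, hWν⟩ := PSAux.exists_exhaust (momentMeasure P)
  have hWo : ∀ n, MeasurableSet (W n) := fun n => (hWopen n).measurableSet
  have hΓp : IsProbabilityMeasure (P.bind (Th (q 0))) := PSAux.bind_prob hP hThm hTh (hq 0)
  obtain ⟨A, hAm, hA1, hA2⟩ := PSAux.exists_meas_PM W hWopen hWu
  have hSm : MeasurableSet (A ∩ ⋂ n, {κ : Measure X | κ (W n) < ∞}) :=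
    hAm.inter (MeasurableSet.iInter fun n => measurableSet_lt (Measure.measurable_coe (hWo n)) measurable_const)
  have hΓS : ∀ᵐ κ ∂(P.bind (Th (q 0))), κ ∈ A ∩ ⋂ n, {κ : Measure X | κ (W n) < ∞} := by
    rw [ae_iff]
    change (P.bind (Th (q 0))) (A ∩ ⋂ n, {κ : Measure X | κ (W n) < ∞})ᶜ = 0
    rw [Measure.bind_apply hSm.compl (hThm _).aemeasurable,
      ← lintegral_zero (μ := P)]
    refine lintegral_congr_ae ?_
    have hW' : ∀ᵐ μ ∂P, ∀ n, μ (W n) < ∞ := ae_all_iff.2 fun n => PSAux.ae_W (hWo n) (hWν n)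
    filter_upwards [hP.2, hW'] with μ hμ hμW
    have hae : ∀ᵐ κ ∂(Th (q 0) μ), κ ∈ A ∩ ⋂ n, {κ : Measure X | κ (W n) < ∞} := by
      filter_upwards [(hTh _ (hq 0) μ hμ).2.1] with κ hκ
      have hκW : ∀ n, κ (W n) < ∞ := fun n => (hκ.2 (W n)).trans_lt (hμW n)
      exact ⟨hA2 κ hκ.1 hκW, Set.mem_iInter.2 hκW⟩
    exact hae
  have hΓPM : ∀ᵐ κ ∂(P.bind (Th (q 0))), IsPointMeasure κ := hΓS.mono fun κ hκ => hA1 κ hκ.1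
  have hΓW : ∀ᵐ κ ∂(P.bind (Th (q 0))), ∀ n, κ (W n) < ∞ := hΓS.mono fun κ hκ => Set.mem_iInter.1 hκ.2
  have hWϱ : ∀ n, (ENNReal.ofReal (q 0) • momentMeasure P) (W n) < ∞ := fun n => by
    simpa using ENNReal.mul_lt_top ENNReal.ofReal_lt_top (hWν n)
  have key : ∀ n, ∀ f g : X → ℝ, PSAux.Nice (W n) f → PSAux.Nice (W n) g →
      ∫⁻ κ, pairing g κ * expNeg (pairing f κ) ∂(P.bind (Th (q 0))) =
        pairing (fun x => g x * Real.exp (-f x)) (ENNReal.ofReal (q 0) • momentMeasure P)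
          * laplaceT (P.bind (Th (q 0))) f := by
    intro n f g hf hg
    have hg' : PSAux.Nice (W n) (fun x => g x * Real.exp (-f x)) :=
      hg.mul (C := 1) hf.meas.neg.exp (fun _ => Real.exp_nonneg _)
        (fun x => Real.exp_le_one_iff.2 (by linarith [hf.nonneg x]))
    have := PSAux.campbell_nice P hP m q hq hsum Th hThm hTh hfact (hWo n) (hWb n) (hWν n) hf hg'
    have e : (fun x => g x * Real.exp (-f x) * Real.exp (f x)) = g := by
      ext x; rw [mul_assoc, ← Real.exp_add]; simp
    rw [e] at this
    rw [this]
    simp [pairing]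
  exact ⟨fun h hh => PSAux.campbell_all _ _ W hWo hWu hWmono hWϱ hΓW key h hh, hΓp, hΓPM,
    fun f hf => PSAux.laplace_all _ _ W hWo hWu hWmono hWϱ hΓW key hf⟩
end
end

section
/- (Theorem 2) Let X be a Polish space, P a point process on X of first order, n ≥ 2, and q_1, …, q_n ∈ (0,1) with q_1 + … + q_n = 1. Then P is a Poisson point process if and only if the multi-splitting law factorizes: S^n_q(P) = Γ_{q_1}(P) ⊗ ⋯ ⊗ Γ_{q_n}(P). Moreover, in that case P = Π_{ν_P}. -/
open MeasureTheory ENNReal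

noncomputable section

namespace PoissonSplitting
variable {X : Type*} [MeasurableSpace X] [MetricSpace X]

lemma expNeg_top : expNeg ∞ = 0 := by simp [expNeg]

lemma expNeg_ofReal {a : ℝ} (ha : 0 ≤ a) :
    expNeg (ENNReal.ofReal a) = ENNReal.ofReal (Real.exp (-a)) := by
  simp [expNeg, ENNReal.toReal_ofReal ha]

lemma expNeg_of_ne_top {a : ℝ≥0∞} (ha : a ≠ ∞) :
    expNeg a = ENNReal.ofReal (Real.exp (-a.toReal)) := by
  simp [expNeg, ha]

lemma expNeg_zero : expNeg 0 = 1 := by simp [expNeg]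

lemma expNeg_add (a b : ℝ≥0∞) : expNeg (a + b) = expNeg a * expNeg b := by
  by_cases ha : a = ∞
  · simp [ha, expNeg_top]
  by_cases hb : b = ∞
  · simp [hb, expNeg_top]
  rw [expNeg_of_ne_top ha, expNeg_of_ne_top hb, expNeg_of_ne_top (by simp [ha, hb]),
    ← ENNReal.ofReal_mul (Real.exp_pos _).le, ← Real.exp_add, ENNReal.toReal_add ha hb]
  congr 2
  ring

lemma expNeg_sum {ι : Type*} (s : Finset ι) (a : ι → ℝ≥0∞) :
    expNeg (∑ i ∈ s, a i) = ∏ i ∈ s, expNeg (a i) := by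
  classical
  induction s using Finset.induction_on with
  | empty => simp [expNeg_zero]
  | insert i s hi ih => rw [Finset.sum_insert hi, Finset.prod_insert hi, expNeg_add, ih]

lemma expNeg_nsmul (n : ℕ) (a : ℝ≥0∞) : expNeg (n * a) = expNeg a ^ n := by
  have := expNeg_sum (Finset.range n) (fun _ => a)
  simpa using this

lemma expNeg_anti : Antitone expNeg := by
  intro a b hab
  by_cases hb : b = ∞
  · simp [hb, expNeg_top]
  have ha : a ≠ ∞ := ne_top_of_le_ne_top hb hab
  rw [expNeg_of_ne_top ha, expNeg_of_ne_top hb]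
  apply ENNReal.ofReal_le_ofReal
  apply Real.exp_le_exp.2
  have := ENNReal.toReal_mono hb hab
  linarith

lemma expNeg_le_one (a : ℝ≥0∞) : expNeg a ≤ 1 := by
  rw [← expNeg_zero]; exact expNeg_anti (zero_le)

lemma expNeg_ne_top (a : ℝ≥0∞) : expNeg a ≠ ∞ :=
  ne_top_of_le_ne_top one_ne_top (expNeg_le_one a)

lemma measurable_expNeg : Measurable expNeg := expNeg_anti.measurable

/-- measurable left inverse of `expNeg` -/
def invExp (y : ℝ) : ℝ≥0∞ := if y = 0 then ∞ else ENNReal.ofReal (-Real.log y)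

lemma measurable_invExp : Measurable invExp := by
  unfold invExp
  refine Measurable.ite (measurableSet_singleton 0) measurable_const ?_
  fun_prop

lemma invExp_expNeg (a : ℝ≥0∞) : invExp (expNeg a).toReal = a := by
  by_cases ha : a = ∞
  · simp [ha, expNeg_top, invExp]
  · rw [expNeg_of_ne_top ha, ENNReal.toReal_ofReal (Real.exp_pos _).le, invExp,
      if_neg (Real.exp_pos _).ne', Real.log_exp, neg_neg, ENNReal.ofReal_toReal ha]

/-- `expNeg` with values in the unit interval. -/
def expI (a : ℝ≥0∞) : unitInterval :=
  ⟨(expNeg a).toReal, ENNReal.toReal_nonneg, by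
    simpa using ENNReal.toReal_mono one_ne_top (expNeg_le_one a)⟩

lemma measurable_expI : Measurable expI :=
  (measurable_expNeg.ennreal_toReal).subtype_mk

lemma measurable_pairing {f : X → ℝ} (hf : Measurable f) : Measurable (pairing f) :=
  Measure.measurable_lintegral hf.ennreal_ofReal

open BoundedContinuousFunction in
lemma ext_moments {J : Type*} [Fintype J] (P P' : Measure (J → unitInterval))
    [IsFiniteMeasure P] [IsFiniteMeasure P']
    (h : ∀ n : J → ℕ, ∫ y, ∏ j, (y j : ℝ) ^ n j ∂P = ∫ y, ∏ j, (y j : ℝ) ^ n j ∂P') : P = P' := by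
  classical
  let co : J → ((J → unitInterval) →ᵇ ℝ) := fun j =>
    BoundedContinuousFunction.mkOfCompact ⟨fun y => (y j : ℝ), by fun_prop⟩
  let A : StarSubalgebra ℝ ((J → unitInterval) →ᵇ ℝ) :=
    { Algebra.adjoin ℝ (Set.range co) with
      star_mem' := by
        intro a ha
        have : star a = a := by ext; simp
        rw [this]; exact ha }
  have hA : ∀ g, g ∈ A ↔ g ∈ Algebra.adjoin ℝ (Set.range co) := fun g => Iff.rfl
  refine ext_of_forall_mem_subalgebra_integral_eq_of_pseudoEMetric_complete_countable
    (𝕜 := ℝ) (A := A) ?_ ?_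
  · intro x y hxy
    obtain ⟨j, hj⟩ := Function.ne_iff.1 hxy
    refine ⟨fun z => (z j : ℝ), ⟨toContinuousMapStarₐ ℝ (co j), ?_, rfl⟩, ?_⟩
    · exact ⟨co j, (hA _).2 (Algebra.subset_adjoin ⟨j, rfl⟩), rfl⟩
    · simpa [Subtype.ext_iff] using hj
  · intro g hg
    rw [hA, ← Subalgebra.mem_toSubmodule, Algebra.adjoin_eq_span] at hg
    induction hg using Submodule.span_induction with
    | mem g hg =>
      have : ∃ n : J → ℕ, ∀ y, g y = ∏ j, (y j : ℝ) ^ n j := by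
        induction hg using Submonoid.closure_induction with
        | mem g hg =>
          obtain ⟨j, rfl⟩ := hg
          refine ⟨fun i => if i = j then 1 else 0, fun y => ?_⟩
          simp [co, Finset.prod_ite_eq', pow_ite]
        | one => exact ⟨fun _ => 0, fun y => by simp⟩
        | mul a b _ _ ha hb =>
          obtain ⟨n, hn⟩ := ha
          obtain ⟨n', hn'⟩ := hb
          refine ⟨n + n', fun y => ?_⟩
          simp [hn, hn', pow_add, Finset.prod_mul_distrib]
      obtain ⟨n, hn⟩ := this
      simp only [hn, h]
    | zero => simp
    | add a b _ _ ha hb =>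
      simp only [BoundedContinuousFunction.coe_add, Pi.add_apply]
      rw [integral_add (a.integrable _) (b.integrable _),
        integral_add (a.integrable _) (b.integrable _), ha, hb]
    | smul c a _ ha =>
      simp only [BoundedContinuousFunction.coe_smul, smul_eq_mul]
      rw [integral_const_mul, integral_const_mul, ha]

lemma exists_bounded_cover (X : Type*) [MetricSpace X] [MeasurableSpace X] [OpensMeasurableSpace X] :
    ∃ C : ℕ → Set X, Monotone C ∧ (∀ n, MeasurableSet (C n)) ∧ (∀ n, Bornology.IsBounded (C n)) ∧
      ⋃ n, C n = Set.univ := by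
  rcases isEmpty_or_nonempty X with hX | ⟨⟨x⟩⟩
  · exact ⟨fun _ => ∅, fun _ _ _ => le_rfl, by simp, by simp, Subsingleton.elim _ _⟩
  · exact ⟨fun n => Metric.ball x n, fun a b hab => Metric.ball_subset_ball (by exact_mod_cast hab),
      fun n => measurableSet_ball, fun n => Metric.isBounded_ball, Metric.iUnion_ball_nat x⟩

lemma ext_laplace [OpensMeasurableSpace X] {ι : Type*} [Fintype ι] (Q1 Q2 : Measure (ι → Measure X))
    [IsFiniteMeasure Q1] [IsFiniteMeasure Q2]
    (h : ∀ g : ι → X → ℝ, (∀ i, MemU (g i)) →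
      ∫⁻ κ, expNeg (∑ i, pairing (g i) (κ i)) ∂Q1 = ∫⁻ κ, expNeg (∑ i, pairing (g i) (κ i)) ∂Q2) :
    Q1 = Q2 := by
  classical
  let J := {p : ι × Set X // MeasurableSet p.2 ∧ Bornology.IsBounded p.2}
  let Φ : (ι → Measure X) → (J → unitInterval) := fun κ j => expI (κ j.1.1 j.1.2)
  have hΦ : Measurable Φ := measurable_pi_iff.2 fun j =>
    measurable_expI.comp ((Measure.measurable_coe j.2.1).comp (measurable_pi_apply j.1.1))
  have key : Q1.map Φ = Q2.map Φ := by
    have hr : ∀ F : Finset J, Measurable (F.restrict : (J → unitInterval) → (F → unitInterval)) :=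
      fun F => Finset.measurable_restrict F
    have : ∀ F : Finset J, (Q1.map Φ).map F.restrict = (Q2.map Φ).map F.restrict := by
      intro F
      apply ext_moments
      intro n
      rw [Measure.map_map (hr F) hΦ, Measure.map_map (hr F) hΦ]
      have hm : Measurable fun y : F → unitInterval => ∏ j, (y j : ℝ) ^ n j := by fun_prop
      rw [integral_map ((hr F).comp hΦ).aemeasurable hm.aestronglyMeasurable,
        integral_map ((hr F).comp hΦ).aemeasurable hm.aestronglyMeasurable]
      let g : ι → X → ℝ := fun i x => ∑ j : F,
        if j.1.1.1 = i then (n j : ℝ) * j.1.1.2.indicator 1 x else 0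
      have hterm : ∀ i (j : F), Measurable fun x : X =>
          (if j.1.1.1 = i then (n j : ℝ) * j.1.1.2.indicator 1 x else 0 : ℝ) := by
        intro i j
        split_ifs
        · exact measurable_const.mul (measurable_one.indicator j.1.2.1)
        · exact measurable_const
      have hterm0 : ∀ i (j : F) (x : X), 
          (0 : ℝ) ≤ (if j.1.1.1 = i then (n j : ℝ) * j.1.1.2.indicator 1 x else 0 : ℝ) := by
        intro i j x
        split_ifs
        · exact mul_nonneg (Nat.cast_nonneg _) (Set.indicator_nonneg (fun _ _ => zero_le_one) _)
        · exact le_rfl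
      have hg : ∀ i, MemU (g i) := by
        intro i
        refine ⟨Finset.measurable_fun_sum _ fun j _ => hterm i j,
          fun x => Finset.sum_nonneg fun j _ => hterm0 i j x, ⟨∑ j : F, (n j : ℝ), fun x => ?_⟩, ?_⟩
        · refine Finset.sum_le_sum fun j _ => ?_
          split_ifs
          · refine mul_le_of_le_one_right (Nat.cast_nonneg _) ?_
            exact Set.indicator_le_self' (fun _ _ => zero_le_one) x
          · exact Nat.cast_nonneg _
        · refine Bornology.IsBounded.subset (t := ⋃ j : F, j.1.1.2) ?_ ?_
          · exact (Bornology.isBounded_iUnion).2 fun j => j.1.2.2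
          · intro x hx
            obtain ⟨j, _, hj⟩ := Finset.exists_ne_zero_of_sum_ne_zero hx
            refine Set.mem_iUnion.2 ⟨j, ?_⟩
            by_contra hc
            simp [hc] at hj
      have hval : ∀ κ : ι → Measure X, ∏ j, (((F.restrict ∘ Φ) κ j : unitInterval) : ℝ) ^ n j
          = (expNeg (∑ i, pairing (g i) (κ i))).toReal := by
        intro κ
        have h1 : ∀ i, pairing (g i) (κ i) =
            ∑ j : F, if j.1.1.1 = i then (n j : ℝ≥0∞) * κ j.1.1.1 j.1.1.2 else 0 := by
          intro i
          unfold pairing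
          simp only [g]
          simp_rw [ENNReal.ofReal_sum_of_nonneg (fun j _ => hterm0 i j _)]
          rw [lintegral_finsetSum _ (fun j _ => (hterm i j).ennreal_ofReal)]
          refine Finset.sum_congr rfl fun j _ => ?_
          split_ifs with hji
          · subst hji
            simp_rw [ENNReal.ofReal_mul (Nat.cast_nonneg (n j))]
            rw [lintegral_const_mul _ (measurable_one.indicator j.1.2.1).ennreal_ofReal]
            have : ∀ x, ENNReal.ofReal ((j.1.1.2).indicator (1 : X → ℝ) x)
                = (j.1.1.2).indicator (1 : X → ℝ≥0∞) x := by
              intro x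
              by_cases hx : x ∈ j.1.1.2 <;> simp [hx]
            simp_rw [this]
            rw [lintegral_indicator_one j.1.2.1]
            simp
          · simp
        have h2 : ∑ i, pairing (g i) (κ i) = ∑ j : F, (n j : ℝ≥0∞) * κ j.1.1.1 j.1.1.2 := by
          simp_rw [h1]
          rw [Finset.sum_comm]
          simp
        rw [h2, expNeg_sum, ENNReal.toReal_prod]
        refine Finset.prod_congr rfl fun j _ => ?_
        rw [expNeg_nsmul, ENNReal.toReal_pow]
        rfl
      simp_rw [hval]
      have hmm : Measurable fun κ : ι → Measure X => expNeg (∑ i, pairing (g i) (κ i)) :=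
        measurable_expNeg.comp (Finset.measurable_fun_sum _ fun i _ =>
          (measurable_pairing (hg i).1).comp (measurable_pi_apply i))
      rw [integral_toReal hmm.aemeasurable (ae_of_all _ fun κ => (expNeg_ne_top _).lt_top),
        integral_toReal hmm.aemeasurable (ae_of_all _ fun κ => (expNeg_ne_top _).lt_top), h g hg]
    refine IsProjectiveLimit.unique (P := fun F : Finset J => (Q2.map Φ).map F.restrict) ?_ ?_
    · intro F; exact this F
    · intro F; rfl
  -- recover
  obtain ⟨C, hCm, hC, hCb, hCu⟩ := exists_bounded_cover X
  have hle : (inferInstance : MeasurableSpace (ι → Measure X)) ≤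
      MeasurableSpace.comap Φ inferInstance := by
    have hid : @Measurable _ _ (MeasurableSpace.comap Φ inferInstance) _
        (id : (ι → Measure X) → (ι → Measure X)) := by
      refine @measurable_pi_lambda _ _ _ (MeasurableSpace.comap Φ inferInstance) _ _ fun i => ?_
      refine @Measure.measurable_of_measurable_coe _ _ _ (MeasurableSpace.comap Φ inferInstance)
        _ fun B hB => ?_
      have hB' : ∀ κ : ι → Measure X, κ i B = ⨆ n, κ i (B ∩ C n) := by
        intro κ
        rw [← Monotone.measure_iUnion, ← Set.inter_iUnion, hCu, Set.inter_univ]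
        intro a b hab
        exact Set.inter_subset_inter_right _ (hCm hab)
      have : (fun κ : ι → Measure X => (id κ) i B) = fun κ => ⨆ n, κ i (B ∩ C n) := by
        ext κ; exact hB' κ
      rw [this]
      refine Measurable.iSup fun (n : ℕ) => ?_
      let j : J := ⟨(i, B ∩ C n), hB.inter (hC n), (hCb n).subset Set.inter_subset_right⟩
      have : (fun κ : ι → Measure X => κ i (B ∩ C n)) =
          (fun y : J → unitInterval => invExp (y j : ℝ)) ∘ Φ := by
        ext κ
        exact (invExp_expNeg _).symm
      rw [this]
      refine Measurable.comp (g := fun y : J → unitInterval => invExp (y j : ℝ)) ?_ (comap_measurable Φ)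
      exact measurable_invExp.comp (measurable_subtype_coe.comp (measurable_pi_apply j))
    intro s hs
    exact hid hs
  ext s hs
  obtain ⟨t, ht, rfl⟩ := hle s hs
  rw [← Measure.map_apply hΦ ht, key, Measure.map_apply hΦ ht]

end PoissonSplitting

namespace PoissonSplitting
variable {X : Type*} [MeasurableSpace X] [MetricSpace X]

/-- `μ` is integer valued and finite on each `O n`. -/
def Good (O : ℕ → Set X) (μ : Measure X) : Prop :=
  ∀ n, ∀ B, MeasurableSet B → μ (B ∩ O n) ∈ Set.range ((↑) : ℕ → ℝ≥0∞)

/-- A countable open cover. -/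
def IsCov (O : ℕ → Set X) : Prop := (∀ n, IsOpen (O n)) ∧ ⋃ n, O n = Set.univ

lemma Good.ne_top {O : ℕ → Set X} {μ : Measure X} (h : Good O μ) (n : ℕ) : μ (O n) ≠ ∞ := by
  obtain ⟨k, hk⟩ := h n Set.univ MeasurableSet.univ
  rw [Set.univ_inter] at hk
  rw [← hk]; exact natCast_ne_top k

lemma Good.locFin {O : ℕ → Set X} (hO : IsCov O) {μ : Measure X} (h : Good O μ) :
    IsLocallyFiniteMeasure μ := by
  refine ⟨fun x => ?_⟩
  obtain ⟨n, hn⟩ := Set.mem_iUnion.1 (hO.2 ▸ Set.mem_univ x)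
  exact ⟨O n, (hO.1 n).mem_nhds hn, (h.ne_top n).lt_top⟩

variable [BorelSpace X]

lemma tendsto_ball_inter {O : Set X} (hO : IsOpen O) {μ : Measure X} (hμ : μ O ≠ ∞) {x : X}
    (hx : x ∈ O) :
    Filter.Tendsto (fun k : ℕ => μ (Metric.ball x (1 / ((k : ℝ) + 1)) ∩ O)) Filter.atTop
      (nhds (μ {x})) := by
  have : {x} = ⋂ k : ℕ, (Metric.ball x (1 / ((k : ℝ) + 1)) ∩ O) := by
    ext y
    simp only [Set.mem_singleton_iff, Set.mem_iInter, Set.mem_inter_iff, Metric.mem_ball]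
    constructor
    · rintro rfl k
      exact ⟨by simpa using Nat.one_div_pos_of_nat (α := ℝ), hx⟩
    · intro h
      by_contra hne
      obtain ⟨k, hk⟩ := exists_nat_one_div_lt (dist_pos.2 hne)
      exact absurd (h k).1 (not_lt.2 hk.le)
  rw [this]
  refine tendsto_measure_iInter_atTop (fun k => ?_) ?_ ⟨0, ?_⟩
  · exact (measurableSet_ball.inter hO.measurableSet).nullMeasurableSet
  · intro a b hab
    refine Set.inter_subset_inter_left _ (Metric.ball_subset_ball ?_)
    exact Nat.one_div_le_one_div hab
  · exact ne_top_of_le_ne_top hμ (measure_mono Set.inter_subset_right)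

variable [SecondCountableTopology X]

lemma Good.atoms {O : ℕ → Set X} (hO : IsCov O) {μ : Measure X} (h : Good O μ) :
    {x | μ {x} ≠ 0}.Countable ∧ μ {x | μ {x} ≠ 0}ᶜ = 0 := by
  have := h.locFin hO
  constructor
  · have := Measure.countable_meas_pos_of_disjoint_iUnion (μ := μ) (As := fun x : X => {x})
      (fun x => measurableSet_singleton x) (fun x y hxy => by simpa using hxy)
    simpa [pos_iff_ne_zero] using this
  · refine measure_null_of_locally_null _ fun x hx => ?_
    have hx : μ {x} = 0 := by simpa using hx
    obtain ⟨n, hn⟩ := Set.mem_iUnion.1 (hO.2 ▸ Set.mem_univ x)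
    have ht := tendsto_ball_inter (hO.1 n) (h.ne_top n) hn
    rw [hx] at ht
    obtain ⟨k, hk⟩ := (ht.eventually (gt_mem_nhds (zero_lt_one' ℝ≥0∞))).exists
    refine ⟨Metric.ball x (1 / ((k : ℝ) + 1)) ∩ O n, mem_nhdsWithin_of_mem_nhds ?_, ?_⟩
    · exact Filter.inter_mem (Metric.ball_mem_nhds _ Nat.one_div_pos_of_nat) ((hO.1 n).mem_nhds hn)
    · obtain ⟨j, hj⟩ := h n _ (measurableSet_ball (x := x) (ε := 1 / ((k : ℝ) + 1)))
      rw [← hj] at hk ⊢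
      have : j < 1 := by exact_mod_cast hk
      have : j = 0 := by omega
      simp [this]

lemma apply_of_atoms {μ : Measure X} {S : Set X} (hS : S.Countable) (h : μ Sᶜ = 0) {B : Set X}
    (hB : MeasurableSet B) : μ B = ∑' x : S, μ {(x : X)} * B.indicator 1 (x : X) := by
  have := hS.to_subtype
  have h1 : μ B = μ (B ∩ S) := by
    refine le_antisymm ?_ (measure_mono Set.inter_subset_left)
    calc μ B ≤ μ ((B ∩ S) ∪ Sᶜ) := measure_mono (by intro x hx; by_cases hs : x ∈ S <;> simp [hx, hs])
      _ ≤ μ (B ∩ S) + μ Sᶜ := measure_union_le _ _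
      _ = _ := by rw [h, add_zero]
  have h2 : B ∩ S = ⋃ x : S, (B ∩ {(x : X)}) := by
    rw [← Set.inter_iUnion]; simp
  rw [h1, h2, measure_iUnion]
  · refine tsum_congr fun x => ?_
    by_cases hx : (x : X) ∈ B
    · simp [hx, Set.inter_eq_right.2 (Set.singleton_subset_iff.2 hx)]
    · simp [hx]
  · intro x y hxy
    refine Disjoint.mono Set.inter_subset_right Set.inter_subset_right ?_
    simpa [Subtype.ext_iff] using hxy
  · intro x
    exact hB.inter (measurableSet_singleton _)

lemma Good.isPointMeasure {O : ℕ → Set X} (hO : IsCov O) {μ : Measure X} (h : Good O μ) :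
    IsPointMeasure μ := by
  classical
  refine ⟨?_, h.locFin hO⟩
  obtain ⟨hS, hS0⟩ := h.atoms hO
  set S := {x | μ {x} ≠ 0} with hSdef
  have := hS.to_subtype
  have hc : ∀ x : X, ∃ c : ℕ, (c : ℝ≥0∞) = μ {x} := by
    intro x
    obtain ⟨n, hn⟩ := Set.mem_iUnion.1 (hO.2 ▸ Set.mem_univ x)
    obtain ⟨k, hk⟩ := h n {x} (measurableSet_singleton x)
    rw [Set.inter_eq_left.2 (Set.singleton_subset_iff.2 hn)] at hk
    exact ⟨k, hk⟩
  choose c hc using hc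
  let I := Σ x : S, Fin (c x)
  have : Countable I := inferInstance
  obtain ⟨e, he⟩ := exists_injective_nat I
  refine ⟨Function.extend e (fun j => some (j.1 : X)) (fun _ => none), ?_⟩
  ext B hB
  rw [Measure.sum_apply _ hB, apply_of_atoms hS hS0 hB]
  have : (fun n => (((Function.extend e (fun j : I => some (j.1 : X)) (fun _ => none) n).elim 0
      Measure.dirac : Measure X) B)) = Function.extend e (fun j : I => B.indicator 1 (j.1 : X)) 0 := by
    ext n
    by_cases hn : ∃ j, e j = n
    · obtain ⟨j, rfl⟩ := hn
      rw [he.extend_apply, he.extend_apply]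
      simp [Measure.dirac_apply' _ hB]
    · rw [Function.extend_apply' _ _ _ hn, Function.extend_apply' _ _ _ hn]
      simp
  rw [this, tsum_extend_zero he]
  refine Eq.trans ?_ (ENNReal.tsum_sigma
    (fun (x : S) (_ : Fin (c x)) => B.indicator (1 : X → ℝ≥0∞) (x : X))).symm
  refine tsum_congr fun x => ?_
  simp [hc]

lemma nat_tsum {ι : Type*} (a : ι → ℝ≥0∞) (ha : ∀ i, a i ∈ Set.range ((↑) : ℕ → ℝ≥0∞))
    (h : ∑' i, a i ≠ ∞) : ∑' i, a i ∈ Set.range ((↑) : ℕ → ℝ≥0∞) := by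
  choose k hk using ha
  have hf := ENNReal.finite_const_le_of_tsum_ne_top h one_ne_zero
  refine ⟨∑ i ∈ hf.toFinset, k i, ?_⟩
  rw [tsum_eq_sum (s := hf.toFinset)]
  · push_cast
    simp [hk]
  · intro i hi
    have : ¬ (1 ≤ a i) := by simpa using hi
    rw [← hk] at this ⊢
    have : ¬ (1 ≤ k i) := by exact_mod_cast this
    have : k i = 0 := by omega
    simp [this]

lemma IsPointMeasure.good {O : ℕ → Set X} (hO : IsCov O) {μ : Measure X} (h : IsPointMeasure μ)
    (hfin : ∀ n, μ (O n) ≠ ∞) : Good O μ := by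
  intro n B hB
  obtain ⟨⟨D, hD⟩, -⟩ := h
  have hm : MeasurableSet (B ∩ O n) := hB.inter (hO.1 n).measurableSet
  have hne : μ (B ∩ O n) ≠ ∞ := ne_top_of_le_ne_top (hfin n) (measure_mono Set.inter_subset_right)
  rw [hD, Measure.sum_apply _ hm] at hne ⊢
  refine nat_tsum _ (fun i => ?_) hne
  cases D i with
  | none => exact ⟨0, by simp⟩
  | some x =>
    by_cases hx : x ∈ B ∩ O n
    · exact ⟨1, by simp [Measure.dirac_apply' _ hm, hx]⟩
    · exact ⟨0, by simp [Measure.dirac_apply' _ hm, hx]⟩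

lemma measurableSet_good {O : ℕ → Set X} (hO : IsCov O) : MeasurableSet {μ : Measure X | Good O μ} := by
  let 𝒜 : Set (Set X) := generateSetAlgebra (TopologicalSpace.countableBasis X)
  have h𝒜c : 𝒜.Countable := countable_generateSetAlgebra (TopologicalSpace.countable_countableBasis X)
  have h𝒜 : IsSetAlgebra 𝒜 := isSetAlgebra_generateSetAlgebra
  have hgen : ‹MeasurableSpace X› = MeasurableSpace.generateFrom 𝒜 := by
    rw [generateFrom_generateSetAlgebra_eq, BorelSpace.measurable_eq (α := X)]
    exact (TopologicalSpace.isBasis_countableBasis X).borel_eq_generateFrom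
  have hm : ∀ A ∈ 𝒜, MeasurableSet A := by
    intro A hA; rw [hgen]; exact MeasurableSpace.measurableSet_generateFrom hA
  have : {μ : Measure X | Good O μ} =
      ⋂ n, ⋂ A ∈ 𝒜, {μ : Measure X | μ (A ∩ O n) ∈ Set.range ((↑) : ℕ → ℝ≥0∞)} := by
    ext μ
    simp only [Set.mem_iInter, Set.mem_ofPred_eq]
    constructor
    · intro h n A hA
      exact h n A (hm A hA)
    · intro h n B hB
      have hfin : μ (O n) ≠ ∞ := by
        obtain ⟨k, hk⟩ := h n Set.univ h𝒜.univ_mem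
        rw [Set.univ_inter] at hk
        rw [← hk]; exact natCast_ne_top k
      have hle : ∀ C, μ (C ∩ O n) ≠ ∞ := fun C =>
        ne_top_of_le_ne_top hfin (measure_mono Set.inter_subset_right)
      have hOn := (hO.1 n).measurableSet
      induction B, hB using MeasurableSpace.induction_on_inter hgen
        (fun s hs t ht _ => h𝒜.inter_mem hs ht) with
      | empty => exact ⟨0, by simp⟩
      | basic t ht => exact h n t ht
      | compl t htm ih =>
        obtain ⟨k, hk⟩ := ih
        obtain ⟨l, hl⟩ := h n Set.univ h𝒜.univ_mem
        rw [Set.univ_inter] at hl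
        refine ⟨l - k, ?_⟩
        have : tᶜ ∩ O n = O n \ (t ∩ O n) := by ext x; simp; tauto
        rw [this, measure_sdiff Set.inter_subset_right (htm.inter hOn).nullMeasurableSet (hle t),
          ← hk, ← hl, ENNReal.natCast_sub]
      | iUnion f hd hf ih =>
        have h3 : μ ((⋃ i, f i) ∩ O n) = ∑' i, μ (f i ∩ O n) := by
          rw [Set.iUnion_inter, measure_iUnion]
          · intro i j hij
            exact (hd hij).mono Set.inter_subset_left Set.inter_subset_left
          · exact fun i => (hf i).inter hOn
        have := hle (⋃ i, f i)
        rw [h3] at this ⊢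
        exact nat_tsum _ ih this
  rw [this]
  refine MeasurableSet.iInter fun n => MeasurableSet.biInter h𝒜c fun A hA => ?_
  exact (Measure.measurable_coe ((hm A hA).inter (hO.1 n).measurableSet))
    (Set.countable_range _).measurableSet

lemma Good.le_iff {O : ℕ → Set X} (hO : IsCov O) {μ κ : Measure X} (hμ : Good O μ) (hκ : Good O κ) :
    κ ≤ μ ↔ ∀ n, ∀ U ∈ TopologicalSpace.countableBasis X, κ (U ∩ O n) ≤ μ (U ∩ O n) := by
  refine ⟨fun h n U _ => h _, fun h => ?_⟩
  have hx : ∀ x, κ {x} ≤ μ {x} := by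
    intro x
    obtain ⟨n, hn⟩ := Set.mem_iUnion.1 (hO.2 ▸ Set.mem_univ x)
    refine ge_of_tendsto' (tendsto_ball_inter (hO.1 n) (hμ.ne_top n) hn) fun k => ?_
    obtain ⟨U, hU, hxU, hUb⟩ := (TopologicalSpace.isBasis_countableBasis X).mem_nhds_iff.1
      (Metric.ball_mem_nhds x (Nat.one_div_pos_of_nat (α := ℝ) (n := k)))
    calc κ {x} ≤ κ (U ∩ O n) := measure_mono (by simp [hxU, hn])
      _ ≤ μ (U ∩ O n) := h n U hU
      _ ≤ _ := measure_mono (Set.inter_subset_inter_left _ hUb)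
  obtain ⟨hS, hS0⟩ := hκ.atoms hO
  set S := {x | κ {x} ≠ 0}
  have := hS.to_subtype
  refine Measure.le_iff.2 fun B hB => ?_
  have h1 : μ.restrict S B ≤ μ B := Measure.restrict_le_self B
  refine le_trans ?_ h1
  have h2 : (μ.restrict S) Sᶜ = 0 := by
    rw [Measure.restrict_apply hS.measurableSet.compl]; simp
  rw [apply_of_atoms hS hS0 hB, apply_of_atoms hS h2 hB]
  refine ENNReal.tsum_le_tsum fun x => ?_
  refine mul_le_mul' ?_ le_rfl
  rw [Measure.restrict_apply (measurableSet_singleton _),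
    Set.inter_eq_left.2 (Set.singleton_subset_iff.2 x.2)]
  exact hx x

/-- The set of admissible pairs for subtraction. -/
def subSet (O : ℕ → Set X) : Set (Measure X × Measure X) :=
  {p | Good O p.1 ∧ Good O p.2 ∧ p.2 ≤ p.1}

lemma measurableSet_subSet {O : ℕ → Set X} (hO : IsCov O) : MeasurableSet (subSet O) := by
  have : subSet O = (Prod.fst ⁻¹' {μ : Measure X | Good O μ}) ∩
      ((Prod.snd ⁻¹' {μ : Measure X | Good O μ}) ∩
      ⋂ n, ⋂ U ∈ TopologicalSpace.countableBasis X,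
        {p : Measure X × Measure X | p.2 (U ∩ O n) ≤ p.1 (U ∩ O n)}) := by
    ext p
    simp only [subSet, Set.mem_ofPred_eq, Set.mem_inter_iff, Set.mem_preimage, Set.mem_iInter]
    constructor
    · rintro ⟨h1, h2, h3⟩
      exact ⟨h1, h2, (h1.le_iff hO h2).1 h3⟩
    · rintro ⟨h1, h2, h3⟩
      exact ⟨h1, h2, (h1.le_iff hO h2).2 h3⟩
  rw [this]
  refine (measurable_fst (measurableSet_good hO)).inter
    ((measurable_snd (measurableSet_good hO)).inter ?_)
  refine MeasurableSet.iInter fun n =>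
    MeasurableSet.biInter (TopologicalSpace.countable_countableBasis X) fun U hU => ?_
  have hm : MeasurableSet (U ∩ O n) :=
    (TopologicalSpace.isOpen_of_mem_countableBasis hU).measurableSet.inter (hO.1 n).measurableSet
  exact measurableSet_le ((Measure.measurable_coe hm).comp measurable_snd)
    ((Measure.measurable_coe hm).comp measurable_fst)

lemma sub_inter {μ κ : Measure X} (h : κ ≤ μ) {K B : Set X} (hK : MeasurableSet K)
    (hB : MeasurableSet B) (hfin : κ K ≠ ∞) : (μ - κ) (B ∩ K) = μ (B ∩ K) - κ (B ∩ K) := by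
  have : IsFiniteMeasure (κ.restrict K) := ⟨by simpa using hfin.lt_top⟩
  rw [← Measure.restrict_apply hB, Measure.restrict_sub_eq_restrict_sub_restrict hK,
    Measure.sub_apply hB (Measure.restrict_mono le_rfl h), Measure.restrict_apply hB,
    Measure.restrict_apply hB]

lemma sum_disjointed {O : ℕ → Set X} (hO : IsCov O) (μ : Measure X) {B : Set X}
    (hB : MeasurableSet B) : μ B = ∑' n, μ (B ∩ disjointed O n) := by
  rw [← measure_iUnion, ← Set.inter_iUnion, iUnion_disjointed, hO.2, Set.inter_univ]
  · intro i j hij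
    exact (disjoint_disjointed O hij).mono Set.inter_subset_right Set.inter_subset_right
  · exact fun n => hB.inter (MeasurableSet.disjointed (fun n => (hO.1 n).measurableSet) n)

lemma sub_formula {O : ℕ → Set X} (hO : IsCov O) {μ κ : Measure X} (h : κ ≤ μ)
    (hκ : ∀ n, κ (O n) ≠ ∞) {B : Set X} (hB : MeasurableSet B) :
    (μ - κ) B = ∑' n, (μ (B ∩ disjointed O n) - κ (B ∩ disjointed O n)) := by
  rw [sum_disjointed hO _ hB]
  refine tsum_congr fun n => sub_inter h
    (MeasurableSet.disjointed (fun n => (hO.1 n).measurableSet) n) hB ?_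
  exact ne_top_of_le_ne_top (hκ n) (measure_mono (disjointed_subset O n))

lemma add_sub_of_le {O : ℕ → Set X} (hO : IsCov O) {μ κ : Measure X} (h : κ ≤ μ)
    (hκ : ∀ n, κ (O n) ≠ ∞) : κ + (μ - κ) = μ := by
  ext B hB
  rw [Measure.add_apply, sub_formula hO h hκ hB, sum_disjointed hO κ hB, ← ENNReal.tsum_add,
    sum_disjointed hO μ hB]
  exact tsum_congr fun n => add_tsub_cancel_of_le (h _)

lemma add_sub_cancel' {O : ℕ → Set X} (hO : IsCov O) {α β : Measure X}
    (hα : ∀ n, α (O n) ≠ ∞) : (α + β) - α = β := by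
  ext B hB
  rw [sub_formula hO (Measure.le_add_right le_rfl) hα hB, sum_disjointed hO β hB]
  refine tsum_congr fun n => ?_
  rw [Measure.add_apply]
  refine ENNReal.add_sub_cancel_left (ne_top_of_le_ne_top (hα n) (measure_mono ?_))
  exact Set.inter_subset_right.trans (disjointed_subset O n)

lemma Good.sub {O : ℕ → Set X} (hO : IsCov O) {μ κ : Measure X} (hμ : Good O μ) (hκ : Good O κ)
    (h : κ ≤ μ) : Good O (μ - κ) := by
  intro n B hB
  rw [sub_inter h (hO.1 n).measurableSet hB (hκ.ne_top n)]
  obtain ⟨k, hk⟩ := hμ n B hB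
  obtain ⟨l, hl⟩ := hκ n B hB
  exact ⟨k - l, by rw [← hk, ← hl, ENNReal.natCast_sub]⟩

lemma Good.add {O : ℕ → Set X} {μ κ : Measure X} (hμ : Good O μ) (hκ : Good O κ) :
    Good O (μ + κ) := by
  intro n B hB
  obtain ⟨k, hk⟩ := hμ n B hB
  obtain ⟨l, hl⟩ := hκ n B hB
  exact ⟨k + l, by rw [Measure.add_apply, ← hk, ← hl, Nat.cast_add]⟩

open Classical in
/-- Measurable version of subtraction. -/
def msub (O : ℕ → Set X) (p : Measure X × Measure X) : Measure X :=
  if p ∈ subSet O then p.1 - p.2 else 0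

lemma measurable_msub {O : ℕ → Set X} (hO : IsCov O) : Measurable (msub O) := by
  classical
  refine Measure.measurable_of_measurable_coe _ fun B hB => ?_
  have : (fun p => msub O p B) = fun p => if p ∈ subSet O then
      ∑' n, (p.1 (B ∩ disjointed O n) - p.2 (B ∩ disjointed O n)) else 0 := by
    ext p
    unfold msub
    split_ifs with hp
    · exact sub_formula hO hp.2.2 (fun n => hp.2.1.ne_top n) hB
    · simp
  rw [this]
  refine Measurable.ite (measurableSet_subSet hO) ?_ measurable_const
  refine Measurable.ennreal_tsum fun n => ?_
  have hm : MeasurableSet (B ∩ disjointed O n) :=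
    hB.inter (MeasurableSet.disjointed (fun n => (hO.1 n).measurableSet) n)
  exact ((Measure.measurable_coe hm).comp measurable_fst).sub
    ((Measure.measurable_coe hm).comp measurable_snd)

end PoissonSplitting

namespace PoissonSplitting
variable {X : Type*} [MeasurableSpace X] [MetricSpace X]

open Classical in
/-- Markov-kernel version of a measurable family of laws. -/
def thK (T : Measure X → Measure (Measure X)) (hT : Measurable T) :
    ProbabilityTheory.Kernel (Measure X) (Measure X) where
  toFun μ := if T μ Set.univ = 1 then T μ else Measure.dirac 0
  measurable' := Measurable.ite
    (((Measure.measurable_coe MeasurableSet.univ).comp hT) (measurableSet_singleton 1)) hT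
    measurable_const

instance (T : Measure X → Measure (Measure X)) (hT : Measurable T) :
    ProbabilityTheory.IsMarkovKernel (thK T hT) := by
  classical
  refine ⟨fun μ => ?_⟩
  change IsProbabilityMeasure (if T μ Set.univ = 1 then T μ else Measure.dirac 0)
  split_ifs with h
  · exact ⟨h⟩
  · infer_instance

lemma thK_apply (T : Measure X → Measure (Measure X)) (hT : Measurable T) (μ : Measure X)
    (h : IsProbabilityMeasure (T μ)) : thK T hT μ = T μ := by
  classical
  change (if T μ Set.univ = 1 then T μ else Measure.dirac 0) = T μ
  rw [if_pos h.measure_univ]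

/-- non-dependent cons -/
def consM {m : ℕ} (p : Measure X × (Fin (m + 1) → Measure X)) : Fin (m + 1 + 1) → Measure X :=
  Fin.cons p.1 p.2

lemma measurable_consM {m : ℕ} :
    Measurable (consM : Measure X × (Fin (m + 1) → Measure X) → Fin (m + 1 + 1) → Measure X) := by
  refine measurable_pi_iff.2 fun i => ?_
  refine Fin.cases ?_ (fun j => ?_) i
  · exact measurable_fst
  · exact (measurable_pi_apply j).comp measurable_snd

variable [BorelSpace X] [SecondCountableTopology X]

open ProbabilityTheory in
/-- The sequential splitting kernel. -/
def seqK {O : ℕ → Set X} (hO : IsCov O) (Th : ℝ → Measure X → Measure (Measure X))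
    (hThm : ∀ s, Measurable (Th s)) :
    (m : ℕ) → (Fin m → ℝ) → Kernel (Measure X) (Fin (m + 1) → Measure X)
  | 0, _ => Kernel.deterministic (fun μ _ => μ) (measurable_pi_iff.2 fun _ => measurable_id)
  | m + 1, s => ((thK (Th (s 0)) (hThm _)) ⊗ₖ
      ((seqK hO Th hThm m (fun i => s i.succ)).comap (msub O) (measurable_msub hO))).map consM

open ProbabilityTheory in
lemma seqK_markov {O : ℕ → Set X} (hO : IsCov O) (Th : ℝ → Measure X → Measure (Measure X))
    (hThm : ∀ s, Measurable (Th s)) (m : ℕ) (s : Fin m → ℝ) :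
    IsMarkovKernel (seqK hO Th hThm m s) := by
  induction m with
  | zero => unfold seqK; infer_instance
  | succ m ih =>
    have := ih (fun i => s i.succ)
    unfold seqK
    exact Kernel.IsMarkovKernel.map _ measurable_consM

open ProbabilityTheory in
lemma seqThinInt_eq {O : ℕ → Set X} (hO : IsCov O) (Th : ℝ → Measure X → Measure (Measure X))
    (hThm : ∀ s, Measurable (Th s))
    (hTh : ∀ s ∈ Set.Ioo (0 : ℝ) 1, ∀ μ, IsPointMeasure μ → IsThinning s μ (Th s μ))
    (m : ℕ) (s : Fin m → ℝ) (hs : ∀ i, s i ∈ Set.Ioo (0 : ℝ) 1) (μ : Measure X) (hμ : Good O μ)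
    (h : (Fin (m + 1) → Measure X) → ℝ≥0∞) (hh : Measurable h) :
    seqThinInt Th m s μ h = ∫⁻ κ, h κ ∂(seqK hO Th hThm m s μ) := by
  induction m generalizing μ with
  | zero =>
    unfold seqThinInt seqK
    rw [Kernel.lintegral_deterministic' _ hh]
  | succ m ih =>
    have := seqK_markov hO Th hThm m (fun i => s i.succ)
    have hT := hTh (s 0) (hs 0) μ (hμ.isPointMeasure hO)
    unfold seqThinInt seqK
    rw [Kernel.lintegral_map _ measurable_consM _ hh,
      Kernel.lintegral_compProd _ _ _ (f := fun a => h (consM a)) (hh.comp measurable_consM), thK_apply _ _ _ hT.1]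
    refine lintegral_congr_ae ?_
    filter_upwards [hT.2.1] with κ hκ
    have hκg : Good O κ := IsPointMeasure.good hO hκ.1
      fun n => ne_top_of_le_ne_top (hμ.ne_top n) (hκ.2 _)
    have hsub : msub O (μ, κ) = μ - κ := if_pos ⟨hμ, hκg, hκ.2⟩
    rw [Kernel.comap_apply, hsub]
    refine ih (fun i => s i.succ) (fun i => hs _) (μ - κ) (hμ.sub hO hκg hκ.2) _ ?_
    exact hh.comp (measurable_consM.comp measurable_prodMk_left)

/-- thinned test function -/
def thinF (s : ℝ) (f : X → ℝ) (x : X) : ℝ := -Real.log (1 - s + s * Real.exp (-f x))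

/-- mixed test function -/
def mixF {m : ℕ} (q : Fin (m + 1) → ℝ) (f : Fin (m + 1) → X → ℝ) (x : X) : ℝ :=
  -Real.log ((∑ i, q i * Real.exp (-f i x)) / ∑ i, q i)

lemma MemU.of_le {f g : X → ℝ} (hf : MemU f) (hg : Measurable g) (h0 : ∀ x, 0 ≤ g x)
    (hle : ∀ x, g x ≤ f x) : MemU g := by
  obtain ⟨-, h1, ⟨C, hC⟩, hb⟩ := hf
  refine ⟨hg, h0, ⟨C, fun x => (hle x).trans (hC x)⟩, hb.subset fun x hx => ?_⟩
  have : 0 < g x := lt_of_le_of_ne (h0 x) (Ne.symm hx)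
  exact (this.trans_le (hle x)).ne'

lemma exp_thinF {s : ℝ} (hs : s ∈ Set.Icc (0 : ℝ) 1) {f : X → ℝ} {x : X} (hf : 0 ≤ f x) :
    Real.exp (-thinF s f x) = 1 - s + s * Real.exp (-f x) := by
  unfold thinF
  rw [neg_neg, Real.exp_log]
  have h1 := Real.exp_pos (-f x)
  have h2 : Real.exp (-f x) ≤ 1 := Real.exp_le_one_iff.2 (by linarith)
  rcases hs.2.lt_or_eq with h | h
  · nlinarith [hs.1, mul_nonneg hs.1 h1.le]
  · subst h; linarith

lemma thinF_nonneg {s : ℝ} (hs : s ∈ Set.Icc (0 : ℝ) 1) {f : X → ℝ} {x : X} (hf : 0 ≤ f x) :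
    0 ≤ thinF s f x := by
  have h := exp_thinF hs hf
  have h2 : Real.exp (-f x) ≤ 1 := Real.exp_le_one_iff.2 (by linarith)
  have : Real.exp (-thinF s f x) ≤ 1 := by rw [h]; nlinarith [hs.1]
  have := Real.exp_le_one_iff.1 this
  linarith

lemma thinF_le {s : ℝ} (hs : s ∈ Set.Icc (0 : ℝ) 1) {f : X → ℝ} {x : X} (hf : 0 ≤ f x) :
    thinF s f x ≤ f x := by
  have h := exp_thinF hs hf
  have h2 : Real.exp (-f x) ≤ 1 := Real.exp_le_one_iff.2 (by linarith)
  have : Real.exp (-f x) ≤ Real.exp (-thinF s f x) := by rw [h]; nlinarith [hs.2]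
  have := Real.exp_le_exp.1 this
  linarith

lemma measurable_thinF {s : ℝ} {f : X → ℝ} (hf : Measurable f) : Measurable (thinF s f) := by
  unfold thinF; fun_prop

lemma MemU.thinF {s : ℝ} (hs : s ∈ Set.Icc (0 : ℝ) 1) {f : X → ℝ} (hf : MemU f) :
    MemU (thinF s f) :=
  hf.of_le (measurable_thinF hf.1) (fun x => thinF_nonneg hs (hf.2.1 x))
    (fun x => thinF_le hs (hf.2.1 x))

lemma laplace_bind {P : Measure (Measure X)} (hP : ∀ᵐ μ ∂P, IsPointMeasure μ)
    {T : Measure X → Measure (Measure X)} (hT : Measurable T) {s : ℝ}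
    (hTh : ∀ μ, IsPointMeasure μ → IsThinning s μ (T μ)) {f : X → ℝ} (hf : MemU f) :
    laplaceT (P.bind T) f = laplaceT P (thinF s f) := by
  unfold laplaceT
  rw [Measure.lintegral_bind (f := fun ν => expNeg (pairing f ν)) hT.aemeasurable
    (measurable_expNeg.comp (measurable_pairing hf.1)).aemeasurable]
  refine lintegral_congr_ae ?_
  filter_upwards [hP] with μ hμ
  exact (hTh μ hμ).2.2 f hf

lemma pairing_add_measure (f : X → ℝ) (μ ν : Measure X) :
    pairing f (μ + ν) = pairing f μ + pairing f ν := lintegral_add_measure _ _ _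

section mix
variable {m : ℕ} {q : Fin (m + 1) → ℝ} {f : Fin (m + 1) → X → ℝ}

lemma sum_pos' (hq : ∀ i, 0 < q i) : 0 < ∑ i, q i := Finset.sum_pos (fun i _ => hq i) Finset.univ_nonempty

lemma exp_mixF (hq : ∀ i, 0 < q i) (x : X) :
    Real.exp (-mixF q f x) = (∑ i, q i * Real.exp (-f i x)) / ∑ i, q i := by
  unfold mixF
  rw [neg_neg, Real.exp_log]
  exact div_pos (Finset.sum_pos (fun i _ => mul_pos (hq i) (Real.exp_pos _)) Finset.univ_nonempty)
    (sum_pos' hq)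

lemma mixF_nonneg (hq : ∀ i, 0 < q i) (hf : ∀ i, MemU (f i)) (x : X) : 0 ≤ mixF q f x := by
  have : Real.exp (-mixF q f x) ≤ 1 := by
    rw [exp_mixF hq, div_le_one (sum_pos' hq)]
    refine Finset.sum_le_sum fun i _ => mul_le_of_le_one_right (hq i).le ?_
    exact Real.exp_le_one_iff.2 (by linarith [(hf i).2.1 x])
  have := Real.exp_le_one_iff.1 this
  linarith

lemma mixF_le (hq : ∀ i, 0 < q i) {x : X} {c : ℝ} (hc : ∀ i, f i x ≤ c) : mixF q f x ≤ c := by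
  have : Real.exp (-c) ≤ Real.exp (-mixF q f x) := by
    rw [exp_mixF hq, le_div_iff₀ (sum_pos' hq), mul_comm, Finset.sum_mul]
    refine Finset.sum_le_sum fun i _ => mul_le_mul_of_nonneg_left ?_ (hq i).le
    exact Real.exp_le_exp.2 (by linarith [hc i])
  have := Real.exp_le_exp.1 this
  linarith
end mix

lemma measurable_mixF {m : ℕ} {q : Fin (m + 1) → ℝ} {f : Fin (m + 1) → X → ℝ}
    (hf : ∀ i, Measurable (f i)) : Measurable (mixF q f) := by
  unfold mixF; fun_prop

lemma splitProbs_zero {m : ℕ} (q : Fin (m + 1 + 1) → ℝ) :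
    splitProbs q 0 = q 0 / ∑ i, q i := by
  unfold splitProbs
  have : Finset.Ici (Fin.castSucc (0 : Fin (m + 1))) = Finset.univ := by
    ext i; simp
  rw [this]; rfl

lemma splitProbs_succ {m : ℕ} (q : Fin (m + 1 + 1) → ℝ) (j : Fin m) :
    splitProbs q j.succ = splitProbs (fun i => q i.succ) j := by
  unfold splitProbs
  have : Finset.Ici (Fin.castSucc (j.succ)) =
      (Finset.Ici (Fin.castSucc j)).map (Fin.succEmb (m + 1)) := by
    ext i
    simp only [Finset.mem_Ici, Finset.mem_map]
    constructor
    · intro h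
      refine Fin.cases (fun h => ?_) (fun i h => ?_) i h
      · simp [Fin.le_def] at h
      · exact ⟨i, by simpa [Fin.le_def] using h, rfl⟩
    · rintro ⟨i, h, rfl⟩
      simpa [Fin.le_def] using h
  rw [this, Finset.sum_map]
  rfl

lemma splitProbs_mem {m : ℕ} {q : Fin (m + 1) → ℝ} (hq : ∀ i, 0 < q i) (j : Fin m) :
    splitProbs q j ∈ Set.Ioo (0 : ℝ) 1 := by
  unfold splitProbs
  have h1 : q j.castSucc < ∑ i ∈ Finset.Ici j.castSucc, q i := by
    refine Finset.single_lt_sum (i := j.castSucc) (j := j.succ) (by simp [Fin.ext_iff]) (by simp)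
      ?_ (hq _) (fun k _ _ => (hq k).le)
    simp [Fin.le_def]
  have h0 := hq j.castSucc
  exact ⟨div_pos h0 (h0.trans h1), (div_lt_one (h0.trans h1)).2 h1⟩

lemma seqThin_laplace {O : ℕ → Set X} (hO : IsCov O) (Th : ℝ → Measure X → Measure (Measure X))
    (hTh : ∀ s ∈ Set.Ioo (0 : ℝ) 1, ∀ μ, IsPointMeasure μ → IsThinning s μ (Th s μ))
    (m : ℕ) (q : Fin (m + 1) → ℝ) (hq : ∀ i, 0 < q i) (f : Fin (m + 1) → X → ℝ)
    (hf : ∀ i, MemU (f i)) (hanti : ∀ x, Antitone fun i => f i x)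
    (μ : Measure X) (hμ : Good O μ) (c : ℝ≥0∞) (hc : c ≠ ∞) :
    seqThinInt Th m (splitProbs q) μ (fun κ => c * expNeg (∑ i, pairing (f i) (κ i))) =
      c * expNeg (pairing (mixF q f) μ) := by
  induction m generalizing μ c with
  | zero =>
    have : mixF q f = f 0 := by
      ext x
      unfold mixF
      have := hq 0
      simp [this.ne']
    unfold seqThinInt
    simp [this]
  | succ m ih =>
    set q' : Fin (m + 1) → ℝ := fun i => q i.succ with hq'
    set f' : Fin (m + 1) → X → ℝ := fun i => f i.succ with hf'
    set F := mixF q' f' with hF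
    have hs : splitProbs q 0 ∈ Set.Ioo (0 : ℝ) 1 := splitProbs_mem hq 0
    set s := splitProbs q 0 with hsdef
    have hq'0 : ∀ i, 0 < q' i := fun i => hq _
    have hF0 : ∀ x, 0 ≤ F x := mixF_nonneg hq'0 (fun i => hf _)
    have hFle : ∀ x, F x ≤ f 0 x := fun x => mixF_le hq'0 fun i => hanti x (Fin.zero_le _)
    have hFm : Measurable F := measurable_mixF fun i => (hf _).1
    have hg : MemU (fun x => f 0 x - F x) := (hf 0).of_le ((hf 0).1.sub hFm)
      (fun x => sub_nonneg.2 (hFle x)) (fun x => by linarith [hF0 x])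
    have hT := hTh s hs μ (hμ.isPointMeasure hO)
    unfold seqThinInt
    have h1 : ∀ᵐ κ ∂(Th s μ), seqThinInt Th m (fun i => splitProbs q i.succ) (μ - κ)
        (fun l => c * expNeg (∑ i, pairing (f i)
          ((Fin.cons κ l : Fin (m + 1 + 1) → Measure X) i))) =
        (c * expNeg (pairing F μ)) * expNeg (pairing (fun x => f 0 x - F x) κ) := by
      filter_upwards [hT.2.1] with κ hκ
      have hκg : Good O κ := IsPointMeasure.good hO hκ.1
        fun n => ne_top_of_le_ne_top (hμ.ne_top n) (hκ.2 _)
      have e1 : (fun i => splitProbs q i.succ) = splitProbs q' :=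
        funext fun j => splitProbs_succ q j
      have e2 : (fun l : Fin (m + 1) → Measure X => c * expNeg (∑ i, pairing (f i)
          ((Fin.cons κ l : Fin (m + 1 + 1) → Measure X) i))) =
          fun l => (c * expNeg (pairing (f 0) κ)) * expNeg (∑ i, pairing (f' i) (l i)) := by
        ext l
        rw [Fin.sum_univ_succ, expNeg_add, mul_assoc]
        rfl
      rw [e1, e2, ih q' hq'0 f' (fun i => hf _)
        (fun x i j hij => hanti x (Fin.succ_le_succ_iff.2 hij)) (μ - κ)
        (hμ.sub hO hκg hκ.2) _ (mul_ne_top hc (expNeg_ne_top _)), mul_assoc, mul_assoc,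
        ← expNeg_add, ← expNeg_add]
      congr 2
      have e3 : pairing (f 0) κ = pairing (fun x => f 0 x - F x) κ + pairing F κ := by
        unfold pairing
        rw [← lintegral_add_left hg.1.ennreal_ofReal]
        refine lintegral_congr fun x => ?_
        rw [← ENNReal.ofReal_add (sub_nonneg.2 (hFle x)) (hF0 x)]
        simp
      have e4 : pairing F μ = pairing F κ + pairing F (μ - κ) := by
        rw [← pairing_add_measure, add_sub_of_le hO hκ.2 (fun n => hκg.ne_top n)]
      rw [e3, e4]
      ring
    rw [lintegral_congr_ae h1, lintegral_const_mul' _ _ (mul_ne_top hc (expNeg_ne_top _))]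
    have h2 := hT.2.2 _ hg
    unfold laplaceT at h2
    rw [h2, mul_assoc, ← expNeg_add]
    congr 2
    unfold pairing
    rw [← lintegral_add_left hFm.ennreal_ofReal]
    refine lintegral_congr fun x => ?_
    have h3 : 0 ≤ thinF s (fun x => f 0 x - F x) x :=
      thinF_nonneg ⟨hs.1.le, hs.2.le⟩ (hg.2.1 x)
    have h4 : ENNReal.ofReal (F x) + ENNReal.ofReal (thinF s (fun x => f 0 x - F x) x) =
      ENNReal.ofReal (mixF q f x) := by
      rw [← ENNReal.ofReal_add (hF0 x) h3]
      congr 1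
      have : Real.exp (-(F x + thinF s (fun x => f 0 x - F x) x)) = Real.exp (-mixF q f x) := by
        rw [neg_add, Real.exp_add, exp_thinF (f := fun x => f 0 x - F x) ⟨hs.1.le, hs.2.le⟩ (hg.2.1 x), exp_mixF hq]
        have e5 : Real.exp (-(f 0 x - F x)) = Real.exp (-f 0 x) * Real.exp (F x) := by
          rw [← Real.exp_add]; ring_nf
        have e6 : Real.exp (-F x) * Real.exp (F x) = 1 := by
          rw [← Real.exp_add]; simp
        have e7 := exp_mixF hq'0 (f := f') x
        have hQ' := sum_pos' hq'0
        have hsum : ∑ i, q i = q 0 + ∑ i, q' i := Fin.sum_univ_succ _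
        have hsum2 : ∑ i, q i * Real.exp (-f i x) =
            q 0 * Real.exp (-f 0 x) + ∑ i, q' i * Real.exp (-f' i x) := Fin.sum_univ_succ _
        have hs' : s = q 0 / (q 0 + ∑ i, q' i) := by rw [hsdef, splitProbs_zero, hsum]
        rw [e5]
        have e8 : Real.exp (-F x) * (1 - s + s * (Real.exp (-f 0 x) * Real.exp (F x))) =
            (1 - s) * Real.exp (-F x) + s * Real.exp (-f 0 x) := by
          linear_combination s * Real.exp (-f 0 x) * e6
        rw [e8, e7, hsum, hsum2, hs']
        have := hq 0
        field_simp
        ring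
      have := Real.exp_injective this
      linarith
    exact h4

end PoissonSplitting

namespace PoissonSplitting

lemma rec_lemma {m : ℕ} (q : Fin (m + 1) → ℝ) (hq : ∀ i, q i ∈ Set.Ioo (0 : ℝ) 1)
    (p : ℝ → Prop) (hrec : ∀ t ∈ Set.Ioc (0 : ℝ) 1, (∀ i, p (q i * t)) → p t)
    {δ : ℝ} (hδ0 : 0 < δ) (hδ : ∀ t ∈ Set.Ioc (0 : ℝ) 1, t ≤ δ → p t) : p 1 := by
  obtain ⟨j, -, hj⟩ := Finset.exists_max_image Finset.univ q Finset.univ_nonempty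
  have claim : ∀ k : ℕ, ∀ t ∈ Set.Ioc (0 : ℝ) 1, q j ^ k * t ≤ δ → p t := by
    intro k
    induction k with
    | zero => intro t ht h; exact hδ t ht (by simpa using h)
    | succ k ih =>
      intro t ht h
      refine hrec t ht fun i => ih _ ⟨mul_pos (hq i).1 ht.1, ?_⟩ ?_
      · nlinarith [(hq i).1, (hq i).2, ht.1, ht.2]
      · refine le_trans ?_ h
        rw [pow_succ, mul_assoc]
        have := (hq j).1
        have := hj i (Finset.mem_univ _)
        have := ht.1.le
        gcongr
  obtain ⟨k, hk⟩ := exists_pow_lt_of_lt_one hδ0 (hq j).2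
  exact claim k 1 ⟨one_pos, le_rfl⟩ (by simpa using hk.le)

lemma exp_neg_le_quad {x : ℝ} (hx : 0 ≤ x) : Real.exp (-x) ≤ 1 - x + x ^ 2 := by
  rw [Real.exp_neg]
  refine inv_le_of_inv_le₀ (by nlinarith [sq_nonneg (x - 1)]) ?_
  refine le_trans ?_ (Real.add_one_le_exp x)
  rw [inv_le_iff_one_le_mul₀ (by nlinarith [sq_nonneg (x - 1)])]
  nlinarith [pow_nonneg hx 3]

lemma one_le_expNeg_add (y : ℝ≥0∞) : 1 ≤ expNeg y + y := by
  by_cases h : y = ∞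
  · simp [h]
  · rw [expNeg_of_ne_top h]
    conv_rhs => rw [← ENNReal.ofReal_toReal h]
    rw [ENNReal.toReal_ofReal ENNReal.toReal_nonneg]
    rw [← ENNReal.ofReal_add (Real.exp_pos _).le ENNReal.toReal_nonneg, ENNReal.one_le_ofReal]
    linarith [Real.add_one_le_exp (-y.toReal)]

lemma small_upper {Ω : Type*} [MeasurableSpace Ω] (P : Measure Ω) [IsProbabilityMeasure P]
    (N : Ω → ℝ≥0∞) (hN : Measurable N) {c : ℝ} (hc0 : 0 ≤ c)
    (hc : ENNReal.ofReal c < ∫⁻ ω, N ω ∂P) :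
    ∃ δ : ℝ, 0 < δ ∧ ∀ t ∈ Set.Ioc (0 : ℝ) 1, t ≤ δ →
      ∫⁻ ω, expNeg (ENNReal.ofReal t * N ω) ∂P ≤ ENNReal.ofReal (Real.exp (-(c * t))) := by
  have hsup : ∫⁻ ω, N ω ∂P = ⨆ n : ℕ, ∫⁻ ω, N ω ⊓ (n : ℝ≥0∞) ∂P := by
    rw [← lintegral_iSup (f := fun (n : ℕ) ω => N ω ⊓ (n : ℝ≥0∞)) (fun n => hN.inf measurable_const)]
    · refine lintegral_congr fun ω => ?_
      rw [← inf_iSup_eq, ENNReal.iSup_natCast]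
      simp
    · intro a b hab ω
      exact inf_le_inf_left _ (by exact_mod_cast hab)
  rw [hsup, lt_iSup_iff] at hc
  obtain ⟨M, hM⟩ := hc
  set Y : Ω → ℝ := fun ω => (N ω ⊓ (M : ℝ≥0∞)).toReal with hY
  have hne : ∀ ω, N ω ⊓ (M : ℝ≥0∞) ≠ ∞ := fun ω =>
    ne_top_of_le_ne_top (ENNReal.natCast_ne_top M) inf_le_right
  have hYm : Measurable Y := (hN.inf measurable_const).ennreal_toReal
  have hY0 : ∀ ω, 0 ≤ Y ω := fun ω => ENNReal.toReal_nonneg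
  have hYM : ∀ ω, Y ω ≤ M := fun ω => by
    have := ENNReal.toReal_mono (ENNReal.natCast_ne_top M) (inf_le_right : N ω ⊓ (M : ℝ≥0∞) ≤ M)
    simpa using this
  have hYi : Integrable Y P := Integrable.of_bound hYm.aestronglyMeasurable (M : ℝ)
    (Filter.Eventually.of_forall fun ω => by
      rw [Real.norm_eq_abs, abs_of_nonneg (hY0 ω)]; exact hYM ω)
  have hEY : ∫⁻ ω, N ω ⊓ (M : ℝ≥0∞) ∂P = ENNReal.ofReal (∫ ω, Y ω ∂P) := by
    rw [ofReal_integral_eq_lintegral_ofReal hYi (Filter.Eventually.of_forall hY0)]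
    exact lintegral_congr fun ω => (ENNReal.ofReal_toReal (hne ω)).symm
  rw [hEY] at hM
  have hlt : c < ∫ ω, Y ω ∂P := (ENNReal.ofReal_lt_ofReal_iff_of_nonneg hc0).1 hM
  refine ⟨(∫ ω, Y ω ∂P - c) / ((M : ℝ) ^ 2 + 1), div_pos (sub_pos.2 hlt) (by positivity), ?_⟩
  intro t ht htδ
  rw [le_div_iff₀ (by positivity)] at htδ
  calc ∫⁻ ω, expNeg (ENNReal.ofReal t * N ω) ∂P
      ≤ ∫⁻ ω, ENNReal.ofReal (1 - t * Y ω + t ^ 2 * (M : ℝ) ^ 2) ∂P := by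
        refine lintegral_mono fun ω => ?_
        refine (expNeg_anti (mul_le_mul_right (inf_le_left : N ω ⊓ (M : ℝ≥0∞) ≤ N ω)
          (ENNReal.ofReal t))).trans ?_
        rw [expNeg_of_ne_top (mul_ne_top ofReal_ne_top (hne ω)), ENNReal.toReal_mul,
          ENNReal.toReal_ofReal ht.1.le]
        refine ENNReal.ofReal_le_ofReal ((exp_neg_le_quad (mul_nonneg ht.1.le (hY0 ω))).trans ?_)
        rw [mul_pow]
        have := hYM ω
        have := hY0 ω
        have h : Y ω ^ 2 ≤ (M : ℝ) ^ 2 := by gcongr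
        have := mul_le_mul_of_nonneg_left h (sq_nonneg t)
        change 1 - t * Y ω + t ^ 2 * Y ω ^ 2 ≤ _
        linarith
    _ = ENNReal.ofReal (∫ ω, (1 - t * Y ω + t ^ 2 * (M : ℝ) ^ 2) ∂P) := by
        rw [ofReal_integral_eq_lintegral_ofReal]
        · exact ((integrable_const _).sub (hYi.const_mul t)).add (integrable_const _)
        · refine Filter.Eventually.of_forall fun ω => ?_
          have h1 : 0 ≤ t * Y ω := mul_nonneg ht.1.le (hY0 ω)
          have h2 : t * Y ω ≤ t * M := mul_le_mul_of_nonneg_left (hYM ω) ht.1.le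
          simp only [Pi.zero_apply]
          nlinarith [sq_nonneg (t * M - 1), mul_nonneg ht.1.le (Nat.cast_nonneg (α := ℝ) M)]
    _ = ENNReal.ofReal (1 - t * ∫ ω, Y ω ∂P + t ^ 2 * (M : ℝ) ^ 2) := by
        have hi : Integrable (fun ω => 1 - t * Y ω) P :=
          (integrable_const _).sub (hYi.const_mul t)
        rw [integral_add hi (integrable_const _), integral_sub (integrable_const _) (hYi.const_mul t), integral_const_mul]
        simp
    _ ≤ _ := by
        refine ENNReal.ofReal_le_ofReal ?_
        refine le_trans ?_ (Real.add_one_le_exp _)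
        nlinarith [ht.1, mul_le_mul_of_nonneg_left htδ ht.1.le, sq_nonneg t]

lemma small_lower {Ω : Type*} [MeasurableSpace Ω] (P : Measure Ω) [IsProbabilityMeasure P]
    (N : Ω → ℝ≥0∞) (hN : Measurable N) (hfin : ∫⁻ ω, N ω ∂P ≠ ∞) {c : ℝ}
    (hc : (∫⁻ ω, N ω ∂P).toReal < c) :
    ∃ δ : ℝ, 0 < δ ∧ ∀ t ∈ Set.Ioc (0 : ℝ) 1, t ≤ δ → t < 1 ∧
      ENNReal.ofReal (Real.exp (-(c * t))) ≤
        ∫⁻ ω, expNeg (ENNReal.ofReal (t / (1 - t)) * N ω) ∂P := by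
  set A := (∫⁻ ω, N ω ∂P).toReal with hA
  have hA0 : 0 ≤ A := ENNReal.toReal_nonneg
  have hpos : 0 < 2 * A + c ^ 2 + 1 := by positivity
  refine ⟨min (1 / 2) ((c - A) / (2 * A + c ^ 2 + 1)),
    lt_min (by norm_num) (div_pos (sub_pos.2 hc) hpos), ?_⟩
  intro t ht htδ
  have h1 := htδ.trans (min_le_left _ _)
  have h2 := htδ.trans (min_le_right _ _)
  rw [le_div_iff₀ hpos] at h2
  refine ⟨by linarith, ?_⟩
  have ht0 : 0 < t := ht.1
  have hs0 : 0 ≤ t / (1 - t) := div_nonneg ht.1.le (by linarith)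
  have key : (1 : ℝ≥0∞) ≤ ∫⁻ ω, expNeg (ENNReal.ofReal (t / (1 - t)) * N ω) ∂P
      + ENNReal.ofReal (t / (1 - t) * A) := by
    rw [ENNReal.ofReal_mul hs0, hA, ENNReal.ofReal_toReal hfin,
      ← lintegral_const_mul _ hN, ← lintegral_add_right _ (hN.const_mul _)]
    calc (1 : ℝ≥0∞) = ∫⁻ _, 1 ∂P := by simp
      _ ≤ _ := lintegral_mono fun ω => one_le_expNeg_add _
  have h3 : ENNReal.ofReal (Real.exp (-(c * t))) + ENNReal.ofReal (t / (1 - t) * A) ≤ 1 := by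
    rw [← ENNReal.ofReal_add (Real.exp_pos _).le (mul_nonneg hs0 hA0), ENNReal.ofReal_le_one]
    have e1 := exp_neg_le_quad (x := c * t) (mul_nonneg (hA0.trans hc.le) ht.1.le)
    have e2 : t / (1 - t) ≤ t * (1 + 2 * t) := by
      rw [div_le_iff₀ (by linarith)]
      nlinarith [mul_nonneg (sq_nonneg t) (sub_nonneg.2 h1)]
    have e3 := mul_le_mul_of_nonneg_right e2 hA0
    nlinarith [mul_le_mul_of_nonneg_left h2 ht0.le, sq_nonneg t]
  exact (ENNReal.add_le_add_iff_right ENNReal.ofReal_ne_top).1 (h3.trans key)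

lemma key_limit {Ω : Type*} [MeasurableSpace Ω] (P : Measure Ω) [IsProbabilityMeasure P]
    (N : Ω → ℝ≥0∞) (hN : Measurable N) {m : ℕ} (q : Fin (m + 1) → ℝ)
    (hq : ∀ i, q i ∈ Set.Ioo (0 : ℝ) 1) (hsum : ∑ i, q i = 1) (g : ℝ → ℝ≥0∞)
    (hg : ∀ t ∈ Set.Ioc (0 : ℝ) 1, g t = ∏ i, g (q i * t))
    (hup : ∀ t ∈ Set.Ioc (0 : ℝ) 1, g t ≤ ∫⁻ ω, expNeg (ENNReal.ofReal t * N ω) ∂P)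
    (hlo : ∀ t ∈ Set.Ioc (0 : ℝ) 1, t < 1 →
      ∫⁻ ω, expNeg (ENNReal.ofReal (t / (1 - t)) * N ω) ∂P ≤ g t) :
    g 1 = expNeg (∫⁻ ω, N ω ∂P) := by
  have hprod : ∀ c t : ℝ, ∏ i, ENNReal.ofReal (Real.exp (-(c * (q i * t)))) =
      ENNReal.ofReal (Real.exp (-(c * t))) := by
    intro c t
    rw [← ENNReal.ofReal_prod_of_nonneg (fun i _ => (Real.exp_pos _).le), ← Real.exp_sum]
    congr 2
    rw [Finset.sum_neg_distrib, ← Finset.mul_sum, ← Finset.sum_mul, hsum, one_mul]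
  have up : ∀ c : ℝ, 0 ≤ c → ENNReal.ofReal c < ∫⁻ ω, N ω ∂P →
      g 1 ≤ ENNReal.ofReal (Real.exp (-c)) := by
    intro c hc0 hc
    obtain ⟨δ, hδ0, hδ⟩ := small_upper P N hN hc0 hc
    have := rec_lemma q hq (fun t => g t ≤ ENNReal.ofReal (Real.exp (-(c * t))))
      (fun t ht h => by
        change g t ≤ _
        rw [hg t ht, ← hprod c t]
        exact Finset.prod_le_prod' fun i _ => h i) hδ0
      (fun t ht htd => (hup t ht).trans (hδ t ht htd))
    simpa using this
  by_cases hfin : ∫⁻ ω, N ω ∂P = ∞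
  · rw [hfin, expNeg_top]
    have h1 : Filter.Tendsto (fun c : ℝ => ENNReal.ofReal (Real.exp (-c))) Filter.atTop
        (nhds (ENNReal.ofReal 0)) :=
      ENNReal.tendsto_ofReal Real.tendsto_exp_neg_atTop_nhds_zero
    rw [ENNReal.ofReal_zero] at h1
    refine le_antisymm (ge_of_tendsto h1 ?_) zero_le
    filter_upwards [Filter.eventually_ge_atTop 0] with c hc
    exact up c hc (by rw [hfin]; exact ENNReal.ofReal_lt_top)
  · have lo : ∀ c : ℝ, (∫⁻ ω, N ω ∂P).toReal < c → ENNReal.ofReal (Real.exp (-c)) ≤ g 1 := by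
      intro c hc
      obtain ⟨δ, hδ0, hδ⟩ := small_lower P N hN hfin hc
      have := rec_lemma q hq (fun t => ENNReal.ofReal (Real.exp (-(c * t))) ≤ g t)
        (fun t ht h => by
          change _ ≤ g t
          rw [hg t ht, ← hprod c t]
          exact Finset.prod_le_prod' fun i _ => h i) hδ0
        (fun t ht htd => (hδ t ht htd).2.trans (hlo t ht (hδ t ht htd).1))
      simpa using this
    rw [expNeg_of_ne_top hfin]
    have hcont : Continuous fun c : ℝ => ENNReal.ofReal (Real.exp (-c)) :=
      ENNReal.continuous_ofReal.comp (by fun_prop)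
    refine le_antisymm ?_ ?_
    · refine ge_of_tendsto ((hcont.tendsto _).mono_left
        (nhdsWithin_le_nhds (s := Set.Iio (∫⁻ ω, N ω ∂P).toReal))) ?_
      filter_upwards [self_mem_nhdsWithin] with c hc
      rcases le_or_gt 0 c with h0 | h0
      · refine up c h0 ?_
        rw [ENNReal.ofReal_lt_iff_lt_toReal h0 hfin]
        exact hc
      · refine (hup 1 ⟨one_pos, le_rfl⟩).trans ?_
        calc _ ≤ ∫⁻ _, 1 ∂P := lintegral_mono fun _ => expNeg_le_one _
          _ = 1 := by simp
          _ ≤ _ := by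
            rw [ENNReal.one_le_ofReal]
            exact Real.one_le_exp (by linarith)
    · refine le_of_tendsto ((hcont.tendsto _).mono_left
        (nhdsWithin_le_nhds (s := Set.Ioi (∫⁻ ω, N ω ∂P).toReal))) ?_
      filter_upwards [self_mem_nhdsWithin] with c hc
      exact lo c hc

end PoissonSplitting

namespace PoissonSplitting
variable {X : Type*} [MeasurableSpace X] [MetricSpace X]
variable [BorelSpace X] [SecondCountableTopology X]

lemma exists_cover {P : Measure (Measure X)} (hP : ∀ᵐ μ ∂P, IsPointMeasure μ)
    (hP1 : IsFirstOrder P) : ∃ O : ℕ → Set X, IsCov O ∧ ∀ᵐ μ ∂P, Good O μ := by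
  have : IsLocallyFiniteMeasure (momentMeasure P) := hP1
  let S := (momentMeasure P).finiteSpanningSetsInOpen'
  have hO : IsCov S.set := ⟨S.set_mem, S.spanning⟩
  refine ⟨S.set, hO, ?_⟩
  have h1 : ∀ n, ∀ᵐ μ ∂P, μ (S.set n) ≠ ∞ := by
    intro n
    have hn := S.finite n
    have hm : MeasurableSet (S.set n) := (hO.1 n).measurableSet
    unfold momentMeasure at hn
    rw [Measure.bind_apply hm aemeasurable_id] at hn
    have := ae_lt_top (Measure.measurable_coe hm) hn.ne
    filter_upwards [this] with μ hμ using hμ.ne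
  filter_upwards [hP, ae_all_iff.2 h1] with μ h2 h3
  exact h2.good hO h3

/-- `u = 1 - e^{-f}` -/
lemma thinF_lower {t : ℝ} (ht : t ∈ Set.Icc (0 : ℝ) 1) {f : X → ℝ} {x : X} (hf : 0 ≤ f x) :
    t * (1 - Real.exp (-f x)) ≤ thinF t f x := by
  have h := exp_thinF ht hf
  have h2 := Real.add_one_le_exp (-(t * (1 - Real.exp (-f x))))
  have : Real.exp (-thinF t f x) ≤ Real.exp (-(t * (1 - Real.exp (-f x)))) := by
    rw [h]; linarith
  have := Real.exp_le_exp.1 this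
  linarith

lemma thinF_upper {t : ℝ} (ht : t ∈ Set.Icc (0 : ℝ) 1) (ht1 : t < 1) {f : X → ℝ} {x : X}
    (hf : 0 ≤ f x) : thinF t f x ≤ t / (1 - t) * (1 - Real.exp (-f x)) := by
  have h := exp_thinF ht hf
  have hu0 : 0 ≤ 1 - Real.exp (-f x) := by
    have := Real.exp_le_one_iff.2 (show -f x ≤ 0 by linarith)
    linarith
  have hu1 : 1 - Real.exp (-f x) ≤ 1 := by linarith [Real.exp_pos (-f x)]
  set u := 1 - Real.exp (-f x) with hu
  have ht0 := ht.1
  have h1t : 0 < 1 - t := by linarith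
  have hy0 : 0 ≤ t / (1 - t) * u := mul_nonneg (div_nonneg ht0 h1t.le) hu0
  have : Real.exp (-(t / (1 - t) * u)) ≤ Real.exp (-thinF t f x) := by
    rw [h, Real.exp_neg]
    have e0 : 1 - t + t * Real.exp (-f x) = 1 - t * u := by rw [hu]; ring
    have hpos : 0 < 1 - t * u := by nlinarith
    rw [e0]
    refine inv_le_of_inv_le₀ hpos (le_trans ?_ (Real.add_one_le_exp _))
    rw [inv_le_iff_one_le_mul₀ hpos]
    have e1 : t / (1 - t) * u + 1 = (1 - t + t * u) / (1 - t) := by field_simp; ring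
    rw [e1, div_mul_eq_mul_div, le_div_iff₀ h1t]
    nlinarith [mul_nonneg (mul_nonneg (sq_nonneg t) hu0) (sub_nonneg.2 hu1)]
  have := Real.exp_le_exp.1 this
  linarith

lemma thinF_thinF {s t : ℝ} (hs : s ∈ Set.Icc (0 : ℝ) 1) (ht : t ∈ Set.Icc (0 : ℝ) 1) {f : X → ℝ}
    (hf : ∀ x, 0 ≤ f x) : thinF s (thinF t f) = thinF (s * t) f := by
  ext x
  have := exp_thinF ht (hf x)
  change -Real.log (1 - s + s * Real.exp (-thinF t f x)) = _
  rw [this]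
  unfold thinF
  congr 2
  ring

lemma thinF_one (f : X → ℝ) : thinF 1 f = f := by
  ext x; simp [thinF]

lemma pairing_const_mul {c : ℝ} (hc : 0 ≤ c) {f : X → ℝ} (hf : Measurable f) (μ : Measure X) :
    pairing (fun x => c * f x) μ = ENNReal.ofReal c * pairing f μ := by
  unfold pairing
  rw [← lintegral_const_mul _ hf.ennreal_ofReal]
  exact lintegral_congr fun x => ENNReal.ofReal_mul hc

lemma pairing_mono {f g : X → ℝ} (h : ∀ x, f x ≤ g x) (μ : Measure X) :
    pairing f μ ≤ pairing g μ :=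
  lintegral_mono fun x => ENNReal.ofReal_le_ofReal (h x)

lemma mixF_const {m : ℕ} {q : Fin (m + 1) → ℝ} (hsum : ∑ i, q i = 1) (F : X → ℝ) :
    mixF q (fun _ => F) = F := by
  ext x
  unfold mixF
  rw [← Finset.sum_mul, hsum]
  simp

lemma bind_prob {P : Measure (Measure X)} [IsProbabilityMeasure P]
    (hP : ∀ᵐ μ ∂P, IsPointMeasure μ)
    {T : Measure X → Measure (Measure X)} (hT : Measurable T) {s : ℝ}
    (hTh : ∀ μ, IsPointMeasure μ → IsThinning s μ (T μ)) :
    IsProbabilityMeasure (P.bind T) := by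
  constructor
  rw [Measure.bind_apply MeasurableSet.univ hT.aemeasurable]
  rw [lintegral_congr_ae (g := fun _ => 1)]
  · simp
  · filter_upwards [hP] with μ hμ
    exact (hTh μ hμ).1.measure_univ

lemma lintegral_pi_expNeg {m : ℕ} (R : Fin (m + 1) → Measure (Measure X))
    [∀ i, IsProbabilityMeasure (R i)] (f : Fin (m + 1) → X → ℝ) (hf : ∀ i, MemU (f i)) :
    ∫⁻ κ, expNeg (∑ i, pairing (f i) (κ i)) ∂(Measure.pi R) = ∏ i, laplaceT (R i) (f i) := by
  simp_rw [expNeg_sum]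
  unfold laplaceT
  have hm : ∀ i, Measurable fun ν => expNeg (pairing (f i) ν) :=
    fun i => measurable_expNeg.comp (measurable_pairing (hf i).1)
  rw [ProbabilityTheory.lintegral_prod_eq_prod_lintegral_of_indepFun Finset.univ
    (fun i (κ : Fin (m + 1) → Measure X) => expNeg (pairing (f i) (κ i)))
    (ProbabilityTheory.iIndepFun_pi fun i => (hm i).aemeasurable)
    (fun i => (hm i).comp (measurable_pi_apply i))]
  refine Finset.prod_congr rfl fun i _ => ?_
  exact (measurePreserving_eval R i).lintegral_comp (hm i)

lemma poisson_of_factor (P : Measure (Measure X)) (hP : IsPointProcess P)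
    (hP1 : IsFirstOrder P)
    (m : ℕ) (q : Fin (m + 1) → ℝ)
    (hq : ∀ i, q i ∈ Set.Ioo (0 : ℝ) 1) (hsum : ∑ i, q i = 1)
    (Th : ℝ → Measure X → Measure (Measure X)) (hThm : ∀ s, Measurable (Th s))
    (hTh : ∀ s ∈ Set.Ioo (0 : ℝ) 1, ∀ μ, IsPointMeasure μ → IsThinning s μ (Th s μ))
    (H : ∀ h : (Fin (m + 1) → Measure X) → ℝ≥0∞, Measurable h →
            ∫⁻ μ, seqThinInt Th m (splitProbs q) μ h ∂P
              = ∫⁻ κ, h κ ∂(Measure.pi fun i => P.bind (Th (q i)))) :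
    IsPoissonPP (momentMeasure P) P := by
  obtain ⟨O, hO, hgood⟩ := exists_cover hP.2 hP1
  have := hP.1
  have hpr : ∀ i, IsProbabilityMeasure (P.bind (Th (q i))) := fun i =>
    bind_prob hP.2 (hThm _) (hTh _ (hq i))
  refine ⟨hP.1, hP.2, fun f hf => ?_⟩
  set u : X → ℝ := fun x => 1 - Real.exp (-f x) with hu
  have hum : Measurable u := by have := hf.1; fun_prop
  have ha : ∫⁻ x, ENNReal.ofReal (1 - Real.exp (-f x)) ∂(momentMeasure P) =
      ∫⁻ μ, pairing u μ ∂P := by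
    unfold momentMeasure
    rw [Measure.lintegral_bind aemeasurable_id hum.ennreal_ofReal.aemeasurable]
    rfl
  rw [ha]
  have := key_limit P (pairing u) (measurable_pairing hum) q hq hsum
    (fun t => laplaceT P (thinF t f)) ?_ ?_ ?_
  · simpa [thinF_one] using this
  · intro t ht
    have htc : t ∈ Set.Icc (0 : ℝ) 1 := ⟨ht.1.le, ht.2⟩
    set F := thinF t f with hF
    have hFU : MemU F := hf.thinF htc
    have h1 := H (fun κ => expNeg (∑ i, pairing F (κ i)))
      (measurable_expNeg.comp (Finset.measurable_sum _ fun i _ =>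
        (measurable_pairing hFU.1).comp (measurable_pi_apply i)))
    rw [lintegral_pi_expNeg (fun i => P.bind (Th (q i))) (fun _ => F) (fun _ => hFU)] at h1
    rw [lintegral_congr_ae (g := fun μ => expNeg (pairing F μ))] at h1
    · change laplaceT P F = _ at h1
      rw [h1]
      refine Finset.prod_congr rfl fun i _ => ?_
      rw [laplace_bind hP.2 (hThm _) (hTh _ (hq i)) hFU, hF,
        thinF_thinF ⟨(hq i).1.le, (hq i).2.le⟩ htc hf.2.1]
    · filter_upwards [hgood] with μ hμ
      have h2 := seqThin_laplace hO Th hTh m q (fun i => (hq i).1) (fun _ => F) (fun _ => hFU)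
        (fun x => antitone_const) μ hμ 1 one_ne_top
      simpa [mixF_const hsum] using h2
  · intro t ht
    refine lintegral_mono fun μ => expNeg_anti ?_
    rw [← pairing_const_mul ht.1.le hum]
    exact pairing_mono (fun x => thinF_lower ⟨ht.1.le, ht.2⟩ (hf.2.1 x)) μ
  · intro t ht ht1
    refine lintegral_mono fun μ => expNeg_anti ?_
    rw [← pairing_const_mul (div_nonneg ht.1.le (by linarith)) hum]
    exact pairing_mono (fun x => thinF_upper ⟨ht.1.le, ht.2⟩ ht1 (hf.2.1 x)) μ

end PoissonSplitting

namespace PoissonSplitting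
variable {X : Type*} [MeasurableSpace X] [MetricSpace X]
variable [BorelSpace X] [SecondCountableTopology X]

/-- partial sums -/
def psum {m : ℕ} (κ : Fin (m + 1) → Measure X) (j : Fin (m + 1)) : Measure X :=
  ∑ i ∈ Finset.Iic j, κ i

lemma measurable_psum {m : ℕ} :
    Measurable (psum : (Fin (m + 1) → Measure X) → Fin (m + 1) → Measure X) := by
  refine measurable_pi_iff.2 fun j => Measure.measurable_of_measurable_coe _ fun s hs => ?_
  simp only [psum, Measure.finsetSum_apply]
  exact Finset.measurable_sum _ fun i _ =>
    (Measure.measurable_coe hs).comp (measurable_pi_apply i)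

lemma psum_zero {m : ℕ} (κ : Fin (m + 1) → Measure X) : psum κ 0 = κ 0 := by
  unfold psum
  have : Finset.Iic (0 : Fin (m + 1)) = {0} := by ext i; simp
  rw [this, Finset.sum_singleton]

lemma psum_succ {m : ℕ} (κ : Fin (m + 1) → Measure X) (i : Fin m) :
    psum κ i.succ = psum κ i.castSucc + κ i.succ := by
  unfold psum
  have : Finset.Iic i.succ = insert i.succ (Finset.Iic i.castSucc) := by
    ext j
    simp only [Finset.mem_Iic, Finset.mem_insert, Fin.le_def, Fin.ext_iff, Fin.val_succ,
      Fin.val_castSucc]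
    omega
  rw [this, Finset.sum_insert, add_comm]
  simp [Fin.le_def]

lemma good_psum {O : ℕ → Set X} {m : ℕ} {κ : Fin (m + 1) → Measure X}
    (h : ∀ i, Good O (κ i)) (j : Fin (m + 1)) : Good O (psum κ j) := by
  induction j using Fin.induction with
  | zero => rw [psum_zero]; exact h 0
  | succ i ih => rw [psum_succ]; exact ih.add (h _)

/-- differences of partial sums -/
def recov (O : ℕ → Set X) {m : ℕ} (σ : Fin (m + 1) → Measure X) (j : Fin (m + 1)) : Measure X :=
  Fin.cases (motive := fun _ => Measure X) (σ 0) (fun i => msub O (σ i.succ, σ i.castSucc)) j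

lemma measurable_recov {O : ℕ → Set X} (hO : IsCov O) {m : ℕ} :
    Measurable (recov O : (Fin (m + 1) → Measure X) → Fin (m + 1) → Measure X) := by
  refine measurable_pi_iff.2 fun j => ?_
  refine Fin.cases ?_ (fun i => ?_) j
  · exact measurable_pi_apply 0
  · exact (measurable_msub hO).comp
      ((measurable_pi_apply i.succ).prodMk (measurable_pi_apply i.castSucc))

lemma recov_psum {O : ℕ → Set X} (hO : IsCov O) {m : ℕ} {κ : Fin (m + 1) → Measure X}
    (h : ∀ i, Good O (κ i)) : recov O (psum κ) = κ := by
  ext1 j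
  refine Fin.cases ?_ (fun i => ?_) j
  · exact psum_zero κ
  · change msub O (psum κ i.succ, psum κ i.castSucc) = _
    have hle : psum κ i.castSucc ≤ psum κ i.succ := by
      rw [psum_succ]; exact Measure.le_add_right le_rfl
    have : msub O (psum κ i.succ, psum κ i.castSucc) = psum κ i.succ - psum κ i.castSucc :=
      if_pos ⟨good_psum h _, good_psum h _, hle⟩
    rw [this, psum_succ]
    exact add_sub_cancel' hO fun n => (good_psum h _).ne_top n

lemma measurableSet_allGood {O : ℕ → Set X} (hO : IsCov O) (m : ℕ) :
    MeasurableSet {κ : Fin (m + 1) → Measure X | ∀ i, Good O (κ i)} := by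
  rw [Set.ofPred_forall]
  exact MeasurableSet.iInter fun i =>
    measurableSet_preimage (f := fun κ : Fin (m + 1) → Measure X => κ i)
      (t := {μ : Measure X | Good O μ}) (measurable_pi_apply i) (measurableSet_good hO)

open ProbabilityTheory in
lemma seqK_good {O : ℕ → Set X} (hO : IsCov O) (Th : ℝ → Measure X → Measure (Measure X))
    (hThm : ∀ s, Measurable (Th s))
    (hTh : ∀ s ∈ Set.Ioo (0 : ℝ) 1, ∀ μ, IsPointMeasure μ → IsThinning s μ (Th s μ))
    (m : ℕ) (s : Fin m → ℝ) (hs : ∀ i, s i ∈ Set.Ioo (0 : ℝ) 1) (μ : Measure X) (hμ : Good O μ) :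
    ∀ᵐ κ ∂(seqK hO Th hThm m s μ), ∀ i, Good O (κ i) := by
  induction m generalizing μ with
  | zero =>
    unfold seqK
    rw [Kernel.deterministic_apply]
    rw [ae_dirac_iff (measurableSet_allGood hO 0)]
    exact fun _ => hμ
  | succ m ih =>
    have := seqK_markov hO Th hThm m (fun i => s i.succ)
    have hT := hTh (s 0) (hs 0) μ (hμ.isPointMeasure hO)
    unfold seqK
    rw [Kernel.map_apply _ measurable_consM,
      ae_map_iff measurable_consM.aemeasurable (measurableSet_allGood hO (m + 1))]
    have hset : MeasurableSet {x : Measure X × (Fin (m + 1) → Measure X) |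
        ∀ i, Good O (consM x i)} :=
      measurableSet_preimage measurable_consM (measurableSet_allGood hO (m + 1))
    rw [Kernel.ae_compProd_iff hset,
      thK_apply _ _ _ hT.1]
    filter_upwards [hT.2.1] with κ hκ
    have hκg : Good O κ := IsPointMeasure.good hO hκ.1
      fun n => ne_top_of_le_ne_top (hμ.ne_top n) (hκ.2 _)
    have hsub : msub O (μ, κ) = μ - κ := if_pos ⟨hμ, hκg, hκ.2⟩
    rw [Kernel.comap_apply, hsub]
    filter_upwards [ih (fun i => s i.succ) (fun i => hs _) (μ - κ) (hμ.sub hO hκg hκ.2)] with l hl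
    intro i
    refine Fin.cases ?_ (fun j => ?_) i
    · exact hκg
    · exact hl j

lemma ae_bind_of {α β : Type*} [MeasurableSpace α] [MeasurableSpace β] {P : Measure α}
    {T : α → Measure β} (hT : Measurable T) {p : β → Prop} (hp : MeasurableSet {b | p b})
    (h : ∀ᵐ a ∂P, ∀ᵐ b ∂(T a), p b) : ∀ᵐ b ∂(P.bind T), p b := by
  change (P.bind T) {b | p b}ᶜ = 0
  rw [Measure.bind_apply hp.compl hT.aemeasurable, lintegral_eq_zero_iff
    (f := fun a => T a {b | p b}ᶜ) ((Measure.measurable_coe hp.compl).comp hT)]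
  filter_upwards [h] with a ha using ha

lemma pairing_sum_measure {ι : Type*} (s : Finset ι) (f : X → ℝ) (κ : ι → Measure X) :
    pairing f (∑ i ∈ s, κ i) = ∑ i ∈ s, pairing f (κ i) := lintegral_finsetSum_measure _ _ _

lemma pairing_sum_fun {ι : Type*} (s : Finset ι) (g : ι → X → ℝ) (hg : ∀ i, MemU (g i))
    (μ : Measure X) :
    pairing (fun x => ∑ i ∈ s, g i x) μ = ∑ i ∈ s, pairing (g i) μ := by
  unfold pairing
  rw [← lintegral_finsetSum _ fun i _ => (hg i).1.ennreal_ofReal]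
  exact lintegral_congr fun x => ENNReal.ofReal_sum_of_nonneg fun i _ => (hg i).2.1 x

lemma MemU.sum {ι : Type*} (s : Finset ι) (g : ι → X → ℝ) (hg : ∀ i, MemU (g i)) :
    MemU (fun x => ∑ i ∈ s, g i x) := by
  refine ⟨Finset.measurable_sum _ fun i _ => (hg i).1, fun x =>
    Finset.sum_nonneg fun i _ => (hg i).2.1 x, ?_, ?_⟩
  · choose C hC using fun i => (hg i).2.2.1
    exact ⟨∑ i ∈ s, C i, fun x => Finset.sum_le_sum fun i _ => hC i x⟩
  · refine Bornology.IsBounded.subset (t := ⋃ i ∈ s, Function.support (g i)) ?_ ?_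
    · exact (Bornology.isBounded_biUnion_finset s).2 fun i _ => (hg i).2.2.2
    · intro x hx
      obtain ⟨i, hi, h⟩ := Finset.exists_ne_zero_of_sum_ne_zero hx
      exact Set.mem_biUnion hi h

lemma sum_pairing_psum {m : ℕ} (g : Fin (m + 1) → X → ℝ) (hg : ∀ i, MemU (g i))
    (κ : Fin (m + 1) → Measure X) :
    ∑ j, pairing (g j) (psum κ j) =
      ∑ i, pairing (fun x => ∑ j ∈ Finset.Ici i, g j x) (κ i) := by
  simp_rw [pairing_sum_fun _ g hg, psum, pairing_sum_measure]
  exact Finset.sum_comm' (by simp)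

lemma factor_of_poisson (P : Measure (Measure X)) (hP : IsPointProcess P)
    (hP1 : IsFirstOrder P)
    (m : ℕ) (q : Fin (m + 1) → ℝ)
    (hq : ∀ i, q i ∈ Set.Ioo (0 : ℝ) 1) (hsum : ∑ i, q i = 1)
    (Th : ℝ → Measure X → Measure (Measure X)) (hThm : ∀ s, Measurable (Th s))
    (hTh : ∀ s ∈ Set.Ioo (0 : ℝ) 1, ∀ μ, IsPointMeasure μ → IsThinning s μ (Th s μ))
    (ϱ : Measure X) (hϱ : IsPoissonPP ϱ P)
    (h : (Fin (m + 1) → Measure X) → ℝ≥0∞) (hh : Measurable h) :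
    ∫⁻ μ, seqThinInt Th m (splitProbs q) μ h ∂P
              = ∫⁻ κ, h κ ∂(Measure.pi fun i => P.bind (Th (q i))) := by
  obtain ⟨O, hO, hgood⟩ := exists_cover hP.2 hP1
  have := hP.1
  have hq0 : ∀ i, 0 < q i := fun i => (hq i).1
  have hpr : ∀ i, IsProbabilityMeasure (P.bind (Th (q i))) := fun i =>
    bind_prob hP.2 (hThm _) (hTh _ (hq i))
  have hs := splitProbs_mem hq0
  have hmk := seqK_markov hO Th hThm m (splitProbs q)
  set K := seqK hO Th hThm m (splitProbs q) with hK
  set Q := P.bind K with hQ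
  set pi := Measure.pi fun i => P.bind (Th (q i)) with hpi
  have hQint : ∀ h : (Fin (m + 1) → Measure X) → ℝ≥0∞, Measurable h →
      ∫⁻ μ, seqThinInt Th m (splitProbs q) μ h ∂P = ∫⁻ κ, h κ ∂Q := by
    intro h hh
    rw [hQ, Measure.lintegral_bind K.measurable.aemeasurable hh.aemeasurable]
    refine lintegral_congr_ae ?_
    filter_upwards [hgood] with μ hμ
    exact seqThinInt_eq hO Th hThm hTh m _ hs μ hμ h hh
  rw [hQint h hh]
  have hQprob : IsProbabilityMeasure Q := by
    constructor
    rw [hQ, Measure.bind_apply MeasurableSet.univ K.measurable.aemeasurable]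
    simp
  have hQg : ∀ᵐ κ ∂Q, ∀ i, Good O (κ i) := by
    refine ae_bind_of K.measurable (measurableSet_allGood hO m) ?_
    filter_upwards [hgood] with μ hμ
    exact seqK_good hO Th hThm hTh m _ hs μ hμ
  have hpig : ∀ᵐ κ ∂pi, ∀ i, Good O (κ i) := by
    rw [ae_all_iff]
    intro i
    have h1 : ∀ᵐ ν ∂(P.bind (Th (q i))), Good O ν := by
      refine ae_bind_of (hThm _) (measurableSet_good hO) ?_
      filter_upwards [hgood] with μ hμ
      filter_upwards [(hTh _ (hq i) μ (hμ.isPointMeasure hO)).2.1] with κ hκ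
      exact IsPointMeasure.good hO hκ.1 fun n => ne_top_of_le_ne_top (hμ.ne_top n) (hκ.2 _)
    exact (Measure.quasiMeasurePreserving_eval (fun i => P.bind (Th (q i))) i).ae h1
  have hS : Q.map psum = pi.map psum := by
    refine ext_laplace _ _ fun g hg => ?_
    have hmeas : Measurable fun κ : Fin (m + 1) → Measure X =>
        expNeg (∑ i, pairing (g i) (κ i)) :=
      measurable_expNeg.comp (Finset.measurable_sum _ fun i _ =>
        (measurable_pairing (hg i).1).comp (measurable_pi_apply i))
    rw [lintegral_map hmeas measurable_psum, lintegral_map hmeas measurable_psum]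
    simp_rw [sum_pairing_psum g hg]
    set f : Fin (m + 1) → X → ℝ := fun i x => ∑ j ∈ Finset.Ici i, g j x with hf
    have hfU : ∀ i, MemU (f i) := fun i => MemU.sum _ g hg
    have hanti : ∀ x, Antitone fun i => f i x := fun x i j hij =>
      Finset.sum_le_sum_of_subset_of_nonneg (Finset.Ici_subset_Ici.2 hij)
        fun k _ _ => (hg k).2.1 x
    have hmeas2 : Measurable fun κ : Fin (m + 1) → Measure X =>
        expNeg (∑ i, pairing (f i) (κ i)) :=
      measurable_expNeg.comp (Finset.measurable_sum _ fun i _ =>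
        (measurable_pairing (hfU i).1).comp (measurable_pi_apply i))
    rw [hpi, lintegral_pi_expNeg (fun i => P.bind (Th (q i))) f hfU, ← hQint _ hmeas2]
    have hmixU : MemU (mixF q f) := (hfU 0).of_le (measurable_mixF fun i => (hfU i).1)
      (mixF_nonneg hq0 hfU) (fun x => mixF_le hq0 fun i => hanti x (Fin.zero_le i))
    have e1 : ∫⁻ μ, seqThinInt Th m (splitProbs q) μ
        (fun κ => expNeg (∑ i, pairing (f i) (κ i))) ∂P = laplaceT P (mixF q f) := by
      refine lintegral_congr_ae ?_
      filter_upwards [hgood] with μ hμ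
      simpa using seqThin_laplace hO Th hTh m q hq0 f hfU hanti μ hμ 1 one_ne_top
    rw [e1, hϱ.2.2 _ hmixU]
    have e2 : ∀ i, laplaceT (P.bind (Th (q i))) (f i) =
        expNeg (∫⁻ x, ENNReal.ofReal (q i * (1 - Real.exp (-f i x))) ∂ϱ) := by
      intro i
      have hqi : q i ∈ Set.Icc (0 : ℝ) 1 := ⟨(hq i).1.le, (hq i).2.le⟩
      rw [laplace_bind hP.2 (hThm _) (hTh _ (hq i)) (hfU i), hϱ.2.2 _ ((hfU i).thinF hqi)]
      congr 1
      refine lintegral_congr fun x => ?_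
      rw [exp_thinF hqi ((hfU i).2.1 x)]
      congr 1
      ring
    simp_rw [e2]
    rw [← expNeg_sum, ← lintegral_finsetSum _ fun i _ => by
      have := (hfU i).1
      fun_prop]
    congr 1
    refine lintegral_congr fun x => ?_
    rw [← ENNReal.ofReal_sum_of_nonneg, exp_mixF hq0, hsum]
    · congr 1
      simp_rw [mul_sub, mul_one]
      rw [Finset.sum_sub_distrib, hsum, div_one]
    · intro i _
      have := Real.exp_le_one_iff.2 (show -f i x ≤ 0 by linarith [(hfU i).2.1 x])
      exact mul_nonneg (hq0 i).le (by linarith)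
  have hback : ∀ W : Measure (Fin (m + 1) → Measure X), (∀ᵐ κ ∂W, ∀ i, Good O (κ i)) →
      (W.map psum).map (recov O) = W := by
    intro W hW
    rw [Measure.map_map (measurable_recov hO) measurable_psum]
    conv_rhs => rw [← Measure.map_id (μ := W)]
    refine Measure.map_congr ?_
    filter_upwards [hW] with κ hκ
    exact recov_psum hO hκ
  rw [← hback Q hQg, hS, hback pi hpig]

end PoissonSplitting

open MeasureTheory ENNReal PoissonSplitting

/-- Theorem 2: a point process `P` of first order is a Poisson point process if and only
if its multi-splitting law factorizes (`n = m + 1 ≥ 2` parts, `q₁ + ⋯ + q_n = 1`):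
`S^n_q(P) = Γ_{q₁}(P) ⊗ ⋯ ⊗ Γ_{q_n}(P)`; moreover, in that case `P = Π_{ν_P}`. -/
theorem statement15 {X : Type*} [MeasurableSpace X] [MetricSpace X] [PolishSpace X]
    [BorelSpace X] (P : Measure (Measure X)) (hP : IsPointProcess P)
    (hP1 : IsFirstOrder P)
    (m : ℕ) (hm : 1 ≤ m) (q : Fin (m + 1) → ℝ)
    (hq : ∀ i, q i ∈ Set.Ioo (0 : ℝ) 1) (hsum : ∑ i, q i = 1)
    (Th : ℝ → Measure X → Measure (Measure X)) (hThm : ∀ s, Measurable (Th s))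
    (hTh : ∀ s ∈ Set.Ioo (0 : ℝ) 1, ∀ μ, IsPointMeasure μ → IsThinning s μ (Th s μ)) :
    ((∃ ϱ : Measure X, IsLocallyFiniteMeasure ϱ ∧ IsPoissonPP ϱ P) ↔
      ∀ h : (Fin (m + 1) → Measure X) → ℝ≥0∞, Measurable h →
        ∫⁻ μ, seqThinInt Th m (splitProbs q) μ h ∂P
          = ∫⁻ κ, h κ ∂(Measure.pi fun i => P.bind (Th (q i))))
      ∧ ((∀ h : (Fin (m + 1) → Measure X) → ℝ≥0∞, Measurable h →
            ∫⁻ μ, seqThinInt Th m (splitProbs q) μ h ∂P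
              = ∫⁻ κ, h κ ∂(Measure.pi fun i => P.bind (Th (q i)))) →
          IsPoissonPP (momentMeasure P) P) := by
  refine ⟨⟨?_, ?_⟩, ?_⟩
  · rintro ⟨ϱ, _, hϱ⟩ h hh
    exact factor_of_poisson P hP hP1 m q hq hsum Th hThm hTh ϱ hϱ h hh
  · intro H
    exact ⟨momentMeasure P, hP1, poisson_of_factor P hP hP1 m q hq hsum Th hThm hTh H⟩
  · exact poisson_of_factor P hP hP1 m q hq hsum Th hThm hTh
end
end
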